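/- Let K belong to the class R₂ (the members of R with exactly two singular vertices, one of whose links is RP²), and let t be the singular vertex such that |lk(t,K)| is a connected sum of h copies of RP² (h odd, and the first Z₂-Betti number of lk(t,K) is maximal among links of vertices of K). Then f₁(K) ≥ 4·f₀(K) + 3h; equivalently, g₂(K) ≥ 10 + 3h. -/

import Mathlib

/-- An abstract simplicial complex on vertex set `ℕ`: a finite, downward closed
collection of nonempty finite sets of vertices. -/
structure SComplex where
  faces : Finset (Finset ℕ)
  not_empty_mem : ∅ ∉ faces
  down_closed : ∀ s ∈ faces, ∀ t ⊆ s, t ≠ ∅ → t ∈ faces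

namespace SComplex

/-- The set of vertices of the complex. -/
def vertexSet (K : SComplex) : Finset ℕ := K.faces.sup id

/-- `fnum K i` is the number of `i`-dimensional faces of `K`. -/
def fnum (K : SComplex) (i : ℕ) : ℕ := (K.faces.filter fun s => s.card = i + 1).card

/-- `g₂` for a 3-dimensional complex: `f₁ - 4 f₀ + 10`. -/
def g2 (K : SComplex) : ℤ := (K.fnum 1 : ℤ) - 4 * (K.fnum 0 : ℤ) + 10

/-- `g₂` for a 2-dimensional complex: `f₁ - 3 f₀ + 6`. -/
def g2surf (K : SComplex) : ℤ := (K.fnum 1 : ℤ) - 3 * (K.fnum 0 : ℤ) + 6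

/-- Euler characteristic of a (2-dimensional) complex. -/
def euler (K : SComplex) : ℤ := (K.fnum 0 : ℤ) - (K.fnum 1 : ℤ) + (K.fnum 2 : ℤ)

/-- The link of a face `σ`. -/
def lk (K : SComplex) (σ : Finset ℕ) : SComplex where
  faces := K.faces.filter fun γ => γ ∩ σ = ∅ ∧ γ ∪ σ ∈ K.faces
  not_empty_mem := fun h => K.not_empty_mem (Finset.mem_filter.mp h).1
  down_closed := by
    intro s hs t hts ht
    rw [Finset.mem_filter] at hs ⊢
    refine ⟨K.down_closed s hs.1 t hts ht, ?_, ?_⟩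
    · have h1 : t ∩ σ ⊆ s ∩ σ := Finset.inter_subset_inter hts (Finset.Subset.refl σ)
      rw [hs.2.1] at h1
      exact Finset.subset_empty.mp h1
    · refine K.down_closed (s ∪ σ) hs.2.2 (t ∪ σ)
        (Finset.union_subset_union hts (Finset.Subset.refl σ)) ?_
      intro hc
      exact ht (Finset.union_eq_empty.mp hc).1

/-- The (closed) star of a face `σ`. -/
def st (K : SComplex) (σ : Finset ℕ) : SComplex where
  faces := K.faces.filter fun α => α ∪ σ ∈ K.faces
  not_empty_mem := fun h => K.not_empty_mem (Finset.mem_filter.mp h).1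
  down_closed := by
    intro s hs t hts ht
    rw [Finset.mem_filter] at hs ⊢
    refine ⟨K.down_closed s hs.1 t hts ht, ?_⟩
    refine K.down_closed (s ∪ σ) hs.2 (t ∪ σ)
      (Finset.union_subset_union hts (Finset.Subset.refl σ)) ?_
    intro hc
    exact ht (Finset.union_eq_empty.mp hc).1

/-- A facet is a maximal face. -/
def IsFacet (K : SComplex) (s : Finset ℕ) : Prop :=
  s ∈ K.faces ∧ ∀ t ∈ K.faces, s ⊆ t → s = t

/-- A pure `d`-dimensional complex: all facets have `d+1` vertices. -/
def IsPure (K : SComplex) (d : ℕ) : Prop :=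
  K.faces.Nonempty ∧ ∀ s, K.IsFacet s → s.card = d + 1

/-- Two facets are adjacent if they share a codimension-one face. -/
def FacetAdj (K : SComplex) (s t : Finset ℕ) : Prop :=
  K.IsFacet s ∧ K.IsFacet t ∧ (s ∩ t).card + 1 = s.card

/-- Strong connectedness: any two facets are joined by a chain of facets, consecutive
ones sharing a codimension-one face. -/
def StronglyConnected (K : SComplex) : Prop :=
  ∀ s t, K.IsFacet s → K.IsFacet t → Relation.ReflTransGen K.FacetAdj s t

/-- Two vertices are adjacent if they span an edge. -/
def VertAdj (K : SComplex) (u v : ℕ) : Prop := ({u, v} : Finset ℕ) ∈ K.faces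

/-- Connectedness of a complex (via its 1-skeleton). -/
def Conn (K : SComplex) : Prop :=
  K.faces.Nonempty ∧
    ∀ u v, {u} ∈ K.faces → {v} ∈ K.faces → Relation.ReflTransGen K.VertAdj u v

/-- A normal `d`-pseudomanifold: pure, strongly connected, every `(d-1)`-face is in
exactly two facets, and links of faces of dimension at most `d-2` are connected. -/
def IsNormalPseudomanifold (K : SComplex) (d : ℕ) : Prop :=
  K.IsPure d ∧ K.StronglyConnected ∧
    (∀ s ∈ K.faces, s.card = d →
      (K.faces.filter fun F => F.card = d + 1 ∧ s ⊆ F).card = 2) ∧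
    (∀ s ∈ K.faces, s.card ≤ d - 1 → (K.lk s).Conn)

/-- The geometric realization `|K|`, as a subspace of `ℕ → ℝ`. -/
def realSpace (K : SComplex) : Set (ℕ → ℝ) :=
  {w | (∀ v, 0 ≤ w v) ∧ ∃ s ∈ K.faces, (∀ v, w v ≠ 0 → v ∈ s) ∧ ∑ v ∈ s, w v = 1}

/-- The link of the vertex `v` triangulates the `(d-1)`-sphere. -/
def HasSphereLink (K : SComplex) (d : ℕ) (v : ℕ) : Prop :=
  Nonempty (↥((K.lk {v}).realSpace) ≃ₜ
    ↥(Metric.sphere (0 : EuclideanSpace ℝ (Fin d)) 1))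

/-- A singular vertex of a normal 3-pseudomanifold: its link is not a 2-sphere. -/
def IsSingular (K : SComplex) (v : ℕ) : Prop :=
  {v} ∈ K.faces ∧ ¬ K.HasSphereLink 3 v

/-- `d(σ)`: the number of vertices of the link of `σ`. -/
def deg (K : SComplex) (σ : Finset ℕ) : ℕ := (K.lk σ).fnum 0

/-- The boundary complex of the simplex on vertex set `s`: all nonempty proper subsets. -/
def properFaces (s : Finset ℕ) : Finset (Finset ℕ) :=
  s.powerset.filter fun t => t ≠ ∅ ∧ t ≠ s

/-- All nonempty faces of the simplex on vertex set `s`. -/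
def simplexFaces (s : Finset ℕ) : Finset (Finset ℕ) :=
  s.powerset.filter fun t => t ≠ ∅

/-- Operation (A): a bistellar 2-move on an edge `uv` with `lk(uv) = ∂(abc)`, `abc ∉ K`. -/
def BistellarTwoMove (K K' : SComplex) : Prop :=
  ∃ u v a b c : ℕ,
    ({u, v} : Finset ℕ) ∈ K.faces ∧ u ≠ v ∧
    ({a, b, c} : Finset ℕ).card = 3 ∧
    u ∉ ({a, b, c} : Finset ℕ) ∧ v ∉ ({a, b, c} : Finset ℕ) ∧
    (K.lk {u, v}).faces = properFaces {a, b, c} ∧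
    ({a, b, c} : Finset ℕ) ∉ K.faces ∧
    K'.faces = ((K.faces.filter fun α => ¬ ({u, v} : Finset ℕ) ⊆ α) ∪
      simplexFaces (insert u {a, b, c})) ∪ simplexFaces (insert v {a, b, c})

/-- The faces of the boundary complex of a pure `d`-dimensional complex with face set `F`:
faces contained in some `(d-1)`-face lying in exactly one facet. -/
def bdryFaces (F : Finset (Finset ℕ)) (d : ℕ) : Finset (Finset ℕ) :=
  F.filter fun s => ∃ r ∈ F, s ⊆ r ∧ r.card = d ∧
    (F.filter fun t => t.card = d + 1 ∧ r ⊆ t).card = 1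

/-- The faces of the cone with apex `w` over the complex with face set `F`. -/
def coneFaces (w : ℕ) (F : Finset (Finset ℕ)) : Finset (Finset ℕ) :=
  (F ∪ F.image (insert w)) ∪ {{w}}

/-- `K₁` is obtained from the normal `d`-pseudomanifold `K` by contracting the
edge `uv` (satisfying the link condition): delete all faces containing `u` or `v`
and cone off the boundary of the result with a new vertex `w`. -/
def EdgeContractionAt (d : ℕ) (K : SComplex) (u v : ℕ) (K₁ : SComplex) : Prop :=
  ({u, v} : Finset ℕ) ∈ K.faces ∧ u ≠ v ∧
  (K.lk {u}).faces ∩ (K.lk {v}).faces = (K.lk {u, v}).faces ∧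
  ∃ w, w ∉ K.vertexSet ∧
    K₁.faces = (K.faces.filter fun α => u ∉ α ∧ v ∉ α) ∪
      coneFaces w (bdryFaces (K.faces.filter fun α => u ∉ α ∧ v ∉ α) d)

/-- Operation (B): an edge contraction in a 3-dimensional complex. -/
def EdgeContraction (K K₁ : SComplex) : Prop := ∃ u v, EdgeContractionAt 3 K u v K₁

/-- The class `R`: normal 3-pseudomanifolds with one or two singular vertices such that
(i) if `K` contains the boundary of a 3-simplex then it contains the 3-simplex and
(ii) no normal 3-pseudomanifold with smaller `g₂` is obtained from `K` by a
bistellar 2-move, an edge contraction, an edge expansion followed by a bistellar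
2-move, or an edge expansion followed by an edge contraction. -/
def InClassR (K : SComplex) : Prop :=
  K.IsNormalPseudomanifold 3 ∧
  1 ≤ {v | K.IsSingular v}.ncard ∧ {v | K.IsSingular v}.ncard ≤ 2 ∧
  (∀ s : Finset ℕ, s.card = 4 → (∀ t ∈ properFaces s, t ∈ K.faces) → s ∈ K.faces) ∧
  (∀ K' : SComplex, K'.IsNormalPseudomanifold 3 →
    (BistellarTwoMove K K' ∨ EdgeContraction K K' ∨
      (∃ M, EdgeContraction M K ∧ BistellarTwoMove M K') ∨
      (∃ M, EdgeContraction M K ∧ EdgeContraction M K')) →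
    K.g2 ≤ K'.g2)

end SComplex


namespace SComplex

def LAdj (K : SComplex) (s : Finset ℕ) (x y : ℕ) : Prop :=
  x ∉ s ∧ y ∉ s ∧ insert x (insert y s) ∈ K.faces

structure NP (K : SComplex) : Prop where
  ne : K.faces.Nonempty
  pure : ∀ s ∈ K.faces, ∃ F ∈ K.faces, s ⊆ F ∧ F.card = 4
  le4 : ∀ s ∈ K.faces, s.card ≤ 4
  two : ∀ s ∈ K.faces, s.card = 3 →
    ∃ p q, p ≠ q ∧ ∀ r, (r ∉ s ∧ insert r s ∈ K.faces) ↔ (r = p ∨ r = q)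
  conn : ∀ s : Finset ℕ, s.card ≤ 2 → ∀ x y, x ∉ s → y ∉ s → insert x s ∈ K.faces →
    insert y s ∈ K.faces → Relation.ReflTransGen (K.LAdj s) x y

theorem mem_of_subset {K : SComplex} {s t : Finset ℕ} (hs : s ∈ K.faces) (h : t ⊆ s)
    (hne : t.Nonempty) : t ∈ K.faces :=
  K.down_closed s hs t h hne.ne_empty

theorem face_nonempty {K : SComplex} {s : Finset ℕ} (hs : s ∈ K.faces) : s.Nonempty := by
  rw [Finset.nonempty_iff_ne_empty]
  rintro rfl
  exact K.not_empty_mem hs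

theorem mem_lk {K : SComplex} {σ γ : Finset ℕ} :
    γ ∈ (K.lk σ).faces ↔ γ ∈ K.faces ∧ γ ∩ σ = ∅ ∧ γ ∪ σ ∈ K.faces := by
  simp [lk]

theorem exists_facet {K : SComplex} {s : Finset ℕ} (hs : s ∈ K.faces) :
    ∃ F, K.IsFacet F ∧ s ⊆ F := by
  obtain ⟨F, hF, hmax⟩ := Finset.exists_maximal
    (s := K.faces.filter (fun F => s ⊆ F)) ⟨s, by simp [hs]⟩
  · simp only [Finset.mem_filter] at hF hmax
    refine ⟨F, ⟨hF.1, fun t ht hFt => ?_⟩, hF.2⟩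
    exact Finset.Subset.antisymm hFt (hmax ⟨ht, hF.2.trans hFt⟩ hFt)

theorem lk_singleton_mem {K : SComplex} {σ : Finset ℕ} {x : ℕ} :
    {x} ∈ (K.lk σ).faces ↔ x ∉ σ ∧ insert x σ ∈ K.faces := by
  rw [mem_lk]
  constructor
  · rintro ⟨-, h1, h2⟩
    refine ⟨fun hx => ?_, h2⟩
    have : x ∈ ({x} ∩ σ : Finset ℕ) := by simp [hx]
    rw [h1] at this; simp at this
  · rintro ⟨h1, h2⟩
    refine ⟨mem_of_subset h2 (by simp) (by simp), ?_, h2⟩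
    ext z; simp; rintro rfl; exact h1

theorem lk_vertAdj {K : SComplex} {σ : Finset ℕ} {x y : ℕ} :
    (K.lk σ).VertAdj x y ↔ K.LAdj σ x y := by
  unfold VertAdj LAdj
  rw [mem_lk]
  have e : ({x, y} : Finset ℕ) ∪ σ = insert x (insert y σ) := by ext; simp
  rw [e]
  constructor
  · rintro ⟨-, h1, h2⟩
    refine ⟨fun hx => ?_, fun hx => ?_, h2⟩
    · have : x ∈ ({x, y} ∩ σ : Finset ℕ) := by simp [hx]
      rw [h1] at this; simp at this
    · have : y ∈ ({x, y} ∩ σ : Finset ℕ) := by simp [hx]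
      rw [h1] at this; simp at this
  · rintro ⟨h1, h2, h3⟩
    refine ⟨mem_of_subset h3 (by intro z; simp; tauto) (by simp), ?_, h3⟩
    ext z; simp; rintro (rfl | rfl) <;> assumption

theorem NP.facet_iff {K : SComplex} (h : K.NP) {s : Finset ℕ} :
    K.IsFacet s ↔ s ∈ K.faces ∧ s.card = 4 := by
  constructor
  · rintro ⟨h1, h2⟩
    obtain ⟨F, hF, hs, hc⟩ := h.pure s h1
    rw [h2 F hF hs]
    exact ⟨hF, hc⟩
  · rintro ⟨h1, h2⟩
    refine ⟨h1, fun t ht hst => Finset.eq_of_subset_of_card_le hst ?_⟩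
    rw [h2]; exact h.le4 t ht

theorem insert_of_card {s F : Finset ℕ} {k : ℕ} (h : s ⊆ F) (hs : s.card = k)
    (hF : F.card = k + 1) : ∃ p, p ∉ s ∧ F = insert p s := by
  have : (F \ s).card = 1 := by
    rw [Finset.card_sdiff_of_subset h]; omega
  obtain ⟨p, hp⟩ := Finset.card_eq_one.mp this
  refine ⟨p, ?_, ?_⟩
  · have : p ∈ F \ s := by rw [hp]; simp
    exact (Finset.mem_sdiff.mp this).2
  · rw [Finset.insert_eq, ← hp]; exact (Finset.sdiff_union_of_subset h).symm

theorem NP.chain {K : SComplex} (h : K.NP) : ∀ k : ℕ, k ≤ 3 → ∀ s : Finset ℕ, s.card + k = 3 →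
    ∀ F G, K.IsFacet F → K.IsFacet G → s ⊆ F → s ⊆ G →
    Relation.ReflTransGen K.FacetAdj F G := by
  intro k
  induction k with
  | zero =>
    intro _ s hs F G hF hG hsF hsG
    by_cases hFG : F = G
    · rw [hFG]
    refine Relation.ReflTransGen.single ⟨hF, hG, ?_⟩
    have c1 := (h.facet_iff.mp hF).2
    have c2 := (h.facet_iff.mp hG).2
    rw [c1]
    have h1 : s.card ≤ (F ∩ G).card := Finset.card_le_card (Finset.subset_inter hsF hsG)
    have h2 : (F ∩ G).card ≤ 4 := c1 ▸ Finset.card_le_card Finset.inter_subset_left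
    by_contra hne
    have h3 : (F ∩ G).card = 4 := by omega
    have h4 : F ∩ G = F := Finset.eq_of_subset_of_card_le Finset.inter_subset_left (by omega)
    have h5 : F ∩ G = G := Finset.eq_of_subset_of_card_le Finset.inter_subset_right (by omega)
    exact hFG (h4.symm.trans h5)
  | succ k ih =>
    intro hk s hs F G hF hG hsF hsG
    have c1 := (h.facet_iff.mp hF).2
    have c2 := (h.facet_iff.mp hG).2
    obtain ⟨x, hxF, hxs⟩ := Finset.exists_mem_notMem_of_card_lt_card (s := s) (t := F) (by omega)
    obtain ⟨y, hyG, hys⟩ := Finset.exists_mem_notMem_of_card_lt_card (s := s) (t := G) (by omega)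
    have key : ∀ y, Relation.ReflTransGen (K.LAdj s) x y → y ∉ s → ∀ G, K.IsFacet G →
        insert y s ⊆ G → Relation.ReflTransGen K.FacetAdj F G := by
      intro y hy
      induction hy with
      | refl =>
        intro _ G hG hs2
        exact ih (by omega) (insert x s) (by rw [Finset.card_insert_of_notMem hxs]; omega) F G hF hG
          (Finset.insert_subset hxF hsF) hs2
      | tail hprev hyz IH =>
        rename_i b c
        intro hc G hG hs2
        obtain ⟨H, hH, hH2⟩ := exists_facet hyz.2.2
        refine (IH hyz.1 H hH ((Finset.insert_subset_insert _ (Finset.subset_insert _ _)).trans hH2)).trans ?_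
        exact ih (by omega) (insert c s) (by rw [Finset.card_insert_of_notMem hc]; omega) H G hH hG
          ((Finset.subset_insert _ _).trans hH2) hs2
    refine key y ?_ hys G hG (Finset.insert_subset hyG hsG)
    refine h.conn s (by omega) x y hxs hys ?_ ?_
    · exact mem_of_subset hF.1 (Finset.insert_subset hxF hsF) (by simp)
    · exact mem_of_subset hG.1 (Finset.insert_subset hyG hsG) (by simp)

theorem NP.toNPM {K : SComplex} (h : K.NP) : K.IsNormalPseudomanifold 3 := by
  refine ⟨⟨h.ne, fun s hs => (h.facet_iff.mp hs).2⟩, ?_, ?_, ?_⟩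
  · intro s t hs ht
    exact h.chain 3 le_rfl ∅ (by simp) s t hs ht (by simp) (by simp)
  · intro s hs hc
    obtain ⟨p, q, hpq, hr⟩ := h.two s hs hc
    have : (K.faces.filter fun F => F.card = 3 + 1 ∧ s ⊆ F) = {insert p s, insert q s} := by
      ext F
      simp only [Finset.mem_filter, Finset.mem_insert, Finset.mem_singleton]
      constructor
      · rintro ⟨h1, h2, h3⟩
        obtain ⟨r, hrs, rfl⟩ := insert_of_card h3 hc h2
        rcases (hr r).mp ⟨hrs, h1⟩ with rfl | rfl <;> simp
      · have hp := (hr p).mpr (Or.inl rfl)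
        have hq := (hr q).mpr (Or.inr rfl)
        rintro (rfl | rfl)
        · exact ⟨hp.2, by rw [Finset.card_insert_of_notMem hp.1, hc], Finset.subset_insert _ _⟩
        · exact ⟨hq.2, by rw [Finset.card_insert_of_notMem hq.1, hc], Finset.subset_insert _ _⟩
    rw [this, Finset.card_pair]
    intro he
    have hp := (hr p).mpr (Or.inl rfl)
    have : p ∈ insert q s := he ▸ Finset.mem_insert_self p s
    rcases Finset.mem_insert.mp this with h1 | h1
    · exact hpq h1
    · exact hp.1 h1
  · intro s hs hc
    constructor
    · obtain ⟨F, hF, hsF, hF4⟩ := h.pure s hs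
      obtain ⟨x, hxF, hxs⟩ := Finset.exists_mem_notMem_of_card_lt_card (s := s) (t := F) (by omega)
      exact ⟨{x}, lk_singleton_mem.mpr ⟨hxs, mem_of_subset hF (Finset.insert_subset hxF hsF) (by simp)⟩⟩
    · intro u v hu hv
      rw [lk_singleton_mem] at hu hv
      have := h.conn s (by omega) u v hu.1 hv.1 hu.2 hv.2
      exact Relation.ReflTransGen.mono (fun a b hab => lk_vertAdj.mpr hab) _ _ this

theorem NP.ofNPM {K : SComplex} (h : K.IsNormalPseudomanifold 3) : K.NP := by
  obtain ⟨⟨hne, hp⟩, hsc, htwo, hconn⟩ := h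
  have hpure : ∀ s ∈ K.faces, ∃ F ∈ K.faces, s ⊆ F ∧ F.card = 4 := by
    intro s hs
    obtain ⟨F, hF, hsF⟩ := exists_facet hs
    exact ⟨F, hF.1, hsF, hp F hF⟩
  refine ⟨hne, hpure, ?_, ?_, ?_⟩
  · intro s hs
    obtain ⟨F, hF, hsF, hc⟩ := hpure s hs
    exact hc ▸ Finset.card_le_card hsF
  · intro s hs hc
    obtain ⟨F, G, hFG, he⟩ := Finset.card_eq_two.mp (htwo s hs hc)
    have hF : F ∈ (K.faces.filter fun F => F.card = 3 + 1 ∧ s ⊆ F) := by rw [he]; simp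
    have hG : G ∈ (K.faces.filter fun F => F.card = 3 + 1 ∧ s ⊆ F) := by rw [he]; simp
    rw [Finset.mem_filter] at hF hG
    obtain ⟨p, hps, rfl⟩ := insert_of_card hF.2.2 hc hF.2.1
    obtain ⟨q, hqs, rfl⟩ := insert_of_card hG.2.2 hc hG.2.1
    refine ⟨p, q, ?_, ?_⟩
    · rintro rfl; exact hFG rfl
    · intro r
      constructor
      · rintro ⟨h1, h2⟩
        have : insert r s ∈ (K.faces.filter fun F => F.card = 3 + 1 ∧ s ⊆ F) := by
          rw [Finset.mem_filter]
          exact ⟨h2, by rw [Finset.card_insert_of_notMem h1, hc], Finset.subset_insert _ _⟩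
        rw [he] at this
        simp only [Finset.mem_insert, Finset.mem_singleton] at this
        rcases this with h3 | h3
        · have : r ∈ insert p s := h3 ▸ Finset.mem_insert_self r s
          rcases Finset.mem_insert.mp this with h4 | h4
          · exact Or.inl h4
          · exact absurd h4 h1
        · have : r ∈ insert q s := h3 ▸ Finset.mem_insert_self r s
          rcases Finset.mem_insert.mp this with h4 | h4
          · exact Or.inr h4
          · exact absurd h4 h1
      · rintro (rfl | rfl)
        · exact ⟨hps, hF.1⟩
        · exact ⟨hqs, hG.1⟩
  · intro s hs x y hx hy hxs hys
    by_cases hs0 : s = ∅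
    · subst hs0
      obtain ⟨F, hF, hxF⟩ := exists_facet hxs
      obtain ⟨G, hG, hyG⟩ := exists_facet hys
      have key : ∀ G, Relation.ReflTransGen K.FacetAdj F G → ∀ y ∈ G,
          Relation.ReflTransGen (K.LAdj ∅) x y := by
        intro G hG
        induction hG with
        | refl =>
          intro y hy
          refine Relation.ReflTransGen.single ⟨hx, by simp, ?_⟩
          refine mem_of_subset hF.1 ?_ (by simp)
          exact Finset.insert_subset (hxF (by simp)) (by simpa using hy)
        | tail hprev hyz IH =>
          rename_i A B
          intro y hy
          have h3 : (A ∩ B).Nonempty := by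
            rw [← Finset.card_pos]
            have := hp A hyz.1
            have := hyz.2.2
            omega
          obtain ⟨z, hz⟩ := h3
          rw [Finset.mem_inter] at hz
          refine (IH z hz.1).tail ⟨by simp, by simp, ?_⟩
          refine mem_of_subset hyz.2.1.1 ?_ (by simp)
          exact Finset.insert_subset hz.2 (by simpa using hy)
      exact key G (hsc F G hF hG) y (hyG (by simp))
    · have hsK : s ∈ K.faces := K.down_closed _ hxs s (Finset.subset_insert _ _) hs0
      have := (hconn s hsK (by omega)).2 x y (lk_singleton_mem.mpr ⟨hx, hxs⟩) (lk_singleton_mem.mpr ⟨hy, hys⟩)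
      exact Relation.ReflTransGen.mono (fun a b hab => lk_vertAdj.mp hab) _ _ this

end SComplex

namespace SComplex

theorem cyc_abs (C : Finset ℕ) (r : ℕ → ℕ → Prop) (hsymm : ∀ a b, r a b → r b a)
    (hirr : ∀ a, ¬ r a a) (hC : ∀ a b, r a b → a ∈ C)
    (hdeg : ∀ c ∈ C, ∃ p q, p ≠ q ∧ ∀ x, r c x ↔ (x = p ∨ x = q))
    (hconn : ∀ x ∈ C, ∀ y ∈ C, Relation.ReflTransGen r x y)
    (S : Finset ℕ) (hSC : S ⊆ C) (hS : S.Nonempty) (p : ℕ) (hp : p ∉ S)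
    (hcl : ∀ a ∈ S, ∀ b, r a b → b ∈ S ∨ b = p) :
    ∀ y ∈ C, y ∈ S ∨ y = p := by
  classical
  have closed : ∀ T : Finset ℕ, (∃ x ∈ T, x ∈ C) → (∀ a ∈ T, ∀ b, r a b → b ∈ T) → ∀ y ∈ C, y ∈ T := by
    rintro T ⟨x, hxT, hxC⟩ hT y hy
    have := hconn x hxC y hy
    induction this with
    | refl => exact hxT
    | tail h1 h2 ih => exact hT _ (ih (hC _ _ h2)) _ h2
  obtain ⟨x0, hx0⟩ := hS
  -- parity
  have e1 : (∑ s ∈ S, ∑ b ∈ S, if r s b then (1 : ZMod 2) else 0) = 0 := by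
    rw [← Finset.sum_product']
    refine Finset.sum_involution (fun x _ => (x.2, x.1)) ?_ ?_ ?_ ?_
    · rintro ⟨a, b⟩ _
      by_cases h : r a b
      · have h' := hsymm _ _ h
        simp only [h, h', if_true]; decide
      · have h' : ¬ r b a := fun h2 => h (hsymm _ _ h2)
        simp only [h, h', if_false]; decide
    · rintro ⟨a, b⟩ _ h1 h2
      simp only [Prod.mk.injEq] at h2
      obtain ⟨h2, _⟩ := h2
      subst h2
      simp [hirr] at h1
    · rintro ⟨a, b⟩ h
      simp only [Finset.mem_product] at h ⊢
      exact ⟨h.2, h.1⟩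
    · rintro ⟨a, b⟩ _; rfl
  have e2 : ∀ s ∈ S, (∑ b ∈ S, if r s b then (1 : ZMod 2) else 0) + (if r s p then 1 else 0) = 0 := by
    intro s hs
    have : (∑ b ∈ insert p S, if r s b then (1 : ZMod 2) else 0) = 0 := by
      obtain ⟨a, b, hab, h⟩ := hdeg s (hSC hs)
      have ha : a ∈ insert p S := by
        have := hcl s hs a ((h a).mpr (Or.inl rfl)); simp; tauto
      have hb : b ∈ insert p S := by
        have := hcl s hs b ((h b).mpr (Or.inr rfl)); simp; tauto
      rw [← Finset.sum_subset (s₁ := {a, b})]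
      · rw [Finset.sum_pair hab, if_pos ((h a).mpr (Or.inl rfl)), if_pos ((h b).mpr (Or.inr rfl))]
        decide
      · intro z; simp only [Finset.mem_insert, Finset.mem_singleton]; rintro (rfl | rfl)
        · simpa using ha
        · simpa using hb
      · intro x _ hx
        rw [if_neg]; rw [h]; simpa using hx
    rw [Finset.sum_insert hp] at this
    rw [add_comm]; exact this
  have e3 : (∑ s ∈ S, if r s p then (1 : ZMod 2) else 0) = 0 := by
    have := Finset.sum_congr rfl e2
    rw [Finset.sum_add_distrib, e1] at this
    simpa using this
  by_cases hne : ∃ s ∈ S, r s p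
  · obtain ⟨s, hs, hsp⟩ := hne
    have hpC : p ∈ C := hC _ _ (hsymm _ _ hsp)
    obtain ⟨a, b, hab, h⟩ := hdeg p hpC
    have key : ∀ x, r p x → x ∈ S := by
      by_contra hcon
      push Not at hcon
      obtain ⟨x, hx, hxS⟩ := hcon
      have : ∀ z ∈ S, r z p ↔ z = s := by
        intro z hz
        constructor
        · intro hzp
          have h1 := (h z).mp (hsymm _ _ hzp)
          have h2 := (h s).mp (hsymm _ _ hsp)
          have h3 := (h x).mp hx
          have h4 : z ≠ x := by rintro rfl; exact hxS hz
          have h5 : s ≠ x := by rintro rfl; exact hxS hs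
          rcases h1 with h1 | h1 <;> rcases h2 with h2 | h2 <;> rcases h3 with h3 | h3 <;>
            subst h1 <;> simp_all
        · rintro rfl; exact hsp
      rw [Finset.sum_congr rfl (g := fun z => if z = s then (1 : ZMod 2) else 0)
        (fun z hz => by simp [this z hz])] at e3
      simp [hs] at e3
    have := closed (insert p S) ⟨p, by simp, hpC⟩ (by
      intro a ha b hb
      rcases Finset.mem_insert.mp ha with rfl | ha
      · exact Finset.mem_insert_of_mem (key b hb)
      · have := hcl a ha b hb; simp; tauto)
    intro y hy
    have := this y hy; simp at this; tauto
  · push Not at hne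
    intro y hy
    left
    refine closed S ⟨x0, hx0, hSC hx0⟩ ?_ y hy
    intro a ha b hb
    rcases hcl a ha b hb with h | rfl
    · exact h
    · exact absurd hb (hne a ha)

theorem mem_vertexSet {K : SComplex} {x : ℕ} : x ∈ K.vertexSet ↔ {x} ∈ K.faces := by
  unfold vertexSet
  rw [Finset.mem_sup]
  constructor
  · rintro ⟨s, hs, hx⟩
    exact mem_of_subset hs (by simpa using hx) (by simp)
  · intro h
    exact ⟨_, h, by simp⟩

theorem face_subset_vertexSet {K : SComplex} {s : Finset ℕ} (hs : s ∈ K.faces) :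
    s ⊆ K.vertexSet := by
  intro x hx
  exact mem_vertexSet.mpr (mem_of_subset hs (by simpa using hx) (by simp))

theorem LAdj.symm {K : SComplex} {s : Finset ℕ} {x y : ℕ} (h : K.LAdj s x y) : K.LAdj s y x :=
  ⟨h.2.1, h.1, by rw [Finset.insert_comm]; exact h.2.2⟩

theorem LAdj.left {K : SComplex} {s : Finset ℕ} {x y : ℕ} (h : K.LAdj s x y) : insert x s ∈ K.faces :=
  mem_of_subset h.2.2 (Finset.insert_subset_insert _ (Finset.subset_insert _ _)) (by simp)

theorem LAdj.right {K : SComplex} {s : Finset ℕ} {x y : ℕ} (h : K.LAdj s x y) : insert y s ∈ K.faces :=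
  h.symm.left

/-- edge links behave like cycles -/
theorem NP.cycle {K : SComplex} (h : K.NP) {s : Finset ℕ} (hs : s.card = 2) (P : ℕ → Prop) (p : ℕ)
    (hex : ∃ x, x ∉ s ∧ insert x s ∈ K.faces ∧ P x) (hp : ¬ P p)
    (hcl : ∀ a b, P a → a ≠ b → K.LAdj s a b → P b ∨ b = p) :
    ∀ y, y ∉ s → insert y s ∈ K.faces → P y ∨ y = p := by
  classical
  intro y hy hys
  set C := K.vertexSet.filter (fun x => x ∉ s ∧ insert x s ∈ K.faces) with hC
  have memC : ∀ x, x ∈ C ↔ x ∉ s ∧ insert x s ∈ K.faces := by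
    intro x
    rw [hC, Finset.mem_filter]
    refine ⟨fun h => h.2, fun h => ⟨face_subset_vertexSet h.2 (by simp), h⟩⟩
  have := cyc_abs C (fun a b => a ≠ b ∧ K.LAdj s a b) (fun a b h => ⟨h.1.symm, h.2.symm⟩)
    (fun a h => h.1 rfl) (fun a b h => (memC a).mpr ⟨h.2.1, h.2.left⟩)
    ?_ ?_ (C.filter P) (Finset.filter_subset _ _) ?_ p ?_ ?_ y ((memC y).mpr ⟨hy, hys⟩)
  · simpa [(memC y).mpr ⟨hy, hys⟩] using this
  · intro c hc
    rw [memC] at hc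
    obtain ⟨p, q, hpq, hr⟩ := h.two (insert c s) hc.2 (by rw [Finset.card_insert_of_notMem hc.1, hs])
    refine ⟨p, q, hpq, fun x => ?_⟩
    rw [← hr x]
    unfold LAdj
    simp only [Finset.mem_insert, not_or]
    rw [Finset.insert_comm c x s]
    constructor
    · rintro ⟨h1, h2, h3, h4⟩; exact ⟨⟨Ne.symm h1, h3⟩, h4⟩
    · rintro ⟨⟨h1, h3⟩, h4⟩; exact ⟨Ne.symm h1, hc.1, h3, h4⟩
  · intro x hx y hy
    rw [memC] at hx hy
    have := h.conn s (by omega) x y hx.1 hy.1 hx.2 hy.2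
    induction this with
    | refl => exact Relation.ReflTransGen.refl
    | tail h1 h2 ih =>
      rename_i b c
      by_cases hbc : b = c
      · subst hbc; exact ih hy
      · exact (ih ⟨h2.1, h2.left⟩).tail ⟨hbc, h2⟩
  · obtain ⟨x, hx1, hx2, hx3⟩ := hex
    exact ⟨x, by rw [Finset.mem_filter, memC]; exact ⟨⟨hx1, hx2⟩, hx3⟩⟩
  · simp [hp]
  · intro a ha b hab
    rw [Finset.mem_filter] at ha
    rcases hcl a b ha.2 hab.1 hab.2 with h1 | h1
    · left; rw [Finset.mem_filter, memC]; exact ⟨⟨hab.2.2.1, hab.2.right⟩, h1⟩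
    · exact Or.inr h1

/-- an edge link or a vertex link minus a vertex is connected -/
theorem NP.avoid {K : SComplex} (h : K.NP) {s : Finset ℕ} (hs : s.card = 1 ∨ s.card = 2) (v : ℕ)
    {x y : ℕ} (hx : x ∉ s) (hy : y ∉ s) (hxs : insert x s ∈ K.faces) (hys : insert y s ∈ K.faces)
    (hxv : x ≠ v) (hyv : y ≠ v) :
    Relation.ReflTransGen (fun a b => K.LAdj s a b ∧ a ≠ v ∧ b ≠ v) x y := by
  rcases hs with hs | hs
  · have hpath := h.conn s (by omega) x y hx hy hxs hys
    have key : ∀ y, Relation.ReflTransGen (K.LAdj s) x y →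
      (y ≠ v → Relation.ReflTransGen (fun a b => K.LAdj s a b ∧ a ≠ v ∧ b ≠ v) x y) ∧
      (y = v → ∀ z, z ≠ v → K.LAdj s v z → Relation.ReflTransGen (fun a b => K.LAdj s a b ∧ a ≠ v ∧ b ≠ v) x z) := by
      intro y hy
      induction hy with
      | refl => exact ⟨fun _ => Relation.ReflTransGen.refl, fun h => absurd h hxv⟩
      | tail h1 h2 ih =>
        rename_i b c
        constructor
        · intro hc
          by_cases hb : b = v
          · subst hb; exact ih.2 rfl c hc h2
          · exact (ih.1 hb).tail ⟨h2, hb, hc⟩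
        · rintro rfl z hz hvz
          by_cases hb : b = c
          · exact ih.2 hb z hz hvz
          · refine (ih.1 hb).trans ?_
            have hcs : c ∉ s := h2.2.1
            have := h.conn (insert c s) (by rw [Finset.card_insert_of_notMem hcs]; omega) b z
              (by simp [hb, h2.1]) (by simp [hz, hvz.2.1]) h2.2.2 (by rw [Finset.insert_comm]; exact hvz.2.2)
            refine Relation.ReflTransGen.mono ?_ _ _ this
            rintro p q ⟨h3, h4, h5⟩
            simp only [Finset.mem_insert, not_or] at h3 h4
            refine ⟨⟨h3.2, h4.2, mem_of_subset h5 ?_ (by simp)⟩, h3.1, h4.1⟩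
            exact Finset.insert_subset_insert _ (Finset.insert_subset_insert _ (Finset.subset_insert _ _))
    exact (key y hpath).1 hyv
  · have := h.cycle hs (fun z => Relation.ReflTransGen (fun a b => K.LAdj s a b ∧ a ≠ v ∧ b ≠ v) x z) v
      ⟨x, hx, hxs, Relation.ReflTransGen.refl⟩ ?_ ?_ y hy hys
    · exact this.resolve_right hyv
    · intro hc
      rcases Relation.ReflTransGen.cases_tail hc with h1 | ⟨b, h1, h2⟩
      · exact hxv h1.symm
      · exact h2.2.2 rfl
    · intro a b ha hab hadj
      by_cases hb : b = v
      · exact Or.inr hb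
      left
      have hav : a ≠ v := by
        rintro rfl
        rcases Relation.ReflTransGen.cases_tail ha with h1 | ⟨b, h1, h2⟩
        · exact hxv h1.symm
        · exact h2.2.2 rfl
      exact ha.tail ⟨hadj, hav, hb⟩

/-- a facet containing `s` and avoiding `v` -/
theorem NP.facet_avoid {K : SComplex} (h : K.NP) {s : Finset ℕ} (hs : s ∈ K.faces) {v : ℕ} (hv : v ∉ s) :
    ∃ F ∈ K.faces, s ⊆ F ∧ F.card = 4 ∧ v ∉ F := by
  obtain ⟨F, hF, hsF, hc⟩ := h.pure s hs
  by_cases hvF : v ∈ F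
  · have hc3 : (F.erase v).card = 3 := by rw [Finset.card_erase_of_mem hvF, hc]
    have hF3 : F.erase v ∈ K.faces := mem_of_subset hF (Finset.erase_subset _ _)
      (by rw [← Finset.card_pos]; omega)
    obtain ⟨p, q, hpq, hr⟩ := h.two _ hF3 hc3
    have : ∃ r, r ≠ v ∧ r ∉ F.erase v ∧ insert r (F.erase v) ∈ K.faces := by
      by_cases hpv : p = v
      · exact ⟨q, fun e => hpq (hpv.trans e.symm), (hr q).mpr (Or.inr rfl)⟩
      · exact ⟨p, hpv, (hr p).mpr (Or.inl rfl)⟩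
    obtain ⟨r, hrv, hr1, hr2⟩ := this
    refine ⟨_, hr2, ?_, ?_, ?_⟩
    · exact (Finset.subset_erase.mpr ⟨hsF, hv⟩).trans (Finset.subset_insert _ _)
    · rw [Finset.card_insert_of_notMem hr1, hc3]
    · simp [Ne.symm hrv]
  · exact ⟨F, hF, hsF, hc, hvF⟩

end SComplex

namespace SComplex

theorem bdry_aux {K : SComplex} (h : K.NP) {u v : ℕ}
    (hl : ∀ r : Finset ℕ, r.card = 3 → u ∉ r → v ∉ r → insert u r ∈ K.faces →
      insert v r ∈ K.faces → u = v) (A : Finset (Finset ℕ))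
    (hA : ∀ α, α ∈ A ↔ α ∈ K.faces ∧ u ∉ α ∧ v ∉ α) {s : Finset ℕ} (hs : s ∈ K.faces)
    (hu : u ∉ s) (hv : v ∉ s) (hus : insert u s ∈ K.faces) : s ∈ bdryFaces A 3 := by
  have : ∃ F ∈ K.faces, insert u s ⊆ F ∧ F.card = 4 ∧ v ∉ F.erase u := by
    by_cases huv : u = v
    · obtain ⟨F, h1, h2, h3⟩ := h.pure _ hus
      exact ⟨F, h1, h2, h3, by simp [huv]⟩
    · obtain ⟨F, h1, h2, h3, h4⟩ := h.facet_avoid hus (v := v) (by simp [hv, Ne.symm huv])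
      exact ⟨F, h1, h2, h3, by simp [h4]⟩
  obtain ⟨F, hF, hsF, hc, hvF⟩ := this
  have huF : u ∈ F := hsF (by simp)
  have hc3 : (F.erase u).card = 3 := by rw [Finset.card_erase_of_mem huF, hc]
  have hr : F.erase u ∈ K.faces := mem_of_subset hF (Finset.erase_subset _ _)
      (by rw [← Finset.card_pos]; omega)
  have huF' : insert u (F.erase u) ∈ K.faces := by rw [Finset.insert_erase huF]; exact hF
  obtain ⟨p, q, hpq, hpq2⟩ := h.two _ hr hc3
  have : ∃ q, q ≠ u ∧ ∀ r, (r ∉ F.erase u ∧ insert r (F.erase u) ∈ K.faces) ↔ (r = u ∨ r = q) := by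
    rcases (hpq2 u).mp ⟨by simp, huF'⟩ with rfl | rfl
    · exact ⟨q, hpq.symm, hpq2⟩
    · exact ⟨p, hpq, fun r => by rw [hpq2 r]; tauto⟩
  obtain ⟨q, hqu, hq⟩ := this
  have hqf := (hq q).mpr (Or.inr rfl)
  have hqv : q ≠ v := by
    rintro rfl
    have := hl (F.erase u) hc3 (by simp) hvF huF' hqf.2
    exact hqu this.symm
  unfold bdryFaces
  rw [Finset.mem_filter]
  refine ⟨(hA s).mpr ⟨hs, hu, hv⟩, F.erase u, (hA _).mpr ⟨hr, by simp, hvF⟩, ?_, hc3, ?_⟩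
  · rw [Finset.subset_erase]
    exact ⟨(Finset.subset_insert _ _).trans hsF, hu⟩
  · rw [Finset.card_eq_one]
    refine ⟨insert q (F.erase u), ?_⟩
    ext G
    rw [Finset.mem_filter, hA, Finset.mem_singleton]
    constructor
    · rintro ⟨⟨h1, h2, h3⟩, h4, h5⟩
      obtain ⟨r, hr1, rfl⟩ := insert_of_card h5 hc3 h4
      rcases (hq r).mp ⟨hr1, h1⟩ with rfl | rfl
      · simp at h2
      · rfl
    · rintro rfl
      refine ⟨⟨hqf.2, ?_, ?_⟩, ?_, Finset.subset_insert _ _⟩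
      · simp [hqu.symm]
      · rw [Finset.mem_insert]; rintro (h1 | h1)
        · exact hqv h1.symm
        · exact hvF h1
      · rw [Finset.card_insert_of_notMem hqf.1, hc3]

theorem bdry_iff {K : SComplex} (h : K.NP) {u v : ℕ}
    (hl : ∀ r : Finset ℕ, r.card = 3 → u ∉ r → v ∉ r → insert u r ∈ K.faces →
      insert v r ∈ K.faces → u = v) (A : Finset (Finset ℕ))
    (hA : ∀ α, α ∈ A ↔ α ∈ K.faces ∧ u ∉ α ∧ v ∉ α) {s : Finset ℕ} :
    s ∈ bdryFaces A 3 ↔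
      s ∈ K.faces ∧ u ∉ s ∧ v ∉ s ∧ (insert u s ∈ K.faces ∨ insert v s ∈ K.faces) := by
  constructor
  · unfold bdryFaces
    rw [Finset.mem_filter, hA]
    rintro ⟨⟨h1, h2, h3⟩, r, hr, hsr, hc, hone⟩
    refine ⟨h1, h2, h3, ?_⟩
    rw [hA] at hr
    obtain ⟨p, q, hpq, hpq2⟩ := h.two r hr.1 hc
    have hp := (hpq2 p).mpr (Or.inl rfl)
    have hq := (hpq2 q).mpr (Or.inr rfl)
    by_cases hP : p = u ∨ p = v
    · rcases hP with rfl | rfl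
      · exact Or.inl (mem_of_subset hp.2 (Finset.insert_subset_insert _ hsr) (by simp))
      · exact Or.inr (mem_of_subset hp.2 (Finset.insert_subset_insert _ hsr) (by simp))
    by_cases hQ : q = u ∨ q = v
    · rcases hQ with rfl | rfl
      · exact Or.inl (mem_of_subset hq.2 (Finset.insert_subset_insert _ hsr) (by simp))
      · exact Or.inr (mem_of_subset hq.2 (Finset.insert_subset_insert _ hsr) (by simp))
    exfalso
    push Not at hP hQ
    rw [Finset.card_eq_one] at hone
    obtain ⟨G, hG⟩ := hone
    have m : ∀ x, x ≠ u → x ≠ v → x ∉ r → insert x r ∈ K.faces → insert x r = G := by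
      intro x h4 h5 h6 h7
      have : insert x r ∈ ({G} : Finset (Finset ℕ)) := by
        rw [← hG, Finset.mem_filter, hA]
        refine ⟨⟨h7, ?_, ?_⟩, by rw [Finset.card_insert_of_notMem h6, hc], Finset.subset_insert _ _⟩
        · simp [Ne.symm h4, hr.2.1]
        · simp [Ne.symm h5, hr.2.2]
      simpa using this
    have e := (m p hP.1 hP.2 hp.1 hp.2).trans (m q hQ.1 hQ.2 hq.1 hq.2).symm
    have : p ∈ insert q r := e ▸ Finset.mem_insert_self p r
    rcases Finset.mem_insert.mp this with h1 | h1
    · exact hpq h1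
    · exact hp.1 h1
  · rintro ⟨h1, h2, h3, h4 | h4⟩
    · exact bdry_aux h hl A hA h1 h2 h3 h4
    · exact bdry_aux h (u := v) (v := u) (fun r h5 h6 h7 h8 h9 => (hl r h5 h7 h6 h9 h8).symm) A
        (fun α => by rw [hA]; tauto) h1 h3 h2 h4

/-- data for a contraction -/
structure CData (K K1 : SComplex) (u v w : ℕ) : Prop where
  np : K.NP
  huv : u ≠ v
  edge : {u, v} ∈ K.faces
  link : ∀ s : Finset ℕ, s.Nonempty → u ∉ s → v ∉ s → insert u s ∈ K.faces → insert v s ∈ K.faces →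
    insert u (insert v s) ∈ K.faces
  hw : {w} ∉ K.faces
  m0 : ∀ s, w ∉ s → (s ∈ K1.faces ↔ s ∈ K.faces ∧ u ∉ s ∧ v ∉ s)
  m1 : ∀ s, w ∉ s → (insert w s ∈ K1.faces ↔ u ∉ s ∧ v ∉ s ∧
    (insert u s ∈ K.faces ∨ insert v s ∈ K.faces))

namespace CData
variable {K K1 : SComplex} {u v w : ℕ}

theorem symm (c : CData K K1 u v w) : CData K K1 v u w where
  np := c.np
  huv := c.huv.symm
  edge := by rw [Finset.pair_comm]; exact c.edge
  link := by
    intro s h1 h2 h3 h4 h5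
    rw [Finset.insert_comm]; exact c.link s h1 h3 h2 h5 h4
  hw := c.hw
  m0 := fun s hs => by rw [c.m0 s hs]; tauto
  m1 := fun s hs => by rw [c.m1 s hs]; tauto

theorem hws (c : CData K K1 u v w) {s : Finset ℕ} (hs : s ∈ K.faces) : w ∉ s := fun h =>
  c.hw (mem_of_subset hs (by simpa using h) (by simp))

theorem hwu (c : CData K K1 u v w) : w ≠ u := by
  rintro rfl; exact c.hws c.edge (by simp)

theorem no3 (c : CData K K1 u v w) (r : Finset ℕ) (hr : r.card = 3) (hu : u ∉ r) (hv : v ∉ r)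
    (h1 : insert u r ∈ K.faces) (h2 : insert v r ∈ K.faces) : False := by
  have := c.np.le4 _ (c.link r (by rw [← Finset.card_pos]; omega) hu hv h1 h2)
  rw [Finset.card_insert_of_notMem (by simp [c.huv, hu]), Finset.card_insert_of_notMem hv] at this
  omega

theorem pure_aux (c : CData K K1 u v w) {s : Finset ℕ} (hu : u ∉ s) (hv : v ∉ s) (_hw : w ∉ s)
    (hs : insert u s ∈ K.faces) : ∃ F ∈ K1.faces, insert w s ⊆ F ∧ F.card = 4 := by
  obtain ⟨F, hF, hsF, hc, hvF⟩ := c.np.facet_avoid hs (v := v) (by simp [hv, Ne.symm c.huv])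
  have huF : u ∈ F := hsF (by simp)
  have hwF : w ∉ F := c.hws hF
  have hc3 : (F.erase u).card = 3 := by rw [Finset.card_erase_of_mem huF, hc]
  refine ⟨insert w (F.erase u), ?_, ?_, ?_⟩
  · rw [c.m1 _ (by simp [hwF])]
    refine ⟨by simp, by simp [hvF], Or.inl ?_⟩
    rw [Finset.insert_erase huF]; exact hF
  · refine Finset.insert_subset_insert _ ?_
    rw [Finset.subset_erase]
    exact ⟨(Finset.subset_insert _ _).trans hsF, hu⟩
  · rw [Finset.card_insert_of_notMem (by simp [hwF]), hc3]

theorem cases (c : CData K K1 u v w) {s : Finset ℕ} (hs : s ∈ K1.faces) :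
    (w ∉ s ∧ s ∈ K.faces ∧ u ∉ s ∧ v ∉ s) ∨
    ∃ s', w ∉ s' ∧ s = insert w s' ∧ u ∉ s' ∧ v ∉ s' ∧ (insert u s' ∈ K.faces ∨ insert v s' ∈ K.faces) := by
  by_cases hw : w ∈ s
  · right
    refine ⟨s.erase w, by simp, (Finset.insert_erase hw).symm, ?_⟩
    rw [← c.m1 _ (by simp), Finset.insert_erase hw]; exact hs
  · left; exact ⟨hw, (c.m0 s hw).mp hs⟩

theorem pure1 (c : CData K K1 u v w) : ∀ s ∈ K1.faces, ∃ F ∈ K1.faces, s ⊆ F ∧ F.card = 4 := by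
  intro s hs
  rcases c.cases hs with ⟨hw, hs, hu, hv⟩ | ⟨s', hw, rfl, hu, hv, h1 | h1⟩
  · obtain ⟨F, hF, hsF, hc, hvF⟩ := c.np.facet_avoid hs hv
    by_cases huF : u ∈ F
    · obtain ⟨G, hG, hsG, hGc⟩ := c.pure_aux hu hv hw (mem_of_subset hF (Finset.insert_subset huF hsF) (by simp))
      exact ⟨G, hG, (Finset.subset_insert _ _).trans hsG, hGc⟩
    · exact ⟨F, (c.m0 F (c.hws hF)).mpr ⟨hF, huF, hvF⟩, hsF, hc⟩
  · exact c.pure_aux hu hv hw h1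
  · exact c.symm.pure_aux hv hu hw h1

theorem le41 (c : CData K K1 u v w) : ∀ s ∈ K1.faces, s.card ≤ 4 := by
  intro s hs
  rcases c.cases hs with ⟨hw, hs, hu, hv⟩ | ⟨s', hw, rfl, hu, hv, h1 | h1⟩
  · exact c.np.le4 s hs
  · have := c.np.le4 _ h1
    rw [Finset.card_insert_of_notMem hu] at this
    rw [Finset.card_insert_of_notMem hw]; exact this
  · have := c.np.le4 _ h1
    rw [Finset.card_insert_of_notMem hv] at this
    rw [Finset.card_insert_of_notMem hw]; exact this

/-- membership of `insert x s` in `K1` for `s` avoiding everything -/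
theorem mem_ins (c : CData K K1 u v w) {s : Finset ℕ} (hw : w ∉ s) (hu : u ∉ s) (hv : v ∉ s) (x : ℕ) :
    insert x s ∈ K1.faces ↔ (x ≠ w ∧ x ≠ u ∧ x ≠ v ∧ insert x s ∈ K.faces) ∨
      (x = w ∧ (insert u s ∈ K.faces ∨ insert v s ∈ K.faces)) := by
  by_cases hx : x = w
  · subst hx
    rw [c.m1 s hw]; tauto
  · rw [c.m0 _ (by simp [hw, Ne.symm hx])]
    simp only [Finset.mem_insert, hx, hu, hv, false_and, or_false]
    constructor
    · rintro ⟨h1, h2, h3⟩; exact ⟨hx, Ne.symm h2, Ne.symm h3, h1⟩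
    · rintro ⟨h1, h2, h3, h4⟩; exact ⟨h4, Ne.symm h2, Ne.symm h3⟩

theorem two_a (c : CData K K1 u v w) {s : Finset ℕ} (hw : w ∉ s) (hs : s ∈ K.faces) (hu : u ∉ s) (hv : v ∉ s)
    (hc : s.card = 3) :
    ∃ p q, p ≠ q ∧ ∀ r, (r ∉ s ∧ insert r s ∈ K1.faces) ↔ (r = p ∨ r = q) := by
  obtain ⟨p, q, hpq, hr⟩ := c.np.two s hs hc
  have hp := (hr p).mpr (Or.inl rfl)
  have hq := (hr q).mpr (Or.inr rfl)
  have hno := c.no3 s hc hu hv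
  have hpw : p ≠ w := by rintro rfl; exact c.hws hp.2 (by simp)
  have hqw : q ≠ w := by rintro rfl; exact c.hws hq.2 (by simp)
  have hru := hr u
  have hrv := hr v
  simp only [c.mem_ins hw hu hv]
  by_cases h1 : insert u s ∈ K.faces ∨ insert v s ∈ K.faces
  · -- one of p, q in {u,v}
    have : ∃ p', p' ≠ u ∧ p' ≠ v ∧ p' ≠ w ∧ ∃ a, (a = u ∨ a = v) ∧ ∀ r, (r ∉ s ∧ insert r s ∈ K.faces) ↔ (r = p' ∨ r = a) := by
      rcases h1 with h1 | h1
      · rcases hru.mp ⟨hu, h1⟩ with h2 | h2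
        · refine ⟨q, ?_, ?_, hqw, p, Or.inl h2.symm, fun r => by rw [hr]; tauto⟩
          · rintro rfl; exact hpq h2.symm
          · rintro rfl; exact hno h1 hq.2
        · refine ⟨p, ?_, ?_, hpw, q, Or.inl h2.symm, hr⟩
          · rintro rfl; exact hpq h2
          · rintro rfl; exact hno h1 hp.2
      · rcases hrv.mp ⟨hv, h1⟩ with h2 | h2
        · refine ⟨q, ?_, ?_, hqw, p, Or.inr h2.symm, fun r => by rw [hr]; tauto⟩
          · rintro rfl; exact hno hq.2 h1
          · rintro rfl; exact hpq h2.symm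
        · refine ⟨p, ?_, ?_, hpw, q, Or.inr h2.symm, hr⟩
          · rintro rfl; exact hno hp.2 h1
          · rintro rfl; exact hpq h2
    obtain ⟨p', h2, h3, h4, a, ha, hr'⟩ := this
    refine ⟨p', w, h4, fun r => ?_⟩
    constructor
    · rintro ⟨h5, ⟨h6, h7, h8, h9⟩ | h6⟩
      · rcases (hr' r).mp ⟨h5, h9⟩ with h10 | h10
        · exact Or.inl h10
        · rcases ha with ha | ha
          · exact absurd (h10.trans ha) h7
          · exact absurd (h10.trans ha) h8
      · exact Or.inr h6.1
    · rintro (rfl | rfl)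
      · have := (hr' r).mpr (Or.inl rfl)
        exact ⟨this.1, Or.inl ⟨h4, h2, h3, this.2⟩⟩
      · exact ⟨hw, Or.inr ⟨rfl, h1⟩⟩
  · refine ⟨p, q, hpq, fun r => ?_⟩
    rw [← hr r]
    constructor
    · rintro ⟨h5, ⟨h6, h7, h8, h9⟩ | h6⟩
      · exact ⟨h5, h9⟩
      · exact absurd h6.2 h1
    · rintro ⟨h5, h6⟩
      refine ⟨h5, Or.inl ⟨?_, ?_, ?_, h6⟩⟩
      · rintro rfl; exact c.hws h6 (by simp)
      · rintro rfl; exact h1 (Or.inl h6)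
      · rintro rfl; exact h1 (Or.inr h6)

theorem mem_ins2 (c : CData K K1 u v w) {s : Finset ℕ} (hw : w ∉ s) (hu : u ∉ s) (hv : v ∉ s) (x : ℕ)
    (hxw : x ≠ w) :
    insert x (insert w s) ∈ K1.faces ↔ x ≠ u ∧ x ≠ v ∧
      (insert x (insert u s) ∈ K.faces ∨ insert x (insert v s) ∈ K.faces) := by
  rw [Finset.insert_comm, c.m1 _ (by simp [hw, Ne.symm hxw])]
  simp only [Finset.mem_insert, hu, hv, or_false]
  rw [Finset.insert_comm u, Finset.insert_comm v]
  rw [ne_comm (a := x), ne_comm (a := x)]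

theorem two_b1 (c : CData K K1 u v w) {s : Finset ℕ} (hw : w ∉ s) (hu : u ∉ s) (hv : v ∉ s)
    (hc : s.card = 2) (h1 : insert u s ∈ K.faces) (h2 : insert v s ∉ K.faces) :
    ∃ p q, p ≠ q ∧ ∀ r, (r ∉ insert w s ∧ insert r (insert w s) ∈ K1.faces) ↔ (r = p ∨ r = q) := by
  obtain ⟨p, q, hpq, hr⟩ := c.np.two (insert u s) h1 (by rw [Finset.card_insert_of_notMem hu, hc])
  refine ⟨p, q, hpq, fun r => ?_⟩
  rw [← hr r]
  simp only [Finset.mem_insert, not_or]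
  constructor
  · rintro ⟨⟨h3, h4⟩, h5⟩
    rw [c.mem_ins2 hw hu hv r h3] at h5
    refine ⟨⟨h5.1, h4⟩, h5.2.2.resolve_right fun h => h2 ?_⟩
    exact mem_of_subset h (Finset.subset_insert _ _) (by simp)
  · rintro ⟨⟨h3, h4⟩, h5⟩
    have hrw : r ≠ w := by rintro rfl; exact c.hws h5 (by simp)
    refine ⟨⟨hrw, h4⟩, ?_⟩
    rw [c.mem_ins2 hw hu hv r hrw]
    refine ⟨h3, ?_, Or.inl h5⟩
    rintro rfl
    exact h2 (mem_of_subset h5 (Finset.insert_subset_insert _ (Finset.subset_insert _ _)) (by simp))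

theorem two_b2 (c : CData K K1 u v w) {s : Finset ℕ} (hw : w ∉ s) (hu : u ∉ s) (hv : v ∉ s)
    (hc : s.card = 2) (h1 : insert u s ∈ K.faces) (h2 : insert v s ∈ K.faces) :
    ∃ p q, p ≠ q ∧ ∀ r, (r ∉ insert w s ∧ insert r (insert w s) ∈ K1.faces) ↔ (r = p ∨ r = q) := by
  have huv := c.link s (by rw [← Finset.card_pos]; omega) hu hv h1 h2
  have aux : ∀ u v, u ≠ v → u ∉ s → v ∉ s → insert u s ∈ K.faces → insert u (insert v s) ∈ K.faces →
      ∃ p, p ≠ u ∧ p ≠ v ∧ p ∉ s ∧ ∀ r, (r ≠ u ∧ r ∉ s ∧ insert r (insert u s) ∈ K.faces) ↔ (r = v ∨ r = p) := by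
    intro u v huv hu hv h1 h2
    obtain ⟨p, q, hpq, hr⟩ := c.np.two (insert u s) h1 (by rw [Finset.card_insert_of_notMem hu, hc])
    simp only [Finset.mem_insert, not_or] at hr
    rcases (hr v).mp ⟨⟨huv.symm, hv⟩, by rw [Finset.insert_comm]; exact h2⟩ with rfl | rfl
    · have := (hr q).mpr (Or.inr rfl)
      exact ⟨q, this.1.1, hpq.symm, this.1.2, fun r => by rw [← hr r]; tauto⟩
    · have := (hr p).mpr (Or.inl rfl)
      exact ⟨p, this.1.1, hpq, this.1.2, fun r => by rw [or_comm, ← hr r]; tauto⟩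
  obtain ⟨p, hp1, hp2, hp3, hp⟩ := aux u v c.huv hu hv h1 huv
  obtain ⟨q, hq1, hq2, hq3, hq⟩ := aux v u c.huv.symm hv hu h2 (by rw [Finset.insert_comm]; exact huv)
  have hpK := (hp p).mpr (Or.inr rfl)
  have hqK := (hq q).mpr (Or.inr rfl)
  refine ⟨p, q, ?_, fun r => ?_⟩
  · rintro rfl
    refine c.no3 (insert p s) (by rw [Finset.card_insert_of_notMem hp3, hc]) ?_ ?_ ?_ ?_
    · simp [hu, hp1.symm]
    · simp [hv, hp2.symm]
    · rw [Finset.insert_comm]; exact hpK.2.2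
    · rw [Finset.insert_comm]; exact hqK.2.2
  · simp only [Finset.mem_insert, not_or]
    constructor
    · rintro ⟨⟨h3, h4⟩, h5⟩
      rw [c.mem_ins2 hw hu hv r h3] at h5
      rcases h5.2.2 with h6 | h6
      · exact Or.inl (((hp r).mp ⟨h5.1, h4, h6⟩).resolve_left h5.2.1)
      · exact Or.inr (((hq r).mp ⟨h5.2.1, h4, h6⟩).resolve_left h5.1)
    · rintro (rfl | rfl)
      · have hrw : r ≠ w := by rintro rfl; exact c.hws hpK.2.2 (by simp)
        refine ⟨⟨hrw, hp3⟩, ?_⟩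
        rw [c.mem_ins2 hw hu hv r hrw]
        exact ⟨hp1, hp2, Or.inl hpK.2.2⟩
      · have hrw : r ≠ w := by rintro rfl; exact c.hws hqK.2.2 (by simp)
        refine ⟨⟨hrw, hq3⟩, ?_⟩
        rw [c.mem_ins2 hw hu hv r hrw]
        exact ⟨hq2, hq1, Or.inr hqK.2.2⟩

theorem two1 (c : CData K K1 u v w) : ∀ s ∈ K1.faces, s.card = 3 →
    ∃ p q, p ≠ q ∧ ∀ r, (r ∉ s ∧ insert r s ∈ K1.faces) ↔ (r = p ∨ r = q) := by
  intro s hs hc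
  rcases c.cases hs with ⟨hw, hs, hu, hv⟩ | ⟨s', hw, rfl, hu, hv, h1⟩
  · exact c.two_a hw hs hu hv hc
  · rw [Finset.card_insert_of_notMem hw] at hc
    by_cases h2 : insert u s' ∈ K.faces
    · by_cases h3 : insert v s' ∈ K.faces
      · exact c.two_b2 hw hu hv (by omega) h2 h3
      · exact c.two_b1 hw hu hv (by omega) h2 h3
    · exact c.symm.two_b1 hw hv hu (by omega) (h1.resolve_left h2) h2

theorem ladj (c : CData K K1 u v w) {s : Finset ℕ} (hw : w ∉ s) (hu : u ∉ s) (hv : v ∉ s) {a b : ℕ}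
    (h : K.LAdj s a b) :
    K1.LAdj s (if a = u ∨ a = v then w else a) (if b = u ∨ b = v then w else b) := by
  obtain ⟨h1, h2, h3⟩ := h
  have haw : a ≠ w := by rintro rfl; exact c.hws h3 (by simp)
  have hbw : b ≠ w := by rintro rfl; exact c.hws h3 (by simp)
  have hA : insert a s ∈ K.faces := mem_of_subset h3 (Finset.insert_subset_insert _ (Finset.subset_insert _ _)) (by simp)
  have hB : insert b s ∈ K.faces := mem_of_subset h3 (Finset.subset_insert _ _) (by simp)
  refine ⟨by split_ifs <;> assumption, by split_ifs <;> assumption, ?_⟩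
  split_ifs with ha hb hb
  · rw [Finset.insert_idem, c.m1 s hw]
    refine ⟨hu, hv, ?_⟩
    rcases ha with rfl | rfl
    · exact Or.inl hA
    · exact Or.inr hA
  · push Not at hb
    rw [c.m1 _ (by simp [hw, Ne.symm hbw])]
    refine ⟨by simp [hu, Ne.symm hb.1], by simp [hv, Ne.symm hb.2], ?_⟩
    rcases ha with rfl | rfl
    · exact Or.inl h3
    · exact Or.inr h3
  · push Not at ha
    rw [Finset.insert_comm, c.m1 _ (by simp [hw, Ne.symm haw])]
    refine ⟨by simp [hu, Ne.symm ha.1], by simp [hv, Ne.symm ha.2], ?_⟩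
    rw [Finset.insert_comm] at h3
    rcases hb with rfl | rfl
    · exact Or.inl h3
    · exact Or.inr h3
  · push Not at ha hb
    rw [c.m0 _ (by simp [hw, Ne.symm haw, Ne.symm hbw])]
    exact ⟨h3, by simp [hu, Ne.symm ha.1, Ne.symm hb.1], by simp [hv, Ne.symm ha.2, Ne.symm hb.2]⟩

theorem conn_a (c : CData K K1 u v w) {s : Finset ℕ} (hw : w ∉ s) (hu : u ∉ s) (hv : v ∉ s) (hc : s.card ≤ 2)
    (x y : ℕ) (hx : x ∉ s) (hy : y ∉ s) (hxs : insert x s ∈ K1.faces) (hys : insert y s ∈ K1.faces) :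
    Relation.ReflTransGen (K1.LAdj s) x y := by
  have lift : ∀ x, x ∉ s → insert x s ∈ K1.faces → ∃ a, a ∉ s ∧ insert a s ∈ K.faces ∧
      x = if a = u ∨ a = v then w else a := by
    intro x hx hxs
    rw [c.mem_ins hw hu hv] at hxs
    rcases hxs with ⟨h1, h2, h3, h4⟩ | ⟨h1, h2 | h2⟩
    · exact ⟨x, hx, h4, by simp [h2, h3]⟩
    · exact ⟨u, hu, h2, by simp [h1]⟩
    · exact ⟨v, hv, h2, by simp [h1]⟩
  obtain ⟨a, ha, ha2, rfl⟩ := lift x hx hxs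
  obtain ⟨b, hb, hb2, rfl⟩ := lift y hy hys
  exact Relation.ReflTransGen.lift (fun a => if a = u ∨ a = v then w else a)
    (fun _ _ h => c.ladj hw hu hv h) _ _ (c.np.conn s hc a b ha hb ha2 hb2)

theorem conn_side (c : CData K K1 u v w) {s : Finset ℕ} (hw : w ∉ s) (hu : u ∉ s) (hv : v ∉ s) (hc : s.card ≤ 1)
    {x y : ℕ} (hx : x ∉ s) (hy : y ∉ s) (hxu : x ≠ u) (hyu : y ≠ u) (hxv : x ≠ v) (hyv : y ≠ v)
    (hxs : insert x (insert u s) ∈ K.faces) (hys : insert y (insert u s) ∈ K.faces) :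
    Relation.ReflTransGen (K1.LAdj (insert w s)) x y := by
  have := c.np.avoid (s := insert u s) (by rw [Finset.card_insert_of_notMem hu]; omega) v
    (x := x) (y := y) (by simp [hx, hxu]) (by simp [hy, hyu]) hxs hys hxv hyv
  refine Relation.ReflTransGen.mono ?_ _ _ this
  rintro a b ⟨⟨h1, h2, h3⟩, hav, hbv⟩
  simp only [Finset.mem_insert, not_or] at h1 h2
  have haw : a ≠ w := by rintro rfl; exact c.hws h3 (by simp)
  have hbw : b ≠ w := by rintro rfl; exact c.hws h3 (by simp)
  refine ⟨by simp [haw, h1.2], by simp [hbw, h2.2], ?_⟩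
  rw [Finset.insert_comm b, c.mem_ins2 (by simp [hw, Ne.symm hbw]) (by simp [hu, Ne.symm h2.1]) (by simp [hv, Ne.symm hbv]) a haw]
  refine ⟨h1.1, hav, Or.inl ?_⟩
  rw [Finset.insert_comm u]; exact h3

theorem conn_b (c : CData K K1 u v w) {s : Finset ℕ} (hw : w ∉ s) (hu : u ∉ s) (hv : v ∉ s) (hc : s.card ≤ 1)
    (x y : ℕ) (hx : x ∉ insert w s) (hy : y ∉ insert w s) (hxs : insert x (insert w s) ∈ K1.faces)
    (hys : insert y (insert w s) ∈ K1.faces) :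
    Relation.ReflTransGen (K1.LAdj (insert w s)) x y := by
  simp only [Finset.mem_insert, not_or] at hx hy
  rw [c.mem_ins2 hw hu hv _ hx.1] at hxs
  rw [c.mem_ins2 hw hu hv _ hy.1] at hys
  obtain ⟨hxu, hxv, hxs⟩ := hxs
  obtain ⟨hyu, hyv, hys⟩ := hys
  -- common vertex
  have com : insert u s ∈ K.faces → insert v s ∈ K.faces → ∃ p, p ∉ s ∧ p ≠ u ∧ p ≠ v ∧
      insert p (insert u s) ∈ K.faces ∧ insert p (insert v s) ∈ K.faces := by
    intro h1 h2
    have h3 : insert u (insert v s) ∈ K.faces := by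
      by_cases hs : s = ∅
      · subst hs; simpa using c.edge
      · exact c.link s (Finset.nonempty_iff_ne_empty.mpr hs) hu hv h1 h2
    obtain ⟨F, hF, hsF, hF4⟩ := c.np.pure _ h3
    have : (insert u (insert v s)).card < F.card := by
      rw [Finset.card_insert_of_notMem (by simp [hu, c.huv]), Finset.card_insert_of_notMem hv]; omega
    obtain ⟨p, hpF, hps⟩ := Finset.exists_mem_notMem_of_card_lt_card this
    simp only [Finset.mem_insert, not_or] at hps
    refine ⟨p, hps.2.2, hps.1, hps.2.1, mem_of_subset hF (Finset.insert_subset hpF ?_) (by simp),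
      mem_of_subset hF (Finset.insert_subset hpF ?_) (by simp)⟩
    · exact (Finset.insert_subset_insert _ (Finset.subset_insert _ _)).trans hsF
    · exact (Finset.subset_insert _ _).trans hsF
  have sub : ∀ {x u}, insert x (insert u s) ∈ K.faces → insert u s ∈ K.faces := fun h =>
    mem_of_subset h (Finset.subset_insert _ _) (by simp)
  rcases hxs with hxs | hxs <;> rcases hys with hys | hys
  · exact c.conn_side hw hu hv hc hx.2 hy.2 hxu hyu hxv hyv hxs hys
  · obtain ⟨p, hp, hpu, hpv, h1, h2⟩ := com (sub hxs) (sub hys)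
    exact (c.conn_side hw hu hv hc hx.2 hp hxu hpu hxv hpv hxs h1).trans
      (c.symm.conn_side hw hv hu hc hp hy.2 hpv hyv hpu hyu h2 hys)
  · obtain ⟨p, hp, hpu, hpv, h1, h2⟩ := com (sub hys) (sub hxs)
    exact (c.symm.conn_side hw hv hu hc hx.2 hp hxv hpv hxu hpu hxs h2).trans
      (c.conn_side hw hu hv hc hp hy.2 hpu hyu hpv hyv h1 hys)
  · exact c.symm.conn_side hw hv hu hc hx.2 hy.2 hxv hyv hxu hyu hxs hys

theorem np1 (c : CData K K1 u v w) : K1.NP where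
  ne := by
    refine ⟨{w}, ?_⟩
    have := c.m1 ∅ (by simp)
    simp only [insert_empty_eq] at this
    rw [this]
    exact ⟨by simp, by simp, Or.inl (mem_of_subset c.edge (by simp) (by simp))⟩
  pure := c.pure1
  le4 := c.le41
  two := c.two1
  conn := by
    intro s hc x y hx hy hxs hys
    by_cases hw : w ∈ s
    · obtain ⟨s', hw', rfl⟩ : ∃ s', w ∉ s' ∧ s = insert w s' :=
        ⟨s.erase w, by simp, (Finset.insert_erase hw).symm⟩
      rw [Finset.card_insert_of_notMem hw'] at hc
      have hs : insert w s' ∈ K1.faces := mem_of_subset hxs (Finset.subset_insert _ _) (by simp)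
      rw [c.m1 _ hw'] at hs
      exact c.conn_b hw' hs.1 hs.2.1 (by omega) x y hx hy hxs hys
    · by_cases hs : s = ∅
      · subst hs
        exact c.conn_a (by simp) (by simp) (by simp) hc x y hx hy hxs hys
      · have hs : s ∈ K1.faces := mem_of_subset hxs (Finset.subset_insert _ _) (Finset.nonempty_iff_ne_empty.mpr hs)
        rw [c.m0 _ hw] at hs
        exact c.conn_a hw hs.2.1 hs.2.2 hc x y hx hy hxs hys

end CData
end SComplex

namespace SComplex

/-- vertex neighbours -/
def N (K : SComplex) (x : ℕ) : Finset ℕ := K.vertexSet.filter fun y => y ≠ x ∧ {x, y} ∈ K.faces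

/-- vertices of the link of an edge -/
def L (K : SComplex) (x y : ℕ) : Finset ℕ :=
  K.vertexSet.filter fun z => x ≠ y ∧ z ≠ x ∧ z ≠ y ∧ {x, y, z} ∈ K.faces

theorem mem_N {K : SComplex} {x y : ℕ} : y ∈ K.N x ↔ y ≠ x ∧ {x, y} ∈ K.faces := by
  unfold N
  rw [Finset.mem_filter]
  exact ⟨fun h => h.2, fun h => ⟨face_subset_vertexSet h.2 (by simp), h⟩⟩

theorem mem_L {K : SComplex} {x y z : ℕ} :
    z ∈ K.L x y ↔ x ≠ y ∧ z ≠ x ∧ z ≠ y ∧ {x, y, z} ∈ K.faces := by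
  unfold L
  rw [Finset.mem_filter]
  exact ⟨fun h => h.2, fun h => ⟨face_subset_vertexSet h.2.2.2 (by simp), h⟩⟩

theorem fnum_zero (K : SComplex) : K.fnum 0 = K.vertexSet.card := by
  unfold fnum
  have : (K.faces.filter fun s => s.card = 0 + 1) = K.vertexSet.image (fun x => {x}) := by
    ext s
    simp only [Finset.mem_filter, Finset.mem_image, mem_vertexSet, zero_add, Finset.card_eq_one]
    constructor
    · rintro ⟨h, x, rfl⟩; exact ⟨x, h, rfl⟩
    · rintro ⟨x, h, rfl⟩; exact ⟨h, x, rfl⟩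
  rw [this, Finset.card_image_of_injective _ (Finset.singleton_injective)]

theorem contr (K : SComplex) (h : K.NP) (u v w : ℕ) (huv : u ≠ v) (edge : {u, v} ∈ K.faces)
    (link : ∀ s : Finset ℕ, s.Nonempty → u ∉ s → v ∉ s → insert u s ∈ K.faces → insert v s ∈ K.faces →
    insert u (insert v s) ∈ K.faces) (hw : {w} ∉ K.faces) : 
    ∃ K1, CData K K1 u v w ∧ EdgeContraction K K1 := by
  classical
  have hws : ∀ s ∈ K.faces, w ∉ s := fun s hs h =>
    hw (mem_of_subset hs (by simpa using h) (by simp))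
  set A := K.faces.filter fun α => u ∉ α ∧ v ∉ α with hA
  have hb := fun s => bdry_iff h (u := u) (v := v) (A := A) (s := s) (by
    intro r hr hu hv h1 h2
    exfalso
    have := h.le4 _ (link r (by rw [← Finset.card_pos]; omega) hu hv h1 h2)
    rw [Finset.card_insert_of_notMem (by simp [huv, hu]), Finset.card_insert_of_notMem hv] at this
    omega) (by intro α; rw [hA, Finset.mem_filter])
  have hAm : ∀ α, α ∈ A ↔ α ∈ K.faces ∧ u ∉ α ∧ v ∉ α := by intro α; rw [hA, Finset.mem_filter]
  set faces := A ∪ coneFaces w (bdryFaces A 3) with hf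
  have m0 : ∀ s, w ∉ s → (s ∈ faces ↔ s ∈ K.faces ∧ u ∉ s ∧ v ∉ s) := by
    intro s hs
    rw [hf, coneFaces]
    simp only [Finset.mem_union, hb, Finset.mem_image, hAm, Finset.mem_singleton]
    constructor
    · rintro (h1 | ((h1 | ⟨r, h1, rfl⟩) | rfl))
      · exact h1
      · exact ⟨h1.1, h1.2.1, h1.2.2.1⟩
      · simp at hs
      · simp at hs
    · exact fun h => Or.inl h
  have m1 : ∀ s, w ∉ s → (insert w s ∈ faces ↔ u ∉ s ∧ v ∉ s ∧
    (insert u s ∈ K.faces ∨ insert v s ∈ K.faces)) := by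
    intro s hs
    rw [hf, coneFaces]
    simp only [Finset.mem_union, hb, Finset.mem_image, hAm, Finset.mem_singleton]
    constructor
    · rintro (h1 | ((h1 | ⟨r, h1, h2⟩) | h1))
      · exact absurd (Finset.mem_insert_self w s) (hws _ h1.1)
      · exact absurd (Finset.mem_insert_self w s) (hws _ h1.1)
      · have : r = s := by
          have h3 := hws r h1.1
          rw [← Finset.erase_insert h3, h2, Finset.erase_insert hs]
        subst this; exact h1.2
      · have : s = ∅ := by
          rw [← Finset.erase_insert hs, h1]; simp
        subst this
        exact ⟨by simp, by simp, Or.inl (mem_of_subset edge (by simp) (by simp))⟩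
    · rintro ⟨h1, h2, h3⟩
      by_cases hs0 : s = ∅
      · subst hs0; right; right; rfl
      · right; left; right
        refine ⟨s, ⟨?_, h1, h2, h3⟩, rfl⟩
        rcases h3 with h3 | h3 <;>
        exact mem_of_subset h3 (Finset.subset_insert _ _) (Finset.nonempty_iff_ne_empty.mpr hs0)
  have dc : ∀ s ∈ faces, ∀ t ⊆ s, t ≠ ∅ → t ∈ faces := by
    intro s hs t hts ht
    have ht' := Finset.nonempty_iff_ne_empty.mpr ht
    by_cases hws : w ∈ s
    · obtain ⟨s', hw', rfl⟩ : ∃ s', w ∉ s' ∧ s = insert w s' :=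
        ⟨s.erase w, by simp, (Finset.insert_erase hws).symm⟩
      rw [m1 _ hw'] at hs
      by_cases hwt : w ∈ t
      · obtain ⟨t', hwt', rfl⟩ : ∃ t', w ∉ t' ∧ t = insert w t' :=
          ⟨t.erase w, by simp, (Finset.insert_erase hwt).symm⟩
        have hts' : t' ⊆ s' := (Finset.insert_subset_insert_iff hwt').mp hts
        rw [m1 _ hwt']
        refine ⟨fun h => hs.1 (hts' h), fun h => hs.2.1 (hts' h), ?_⟩
        rcases hs.2.2 with h3 | h3
        · left; exact mem_of_subset h3 (Finset.insert_subset_insert _ hts') (by simp)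
        · right; exact mem_of_subset h3 (Finset.insert_subset_insert _ hts') (by simp)
      · have hts' : t ⊆ s' := (Finset.subset_insert_iff_of_notMem hwt).mp hts
        rw [m0 _ hwt]
        refine ⟨?_, fun h => hs.1 (hts' h), fun h => hs.2.1 (hts' h)⟩
        rcases hs.2.2 with h3 | h3 <;>
        exact mem_of_subset h3 (hts'.trans (Finset.subset_insert _ _)) ht'
    · rw [m0 _ hws] at hs
      rw [m0 _ (fun h => hws (hts h))]
      exact ⟨mem_of_subset hs.1 hts ht', fun h => hs.2.1 (hts h), fun h => hs.2.2 (hts h)⟩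
  let K1 : SComplex := ⟨faces, by
    rw [m0 _ (by simp)]; rintro ⟨h1, -⟩; exact K.not_empty_mem h1, dc⟩
  refine ⟨K1, ⟨h, huv, edge, link, hw, m0, m1⟩, u, v, edge, huv, ?_, w, ?_, rfl⟩
  · ext s
    rw [Finset.mem_inter, mem_lk, mem_lk, mem_lk]
    have e1 : ∀ x, s ∩ {x} = ∅ ↔ x ∉ s := by
      intro x
      rw [← Finset.disjoint_iff_inter_eq_empty, Finset.disjoint_singleton_right]
    have e2 : s ∩ {u, v} = ∅ ↔ u ∉ s ∧ v ∉ s := by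
      rw [← Finset.disjoint_iff_inter_eq_empty, Finset.disjoint_right]
      simp
    have e3 : ∀ x, s ∪ {x} = insert x s := by intro x; ext; simp
    have e4 : s ∪ {u, v} = insert u (insert v s) := by ext; simp
    rw [e1, e1, e2, e3, e3, e4]
    constructor
    · rintro ⟨⟨h1, h2, h3⟩, h4, h5, h6⟩
      exact ⟨h1, ⟨h2, h5⟩, link s (face_nonempty h1) h2 h5 h3 h6⟩
    · rintro ⟨h1, ⟨h2, h3⟩, h4⟩
      refine ⟨⟨h1, h2, mem_of_subset h4 (Finset.insert_subset_insert _ (Finset.subset_insert _ _)) (by simp)⟩,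
        h1, h3, mem_of_subset h4 (Finset.subset_insert _ _) (by simp)⟩
  · rw [mem_vertexSet]; exact hw

theorem CData.f0 {K K1 : SComplex} {u v w : ℕ} (c : CData K K1 u v w) : K.fnum 0 ≤ K1.fnum 0 + 1 := by
  rw [fnum_zero, fnum_zero]
  have : K.vertexSet \ {u, v} ∪ {w} ⊆ K1.vertexSet := by
    intro x hx
    rw [mem_vertexSet]
    simp only [Finset.mem_union, Finset.mem_sdiff, Finset.mem_insert, Finset.mem_singleton, not_or, mem_vertexSet] at hx
    rcases hx with ⟨h1, h2, h3⟩ | rfl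
    · rw [c.m0 _ (c.hws h1)]
      exact ⟨h1, by simpa using Ne.symm h2, by simpa using Ne.symm h3⟩
    · have := c.m1 ∅ (by simp)
      simp only [insert_empty_eq] at this
      rw [this]
      exact ⟨by simp, by simp, Or.inl (mem_of_subset c.edge (by simp) (by simp))⟩
  have h1 := Finset.card_le_card this
  rw [Finset.card_union_of_disjoint] at h1
  · have h2 := Finset.le_card_sdiff {u, v} K.vertexSet
    rw [Finset.card_pair c.huv] at h2
    simp at h1
    omega
  · rw [Finset.disjoint_singleton_right, Finset.mem_sdiff, mem_vertexSet]
    exact fun h => c.hw h.1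

theorem CData.f1 {K K1 : SComplex} {u v w : ℕ} (c : CData K K1 u v w) :
    K1.fnum 1 + 1 + (K.L u v).card ≤ K.fnum 1 := by
  classical
  have hwu := c.hwu
  have hwv := c.symm.hwu
  have huv := c.huv
  set E := K.faces.filter fun s => s.card = 1 + 1 with hE
  set D := insert {u, v} ((K.L u v).image fun z => ({v, z} : Finset ℕ)) with hD
  have hDE : D ⊆ E := by
    intro s hs
    rw [hD, Finset.mem_insert, Finset.mem_image] at hs
    rw [hE, Finset.mem_filter]
    rcases hs with rfl | ⟨z, hz, rfl⟩
    · exact ⟨c.edge, Finset.card_pair c.huv⟩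
    · rw [mem_L] at hz
      exact ⟨mem_of_subset hz.2.2.2 (by intro y; simp; tauto) (by simp), Finset.card_pair hz.2.2.1.symm⟩
  have hDc : D.card = 1 + (K.L u v).card := by
    rw [hD, Finset.card_insert_of_notMem, Finset.card_image_of_injOn, add_comm]
    · intro a ha b hb hab
      simp only [Finset.mem_coe, mem_L] at ha hb
      have : a ∈ ({v, b} : Finset ℕ) := by
        have : a ∈ ({v, a} : Finset ℕ) := by simp
        simp only at hab
        rwa [hab] at this
      simp at this
      exact this.resolve_left ha.2.2.1
    · rw [Finset.mem_image]
      rintro ⟨z, hz, h⟩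
      rw [mem_L] at hz
      have : u ∈ ({v, z} : Finset ℕ) := by rw [h]; simp
      simp [c.huv, hz.2.1.symm] at this
  have hsub : (K1.faces.filter fun s => s.card = 1 + 1) ⊆
      (E \ D).image (fun s => s.image (fun a => if a = u ∨ a = v then w else a)) := by
    intro s hs
    rw [Finset.mem_filter] at hs
    obtain ⟨hs, hc⟩ := hs
    rw [Finset.mem_image]
    have hpre : ∀ e : Finset ℕ, e ∈ K.faces → e.card = 2 → e ≠ {u, v} → (v ∈ e → ∀ z, e = {v, z} → z ∉ K.L u v) → e ∈ E \ D := by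
      intro e h1 h2 h3 h4
      rw [Finset.mem_sdiff, hE, Finset.mem_filter, hD, Finset.mem_insert, Finset.mem_image]
      refine ⟨⟨h1, h2⟩, ?_⟩
      rintro (h5 | ⟨z, hz, rfl⟩)
      · exact h3 h5
      · exact h4 (by simp) z rfl hz
    rcases c.cases hs with ⟨hw, hs, hu, hv⟩ | ⟨s', hw, rfl, hu, hv, h1⟩
    · refine ⟨s, hpre s hs hc ?_ (fun h => absurd h hv), ?_⟩
      · rintro rfl; simp at hu
      · conv_rhs => rw [← Finset.image_id (s := s)]
        refine Finset.image_congr ?_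
        intro a ha
        have : ¬ (a = u ∨ a = v) := by rintro (rfl | rfl) <;> contradiction
        simp [this]
    · rw [Finset.card_insert_of_notMem hw] at hc
      obtain ⟨z, rfl⟩ := Finset.card_eq_one.mp (show s'.card = 1 by omega)
      simp only [Finset.mem_singleton] at hw hu hv
      by_cases h2 : insert u {z} ∈ K.faces
      · refine ⟨{u, z}, hpre _ h2 (Finset.card_pair hu) ?_ ?_, ?_⟩
        · intro h
          have : v ∈ ({u, z} : Finset ℕ) := by rw [h]; simp
          simp [c.huv.symm, hv] at this
        · intro h; simp [c.huv.symm, hv] at h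
        · simp [Finset.image_insert, Ne.symm hu, Ne.symm hv]
      · have h3 := h1.resolve_left h2
        refine ⟨{v, z}, hpre _ h3 (Finset.card_pair hv) ?_ ?_, ?_⟩
        · intro h
          have : u ∈ ({v, z} : Finset ℕ) := by rw [h]; simp
          simp [c.huv, hu] at this
        · intro _ y hy hyL
          have : z ∈ ({v, y} : Finset ℕ) := by rw [← hy]; simp
          simp only [Finset.mem_insert, Finset.mem_singleton] at this
          rcases this with h | h
          · exact hv h.symm
          · subst h
            rw [mem_L] at hyL
            exact h2 (mem_of_subset hyL.2.2.2 (by intro y; simp; tauto) (by simp))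
        · simp [Finset.image_insert, Ne.symm hu, Ne.symm hv]
  have h1 := (Finset.card_le_card hsub).trans Finset.card_image_le
  rw [Finset.card_sdiff_of_subset hDE, hDc] at h1
  have h2 := Finset.card_le_card hDE
  rw [hDc] at h2
  have e1 : K.fnum 1 = E.card := rfl
  have e2 : K1.fnum 1 = (K1.faces.filter fun s => s.card = 1 + 1).card := rfl
  omega

theorem no_contr {K : SComplex} (hK : InClassR K) {u v : ℕ} (huv : u ≠ v) (edge : {u, v} ∈ K.faces)
    (link : ∀ s : Finset ℕ, s.Nonempty → u ∉ s → v ∉ s → insert u s ∈ K.faces → insert v s ∈ K.faces →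
    insert u (insert v s) ∈ K.faces) : (K.L u v).card ≤ 3 := by
  obtain ⟨w, hw⟩ := Infinite.exists_notMem_finset K.vertexSet
  rw [mem_vertexSet] at hw
  obtain ⟨K1, c, hc⟩ := contr K (NP.ofNPM hK.1) u v w huv edge link hw
  have := hK.2.2.2.2 K1 c.np1.toNPM (Or.inr (Or.inl hc))
  have h0 := c.f0
  have h1 := c.f1
  unfold g2 at this
  omega

end SComplex


namespace SComplex

/-- data for splitting a vertex `v` along the missing triangle `T` -/
structure SData (K : SComplex) (v : ℕ) (T : Finset ℕ) (D : Finset ℕ → Bool) : Prop where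
  np : K.NP
  hT : T.card = 3
  hv : v ∉ T
  hTK : T ∉ K.faces
  cross : ∀ e ⊆ T, e.card = 2 → ∀ i, ∃ p, p ∉ insert v e ∧ insert p (insert v e) ∈ K.faces ∧
    D (insert p (insert v e)) = i
  same : ∀ e : Finset ℕ, e.card = 2 → v ∉ e → ¬ e ⊆ T → ∀ p q, p ∉ insert v e → q ∉ insert v e →
    insert p (insert v e) ∈ K.faces → insert q (insert v e) ∈ K.faces →
    D (insert p (insert v e)) = D (insert q (insert v e))

namespace SData
variable {K : SComplex} {v : ℕ} {T : Finset ℕ} {D : Finset ℕ → Bool}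

def Side (K : SComplex) (v : ℕ) (D : Finset ℕ → Bool) (i : Bool) (s : Finset ℕ) : Prop :=
  ∃ F ∈ K.faces, F.card = 4 ∧ insert v s ⊆ F ∧ D F = i

theorem Side.mem {i : Bool} {s : Finset ℕ} (h : Side K v D i s) : insert v s ∈ K.faces := by
  obtain ⟨F, hF, _, h2, _⟩ := h
  exact mem_of_subset hF h2 (by simp)

theorem Side.mono {i : Bool} {s t : Finset ℕ} (h : Side K v D i s) (hts : t ⊆ s) : Side K v D i t := by
  obtain ⟨F, hF, h1, h2, h3⟩ := h
  exact ⟨F, hF, h1, (Finset.insert_subset_insert _ hts).trans h2, h3⟩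

theorem cover (d : SData K v T D) {s : Finset ℕ} (h : insert v s ∈ K.faces) : ∃ i, Side K v D i s := by
  obtain ⟨F, hF, h1, h2⟩ := d.np.pure _ h
  exact ⟨D F, F, hF, h2, h1, rfl⟩

theorem side_T (d : SData K v T D) {s : Finset ℕ} (h : s ⊆ T) (hne : s ≠ T) (i : Bool) : Side K v D i s := by
  have hlt : s.card < 3 := by
    rw [← d.hT]; exact Finset.card_lt_card (Finset.ssubset_iff_subset_ne.mpr ⟨h, hne⟩)
  obtain ⟨e, h1, h2, h3⟩ := Finset.exists_subsuperset_card_eq h (show s.card ≤ 2 by omega) (by rw [d.hT]; omega)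
  obtain ⟨p, hp, hpK, hD⟩ := d.cross e h2 h3 i
  refine ⟨_, hpK, ?_, ?_, hD⟩
  · rw [Finset.card_insert_of_notMem hp, Finset.card_insert_of_notMem (fun h => d.hv (h2 h)), h3]
  · exact (Finset.insert_subset_insert _ h1).trans (Finset.subset_insert _ _)

theorem both (d : SData K v T D) {s : Finset ℕ} (hv : v ∉ s) (hne : s.Nonempty) (h1 : Side K v D true s)
    (h2 : Side K v D false s) : s ⊆ T ∧ s ≠ T := by
  obtain ⟨F, hF, hF4, hsF, hDF⟩ := h1
  obtain ⟨G, hG, hG4, hsG, hDG⟩ := h2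
  have hc1 : (insert v s).card = s.card + 1 := Finset.card_insert_of_notMem hv
  have hle := Finset.card_le_card hsF
  have hpos := Finset.card_pos.mpr hne
  have two : ∀ s : Finset ℕ, v ∉ s → s.card = 2 → ¬ s ⊆ T → ∀ F G, F ∈ K.faces → G ∈ K.faces → F.card = 4 → G.card = 4 →
      insert v s ⊆ F → insert v s ⊆ G → D F = D G := by
    intro s hv hs hsT F G hF hG hF4 hG4 hsF hsG
    have hc1 : (insert v s).card = 3 := by rw [Finset.card_insert_of_notMem hv, hs]
    obtain ⟨p, hp, rfl⟩ := insert_of_card hsF hc1 hF4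
    obtain ⟨q, hq, rfl⟩ := insert_of_card hsG hc1 hG4
    exact d.same s hs hv hsT p q hp hq hF hG
  have hT := d.hT
  have hcase : s.card = 1 ∨ s.card = 2 ∨ s.card = 3 := by omega
  rcases hcase with hc | hc | hc
  · obtain ⟨x, rfl⟩ := Finset.card_eq_one.mp hc
    constructor
    · by_contra hx
      have hx' : x ∉ T := by simpa using hx
      have hcs : ({v, x} : Finset ℕ).card = 2 := by rw [hc1, hc]
      obtain ⟨y, hyF, hys⟩ := Finset.exists_mem_notMem_of_card_lt_card (s := {v, x}) (t := F) (by omega)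
      obtain ⟨z, hzG, hzs⟩ := Finset.exists_mem_notMem_of_card_lt_card (s := {v, x}) (t := G) (by omega)
      have path := d.np.conn {v, x} (by omega) y z hys hzs
        (mem_of_subset hF (Finset.insert_subset hyF hsF) (by simp))
        (mem_of_subset hG (Finset.insert_subset hzG hsG) (by simp))
      have tw : ∀ y, y ∉ ({v, x} : Finset ℕ) → ∀ F G, F ∈ K.faces → G ∈ K.faces → F.card = 4 → G.card = 4 →
          insert y {v, x} ⊆ F → insert y {v, x} ⊆ G → D F = D G := by
        intro y hy F G hF hG hF4 hG4 hsF hsG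
        simp only [Finset.mem_insert, Finset.mem_singleton, not_or] at hy
        rw [Finset.insert_comm] at hsF hsG
        refine two {y, x} ?_ (Finset.card_pair hy.2) ?_ F G hF hG hF4 hG4 hsF hsG
        · simp only [Finset.mem_insert, Finset.mem_singleton, not_or]
          simp only [Finset.mem_singleton] at hv
          exact ⟨Ne.symm hy.1, hv⟩
        · intro h; exact hx' (h (by simp))
      have key : ∀ z, Relation.ReflTransGen (K.LAdj {v, x}) y z → ∀ G, G ∈ K.faces → G.card = 4 →
          insert z {v, x} ⊆ G → D F = D G := by
        intro z hz
        induction hz with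
        | refl => exact fun G hG hG4 hsG => tw y hys F G hF hG hF4 hG4 (Finset.insert_subset hyF hsF) hsG
        | tail h1 h2 ih =>
          rename_i p q
          intro G hG hG4 hsG
          obtain ⟨H, hH, hsH, hH4⟩ := d.np.pure _ h2.2.2
          rw [ih H hH hH4 ((Finset.insert_subset_insert _ (Finset.subset_insert _ _)).trans hsH)]
          exact tw q h2.2.1 H G hH hG hH4 hG4 ((Finset.subset_insert _ _).trans hsH) hsG
      have := key z path G hG hG4 (Finset.insert_subset hzG hsG)
      rw [hDF, hDG] at this; exact absurd this (by simp)
    · rintro rfl; omega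
  · constructor
    · by_contra hx
      have := two s hv hc hx F G hF hG hF4 hG4 hsF hsG
      rw [hDF, hDG] at this; exact absurd this (by simp)
    · rintro rfl; omega
  · exfalso
    have e1 : insert v s = F := Finset.eq_of_subset_of_card_le hsF (by omega)
    have e2 : insert v s = G := Finset.eq_of_subset_of_card_le hsG (by omega)
    rw [← e1] at hDF; rw [← e2, hDF] at hDG; exact absurd hDG (by simp)

theorem both' (d : SData K v T D) {s : Finset ℕ} (hv : v ∉ s) (hne : s.Nonempty) {i j : Bool} (hij : i ≠ j)
    (h1 : Side K v D i s) (h2 : Side K v D j s) : s ⊆ T ∧ s ≠ T := by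
  cases i <;> cases j
  · exact absurd rfl hij
  · exact d.both hv hne h2 h1
  · exact d.both hv hne h1 h2
  · exact absurd rfl hij

theorem side_of (d : SData K v T D) {s : Finset ℕ} (hv : v ∉ s) (hne : s.Nonempty) {i : Bool}
    (hs : Side K v D i s) (hsT : ¬ s ⊆ T) {t : Finset ℕ} (hst : s ⊆ t) (ht : insert v t ∈ K.faces) : Side K v D i t := by
  obtain ⟨j, hj⟩ := d.cover ht
  by_cases hij : i = j
  · exact hij ▸ hj
  · exact absurd (d.both' hv hne hij hs (hj.mono hst)).1 hsT

end SData

/-- membership description of the split complex -/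
structure S2 (K K' : SComplex) (v : ℕ) (T : Finset ℕ) (D : Finset ℕ → Bool) (V : Bool → ℕ) : Prop
    extends SData K v T D where
  hV : V true ≠ V false
  fresh : ∀ i, {V i} ∉ K.faces
  m0 : ∀ s, V true ∉ s → V false ∉ s → (s ∈ K'.faces ↔ (s ∈ K.faces ∧ v ∉ s) ∨ s = T)
  m1 : ∀ i s, V true ∉ s → V false ∉ s → (insert (V i) s ∈ K'.faces ↔ v ∉ s ∧ (SData.Side K v D i s ∨ s = T))
  m2 : ∀ s, V true ∈ s → V false ∈ s → s ∉ K'.faces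

namespace S2
open SData
variable {K K' : SComplex} {v : ℕ} {T : Finset ℕ} {D : Finset ℕ → Bool} {V : Bool → ℕ}

theorem vs (d : S2 K K' v T D V) {s : Finset ℕ} (hs : s ∈ K.faces) (i : Bool) : V i ∉ s := fun h =>
  d.fresh i (mem_of_subset hs (by simpa using h) (by simp))

theorem vT (d : S2 K K' v T D V) (i : Bool) : V i ∉ T := by
  intro h
  obtain ⟨e, he, h1, h2⟩ := Finset.exists_subsuperset_card_eq (s := {V i}) (t := T) (n := 2) (by simpa using h)
    (by simp) (by rw [d.hT]; omega)
  have := (d.side_T (s := e) h1 (by rintro rfl; have := d.hT; omega) i).mem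
  exact d.vs this i (by simp; right; exact he (by simp))

theorem vv (d : S2 K K' v T D V) (i : Bool) : V i ≠ v := by
  have := (d.side_T (s := ∅) (by simp) (by rintro rfl; simpa using d.hT) i).mem
  intro h
  exact d.vs this i (by simp [h])

theorem mi (d : S2 K K' v T D V) {i : Bool} {s : Finset ℕ} (hs : ∀ j, V j ∉ s) :
    insert (V i) s ∈ K'.faces ↔ v ∉ s ∧ (SData.Side K v D i s ∨ s = T) := d.m1 i s (hs _) (hs _)

theorem vne (d : S2 K K' v T D V) {i j : Bool} (h : i ≠ j) : V i ≠ V j := by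
  have := d.hV
  cases i <;> cases j
  · exact absurd rfl h
  · exact this.symm
  · exact this
  · exact absurd rfl h

theorem m2' (d : S2 K K' v T D V) {i j : Bool} (hij : i ≠ j) {s : Finset ℕ} (h1 : V i ∈ s) (h2 : V j ∈ s) :
    s ∉ K'.faces := by
  cases i <;> cases j
  · exact absurd rfl hij
  · exact d.m2 s h2 h1
  · exact d.m2 s h1 h2
  · exact absurd rfl hij

theorem cases (d : S2 K K' v T D V) {s : Finset ℕ} (hs : s ∈ K'.faces) :
    ((∀ j, V j ∉ s) ∧ ((s ∈ K.faces ∧ v ∉ s) ∨ s = T)) ∨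
    ∃ i s', (∀ j, V j ∉ s') ∧ s = insert (V i) s' ∧ v ∉ s' ∧ (Side K v D i s' ∨ s' = T) := by
  by_cases h : ∃ i, V i ∈ s
  · obtain ⟨i, hi⟩ := h
    right
    have hj : ∀ j, V j ∉ s.erase (V i) := by
      intro j hj
      rw [Finset.mem_erase] at hj
      have hij : i ≠ j := by rintro rfl; exact hj.1 rfl
      exact d.m2' hij hi hj.2 hs
    refine ⟨i, s.erase (V i), hj, (Finset.insert_erase hi).symm, ?_⟩
    rw [← d.mi hj, Finset.insert_erase hi]; exact hs
  · push Not at h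
    left
    exact ⟨h, (d.m0 s (h _) (h _)).mp hs⟩

theorem pure1 (d : S2 K K' v T D V) : ∀ s ∈ K'.faces, ∃ F ∈ K'.faces, s ⊆ F ∧ F.card = 4 := by
  intro s hs
  have hTT : ∀ i, insert (V i) T ∈ K'.faces ∧ (insert (V i) T).card = 4 := fun i =>
    ⟨(d.mi d.vT).mpr ⟨d.hv, Or.inr rfl⟩, by rw [Finset.card_insert_of_notMem (d.vT i), d.hT]⟩
  rcases d.cases hs with ⟨h1, ⟨h2, h3⟩ | rfl⟩ | ⟨i, s', h1, rfl, h2, h3 | rfl⟩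
  · obtain ⟨F, hF, hsF, hF4, hvF⟩ := d.np.facet_avoid h2 h3
    exact ⟨F, (d.m0 F (d.vs hF _) (d.vs hF _)).mpr (Or.inl ⟨hF, hvF⟩), hsF, hF4⟩
  · exact ⟨_, (hTT true).1, Finset.subset_insert _ _, (hTT true).2⟩
  · obtain ⟨F, hF, hF4, hsF, hD⟩ := h3
    have hvF : v ∈ F := hsF (by simp)
    have hVF : ∀ j, V j ∉ F.erase v := fun j h => d.vs hF j (Finset.mem_of_mem_erase h)
    refine ⟨insert (V i) (F.erase v), ?_, ?_, ?_⟩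
    · rw [d.mi hVF]
      refine ⟨by simp, Or.inl ⟨F, hF, hF4, ?_, hD⟩⟩
      rw [Finset.insert_erase hvF]
    · refine Finset.insert_subset_insert _ ?_
      rw [Finset.subset_erase]
      exact ⟨(Finset.subset_insert _ _).trans hsF, h2⟩
    · rw [Finset.card_insert_of_notMem (hVF i), Finset.card_erase_of_mem hvF, hF4]
  · exact ⟨_, (hTT i).1, subset_rfl, (hTT i).2⟩

theorem le41 (d : S2 K K' v T D V) : ∀ s ∈ K'.faces, s.card ≤ 4 := by
  intro s hs
  have hT := d.hT
  rcases d.cases hs with ⟨h1, ⟨h2, h3⟩ | rfl⟩ | ⟨i, s', h1, rfl, h2, h3 | rfl⟩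
  · exact d.np.le4 s h2
  · omega
  · have := d.np.le4 _ h3.mem
    rw [Finset.card_insert_of_notMem h2] at this
    rw [Finset.card_insert_of_notMem (h1 i)]; exact this
  · rw [Finset.card_insert_of_notMem (h1 i)]; omega

theorem two1 (d : S2 K K' v T D V) : ∀ s ∈ K'.faces, s.card = 3 →
    ∃ p q, p ≠ q ∧ ∀ r, (r ∉ s ∧ insert r s ∈ K'.faces) ↔ (r = p ∨ r = q) := by
  intro s hs hc
  have hT := d.hT
  have insV : ∀ {s : Finset ℕ} {r : ℕ}, (∀ j, V j ∉ s) → (∀ j, r ≠ V j) → ∀ j, V j ∉ insert r s := by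
    intro s r h1 h2 j
    simp only [Finset.mem_insert, not_or]
    exact ⟨(h2 j).symm, h1 j⟩
  rcases d.cases hs with ⟨h1, ⟨h2, h3⟩ | rfl⟩ | ⟨i, s', h1, rfl, h2, h3⟩
  · have hsT : s ≠ T := by rintro rfl; exact d.hTK h2
    obtain ⟨p, q, hpq, hr⟩ := d.np.two s h2 hc
    have key : ∀ r, r ∉ s → (∀ j, r ≠ V j) → (insert r s ∈ K'.faces ↔ insert r s ∈ K.faces ∧ r ≠ v) := by
      intro r hrs hrV
      rw [d.m0 _ (insV h1 hrV _) (insV h1 hrV _)]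
      have : insert r s ≠ T := by
        intro h; rw [← h, Finset.card_insert_of_notMem hrs] at hT; omega
      simp only [this, or_false, Finset.mem_insert, h3, not_or, not_false_eq_true, and_true]
      rw [ne_comm (a := r)]
    have hKV : ∀ r, insert r s ∈ K.faces → ∀ j, r ≠ V j := by
      rintro r hr j rfl; exact d.vs hr j (by simp)
    by_cases hvs : insert v s ∈ K.faces
    · obtain ⟨q', hq'v, hq'⟩ : ∃ q', q' ≠ v ∧ ∀ r, (r ∉ s ∧ insert r s ∈ K.faces) ↔ (r = v ∨ r = q') := by
        rcases (hr v).mp ⟨h3, hvs⟩ with rfl | rfl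
        · exact ⟨q, hpq.symm, hr⟩
        · exact ⟨p, hpq, fun r => by rw [hr]; tauto⟩
      have hqK := (hq' q').mpr (Or.inr rfl)
      obtain ⟨i, hi⟩ := d.cover hvs
      refine ⟨V i, q', fun h => hKV q' hqK.2 i h.symm, fun r => ?_⟩
      constructor
      · rintro ⟨h4, h5⟩
        by_cases hrV : ∃ j, r = V j
        · obtain ⟨j, rfl⟩ := hrV
          rw [d.mi h1] at h5
          by_cases hij : i = j
          · exact Or.inl (by rw [hij])
          · have := d.both' h3 (by rw [← Finset.card_pos]; omega) hij hi (h5.2.resolve_right hsT)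
            exact absurd (Finset.eq_of_subset_of_card_le this.1 (by omega)) this.2
        · push Not at hrV
          rw [key r h4 hrV] at h5
          exact Or.inr (((hq' r).mp ⟨h4, h5.1⟩).resolve_left h5.2)
      · rintro (rfl | rfl)
        · exact ⟨h1 i, (d.mi h1).mpr ⟨h3, Or.inl hi⟩⟩
        · exact ⟨hqK.1, (key r hqK.1 (hKV r hqK.2)).mpr ⟨hqK.2, hq'v⟩⟩
    · refine ⟨p, q, hpq, fun r => ?_⟩
      rw [← hr r]
      constructor
      · rintro ⟨h4, h5⟩
        refine ⟨h4, ?_⟩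
        by_cases hrV : ∃ j, r = V j
        · obtain ⟨j, rfl⟩ := hrV
          rw [d.mi h1] at h5
          exact absurd (h5.2.resolve_right hsT).mem hvs
        · push Not at hrV
          exact ((key r h4 hrV).mp h5).1
      · rintro ⟨h4, h5⟩
        exact ⟨h4, (key r h4 (hKV r h5)).mpr ⟨h5, by rintro rfl; exact hvs h5⟩⟩
  · refine ⟨V true, V false, d.hV, fun r => ?_⟩
    constructor
    · rintro ⟨h4, h5⟩
      by_cases hrV : ∃ j, r = V j
      · obtain ⟨j, rfl⟩ := hrV
        cases j
        · exact Or.inr rfl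
        · exact Or.inl rfl
      · push Not at hrV
        rw [d.m0 _ (insV h1 hrV _) (insV h1 hrV _)] at h5
        rcases h5 with h5 | h5
        · exact absurd (mem_of_subset h5.1 (Finset.subset_insert _ _) (by rw [← Finset.card_pos]; omega)) d.hTK
        · have := congrArg Finset.card h5
          rw [Finset.card_insert_of_notMem h4] at this; omega
    · rintro (rfl | rfl)
      · exact ⟨h1 _, (d.mi h1).mpr ⟨d.hv, Or.inr rfl⟩⟩
      · exact ⟨h1 _, (d.mi h1).mpr ⟨d.hv, Or.inr rfl⟩⟩
  · rw [Finset.card_insert_of_notMem (h1 i)] at hc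
    have hc2 : s'.card = 2 := by omega
    have hside : Side K v D i s' := h3.resolve_right (by rintro rfl; omega)
    have hne : s'.Nonempty := by rw [← Finset.card_pos]; omega
    have hmem := hside.mem
    have hcv : (insert v s').card = 3 := by rw [Finset.card_insert_of_notMem h2]; omega
    obtain ⟨p, q, hpq, hr⟩ := d.np.two _ hmem hcv
    -- reformulation
    have key : ∀ r, (r ∉ insert (V i) s' ∧ insert r (insert (V i) s') ∈ K'.faces) ↔
        (r ∉ insert v s' ∧ (∀ j, r ≠ V j) ∧ (Side K v D i (insert r s') ∨ insert r s' = T)) := by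
      intro r
      by_cases hrV : ∃ j, r = V j
      · obtain ⟨j, rfl⟩ := hrV
        constructor
        · rintro ⟨h4, h5⟩
          have hij : i ≠ j := by rintro rfl; simp at h4
          exact absurd h5 (d.m2' hij (by simp) (by simp))
        · rintro ⟨h4, h5, h6⟩; exact absurd rfl (h5 j)
      · push Not at hrV
        rw [Finset.insert_comm, d.mi (insV h1 hrV)]
        simp only [Finset.mem_insert, not_or, h2, not_false_eq_true, and_true]
        constructor
        · rintro ⟨h4, h5, h6⟩; exact ⟨⟨Ne.symm h5, h4.2⟩, hrV, h6⟩
        · rintro ⟨h4, h5, h6⟩; exact ⟨⟨hrV i, h4.2⟩, Ne.symm h4.1, h6⟩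
    have hKV : ∀ r, insert r (insert v s') ∈ K.faces → ∀ j, r ≠ V j := by
      rintro r hr j rfl; exact d.vs hr j (by simp)
    by_cases hsT : s' ⊆ T
    · obtain ⟨c, hcs, hcT⟩ := insert_of_card hsT hc2 hT
      obtain ⟨p1, hp1, hp1K, hp1D⟩ := d.cross s' hsT hc2 i
      obtain ⟨p2, hp2, hp2K, hp2D⟩ := d.cross s' hsT hc2 (!i)
      have hne12 : p1 ≠ p2 := by
        rintro rfl; rw [hp1D] at hp2D; cases i <;> simp at hp2D
      have hr' : ∀ r, (r ∉ insert v s' ∧ insert r (insert v s') ∈ K.faces) ↔ (r = p1 ∨ r = p2) := by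
        intro r
        have e1 := (hr p1).mp ⟨hp1, hp1K⟩
        have e2 := (hr p2).mp ⟨hp2, hp2K⟩
        rw [hr r]
        rcases e1 with rfl | rfl <;> rcases e2 with rfl | rfl <;> first | tauto | exact absurd rfl hne12
      have hcv' : c ≠ v := by rintro rfl; exact d.hv (by rw [hcT]; simp)
      have hp1c : p1 ≠ c := by
        rintro rfl
        refine d.hTK (mem_of_subset hp1K ?_ (by rw [hcT]; simp))
        rw [hcT]; exact Finset.insert_subset_insert _ (Finset.subset_insert _ _)
      refine ⟨p1, c, hp1c, fun r => ?_⟩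
      rw [key r]
      constructor
      · rintro ⟨h4, h5, h6 | h6⟩
        · left
          have hK : insert r (insert v s') ∈ K.faces := by rw [Finset.insert_comm]; exact h6.mem
          rcases (hr' r).mp ⟨h4, hK⟩ with h7 | rfl
          · exact h7
          · exfalso
            obtain ⟨F, hF, hF4, hsF, hD⟩ := h6
            have : insert v (insert r s') = F := by
              refine Finset.eq_of_subset_of_card_le hsF ?_
              rw [Finset.insert_comm, Finset.card_insert_of_notMem h4]; omega
            rw [← this, Finset.insert_comm, hp2D] at hD
            cases i <;> simp at hD
        · right
          have : r ∈ insert c s' := by rw [← hcT, ← h6]; simp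
          simp only [Finset.mem_insert] at this
          refine this.resolve_right fun h => h4 (by simp [h])
      · rintro (rfl | rfl)
        · refine ⟨hp1, hKV _ hp1K, Or.inl ⟨_, hp1K, ?_, ?_, hp1D⟩⟩
          · rw [Finset.card_insert_of_notMem hp1]; omega
          · rw [Finset.insert_comm]
        · refine ⟨by simp [hcv', hcs], ?_, Or.inr hcT.symm⟩
          rintro j rfl; exact d.vT j (by rw [hcT]; simp)
    · refine ⟨p, q, hpq, fun r => ?_⟩
      rw [key r, ← hr r]
      constructor
      · rintro ⟨h4, h5, h6 | h6⟩
        · exact ⟨h4, by rw [Finset.insert_comm]; exact h6.mem⟩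
        · exact absurd (h6 ▸ Finset.subset_insert r s') hsT
      · rintro ⟨h4, h5⟩
        refine ⟨h4, hKV r h5, Or.inl (d.side_of h2 hne hside hsT (Finset.subset_insert _ _) ?_)⟩
        rw [Finset.insert_comm]; exact h5

theorem adj0 (d : S2 K K' v T D V) {s : Finset ℕ} (hv : v ∉ s) {a b : ℕ} (h : K.LAdj s a b) (ha : a ≠ v) (hb : b ≠ v) :
    K'.LAdj s a b := by
  refine ⟨h.1, h.2.1, ?_⟩
  rw [d.m0 _ (d.vs h.2.2 _) (d.vs h.2.2 _)]
  exact Or.inl ⟨h.2.2, by simp [Ne.symm ha, Ne.symm hb, hv]⟩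

theorem adj1 (d : S2 K K' v T D V) {s : Finset ℕ} (hv : v ∉ s) (hs : ∀ j, V j ∉ s) {b : ℕ} {i : Bool} (hb : b ∉ s)
    (hbv : b ≠ v) (h : Side K v D i (insert b s)) : K'.LAdj s (V i) b := by
  refine ⟨hs i, hb, ?_⟩
  have hVb : ∀ j, V j ∉ insert b s := by
    intro j hj
    exact d.vs h.mem j (Finset.mem_insert_of_mem hj)
  rw [d.mi hVb]
  exact ⟨by simp [hv, Ne.symm hbv], Or.inl h⟩

theorem conn_a (d : S2 K K' v T D V) {s : Finset ℕ} (hV : ∀ j, V j ∉ s) (hc : s.card ≤ 2) (hsT : s ⊆ T)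
    (x : ℕ) (c : ℕ) (hcT : c ∈ T) (hcs : c ∉ s) (hx : x ∉ s) (hxs : insert x s ∈ K'.faces) :
    Relation.ReflTransGen (K'.LAdj s) c x := by
  have hT := d.hT
  have hv : v ∉ s := fun h => d.hv (hsT h)
  have hsne : s ≠ T := by rintro rfl; omega
  have hcV : ∀ i, K'.LAdj s (V i) c := by
    intro i
    have hsub : insert c s ⊆ T := Finset.insert_subset hcT hsT
    have hVc : ∀ j, V j ∉ insert c s := fun j hj => d.vT j (hsub hj)
    refine ⟨hV i, hcs, ?_⟩
    rw [d.mi hVc]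
    refine ⟨fun h => d.hv (hsub h), ?_⟩
    by_cases h : insert c s = T
    · exact Or.inr h
    · exact Or.inl (d.side_T hsub h i)
  have key : ∀ y, Relation.ReflTransGen (K.LAdj s) v y → y ≠ v → Relation.ReflTransGen (K'.LAdj s) c y := by
    intro y hy
    induction hy with
    | refl => intro h; exact absurd rfl h
    | tail h1 h2 ih =>
      rename_i a b
      intro hb
      by_cases ha : a = v
      · subst ha
        obtain ⟨i, hi⟩ := d.cover h2.2.2
        exact (Relation.ReflTransGen.single (hcV i).symm).tail (d.adj1 hv hV h2.2.1 hb hi)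
      · exact (ih ha).tail (d.adj0 hv h2 ha hb)
  by_cases hxV : ∃ i, x = V i
  · obtain ⟨i, rfl⟩ := hxV
    exact Relation.ReflTransGen.single (hcV i).symm
  · push Not at hxV
    have hVx : ∀ j, V j ∉ insert x s := by
      intro j; simp only [Finset.mem_insert, not_or]; exact ⟨(hxV j).symm, hV j⟩
    rw [d.m0 _ (hVx _) (hVx _)] at hxs
    rcases hxs with ⟨h1, h2⟩ | h1
    · refine key x (d.np.conn s hc v x hv hx (d.side_T hsT hsne true).mem h1) ?_
      rintro rfl; simp at h2
    · have : c ∈ insert x s := by rw [h1]; exact hcT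
      simp only [Finset.mem_insert, hcs, or_false] at this
      rw [this]

theorem conn_b (d : S2 K K' v T D V) {s : Finset ℕ} (hV : ∀ j, V j ∉ s) (hv : v ∉ s) (hc : s.card ≤ 2) (hsT : ¬ s ⊆ T)
    (x y : ℕ) (hx : x ∉ s) (hy : y ∉ s) (hxs : insert x s ∈ K'.faces) (hys : insert y s ∈ K'.faces) :
    Relation.ReflTransGen (K'.LAdj s) x y := by
  have hT := d.hT
  have hsne : s.Nonempty := by
    rw [Finset.nonempty_iff_ne_empty]; rintro rfl; simp at hsT
  have hi : ∃ i, ∀ j t, s ⊆ t → Side K v D j t → j = i := by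
    by_cases h : insert v s ∈ K.faces
    · obtain ⟨i, hi⟩ := d.cover h
      refine ⟨i, fun j t hst hj => ?_⟩
      by_contra hij
      exact hsT (d.both' hv hsne hij (hj.mono hst) hi).1
    · exact ⟨true, fun j t hst hj => absurd (hj.mono hst).mem h⟩
  obtain ⟨i, hi⟩ := hi
  have lift : ∀ x, x ∉ s → insert x s ∈ K'.faces → ∃ a, a ∉ s ∧ insert a s ∈ K.faces ∧ x = if a = v then V i else a := by
    intro x hx hxs
    by_cases hxV : ∃ i, x = V i
    · obtain ⟨j, rfl⟩ := hxV
      rw [d.mi hV] at hxs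
      have hside := hxs.2.resolve_right (by rintro rfl; exact hsT subset_rfl)
      have := hi j s subset_rfl hside
      exact ⟨v, hv, hside.mem, by simp [this]⟩
    · push Not at hxV
      have hVx : ∀ j, V j ∉ insert x s := by
        intro j; simp only [Finset.mem_insert, not_or]; exact ⟨(hxV j).symm, hV j⟩
      rw [d.m0 _ (hVx _) (hVx _)] at hxs
      rcases hxs with ⟨h1, h2⟩ | h1
      · refine ⟨x, hx, h1, ?_⟩
        have : x ≠ v := by rintro rfl; simp at h2
        simp [this]
      · exact absurd (h1 ▸ Finset.subset_insert x s) hsT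
  obtain ⟨a, ha, ha2, rfl⟩ := lift x hx hxs
  obtain ⟨b, hb, hb2, rfl⟩ := lift y hy hys
  refine Relation.ReflTransGen.lift (fun a => if a = v then V i else a) ?_ _ _ (d.np.conn s hc a b ha hb ha2 hb2)
  intro p q hpq
  show K'.LAdj s (if p = v then V i else p) (if q = v then V i else q)
  have st : ∀ q, q ≠ v → K.LAdj s v q → K'.LAdj s (V i) q := by
    intro q hq h
    obtain ⟨j, hj⟩ := d.cover h.2.2
    have := hi j _ (Finset.subset_insert _ _) hj
    subst this
    exact d.adj1 hv hV h.2.1 hq hj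
  by_cases hp : p = v <;> by_cases hq : q = v
  · subst hp; subst hq
    simp only [if_true]
    refine ⟨hV i, hV i, ?_⟩
    rw [Finset.insert_idem, d.mi hV]
    obtain ⟨j, hj⟩ := d.cover hpq.left
    have := hi j _ subset_rfl hj
    exact ⟨hv, Or.inl (this ▸ hj)⟩
  · subst hp
    simp only [if_true, hq, if_false]
    exact st q hq hpq
  · subst hq
    simp only [if_true, hp, if_false]
    exact (st p hp hpq.symm).symm
  · simp only [hp, hq, if_false]
    exact d.adj0 hv hpq hp hq

open Classical in
theorem conn_c (d : S2 K K' v T D V) {s : Finset ℕ} (hV : ∀ j, V j ∉ s) (hv : v ∉ s) (hc : s.card ≤ 1) (i : Bool)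
    (x y : ℕ) (hx : x ∉ insert (V i) s) (hy : y ∉ insert (V i) s) (hxs : insert x (insert (V i) s) ∈ K'.faces)
    (hys : insert y (insert (V i) s) ∈ K'.faces) :
    Relation.ReflTransGen (K'.LAdj (insert (V i) s)) x y := by
  have hT := d.hT
  obtain ⟨t0, ht0, ht0s⟩ := Finset.exists_mem_notMem_of_card_lt_card (s := s) (t := T) (by omega)
  have lift : ∀ x, x ∉ insert (V i) s → insert x (insert (V i) s) ∈ K'.faces →
      x ∉ s ∧ x ≠ v ∧ Side K v D i (insert x s) := by
    intro x hx hxs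
    simp only [Finset.mem_insert, not_or] at hx
    have hxV : ∀ j, x ≠ V j := by
      rintro j rfl
      have hij : i ≠ j := by rintro rfl; exact hx.1 rfl
      exact d.m2' hij (by simp) (by simp) hxs
    have hVx : ∀ j, V j ∉ insert x s := by
      intro j; simp only [Finset.mem_insert, not_or]; exact ⟨(hxV j).symm, hV j⟩
    rw [Finset.insert_comm, d.mi hVx] at hxs
    simp only [Finset.mem_insert, not_or] at hxs
    refine ⟨hx.2, Ne.symm hxs.1.1, hxs.2.resolve_right fun h => ?_⟩
    have := congrArg Finset.card h
    rw [Finset.card_insert_of_notMem hx.2] at this; omega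
  obtain ⟨hx1, hx2, hx3⟩ := lift x hx hxs
  obtain ⟨hy1, hy2, hy3⟩ := lift y hy hys
  have path := d.np.conn (insert v s) (by rw [Finset.card_insert_of_notMem hv]; omega) x y (by simp [hx1, hx2])
    (by simp [hy1, hy2]) (by rw [Finset.insert_comm]; exact hx3.mem) (by rw [Finset.insert_comm]; exact hy3.mem)
  have := Relation.ReflTransGen.lift (p := K'.LAdj (insert (V i) s)) (fun a => if Side K v D i (insert a s) then a else t0) ?_ _ _ path
  · simpa only [Function.onFun, hx3, hy3, if_true] using this
  · rintro p q ⟨h1, h2, h3⟩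
    show K'.LAdj (insert (V i) s) (if Side K v D i (insert p s) then p else t0) (if Side K v D i (insert q s) then q else t0)
    simp only [Finset.mem_insert, not_or] at h1 h2
    have h3' : insert v (insert p (insert q s)) ∈ K.faces := by
      rw [Finset.insert_comm, Finset.insert_comm v]; exact h3
    have mk : ∀ a b, a ∉ s → b ∉ s → (∀ j, V j ∉ insert a (insert b s)) → v ∉ insert a (insert b s) →
        (Side K v D i (insert a (insert b s)) ∨ insert a (insert b s) = T) → K'.LAdj (insert (V i) s) a b := by
      intro a b ha hb hab hvab h
      have e1 := hab i
      simp only [Finset.mem_insert, not_or] at e1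
      refine ⟨by simp [ha, Ne.symm e1.1], by simp [hb, Ne.symm e1.2.1], ?_⟩
      rw [Finset.insert_comm b, Finset.insert_comm a, d.mi hab]
      exact ⟨hvab, h⟩
    obtain ⟨j, hj⟩ := d.cover h3'
    by_cases hij : i = j
    · subst hij
      have ep : Side K v D i (insert p s) := hj.mono (Finset.insert_subset_insert _ (Finset.subset_insert _ _))
      have eq : Side K v D i (insert q s) := hj.mono (Finset.subset_insert _ _)
      simp only [ep, eq, if_true]
      refine mk p q h1.2 h2.2 ?_ ?_ (Or.inl hj)
      · intro k hk; exact d.vs h3' k (Finset.mem_insert_of_mem hk)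
      · simp [hv, Ne.symm h1.1, Ne.symm h2.1]
    · have inT : ∀ r, r ∉ s → r ≠ v → Side K v D j (insert r s) →
          (if Side K v D i (insert r s) then r else t0) ∈ T ∧ (if Side K v D i (insert r s) then r else t0) ∉ s := by
        intro r hr hrv hrj
        split_ifs with h
        · have := d.both' (s := insert r s) (by simp [hv, Ne.symm hrv]) (by simp) hij h hrj
          exact ⟨this.1 (by simp), hr⟩
        · exact ⟨ht0, ht0s⟩
      have hsT : s ⊆ T := by
        by_cases hs0 : s = ∅
        · rw [hs0]; simp
        have hs0' := Finset.nonempty_iff_ne_empty.mpr hs0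
        exact (d.both' hv hs0' hij (hx3.mono (Finset.subset_insert _ _))
          (hj.mono ((Finset.subset_insert _ _).trans (Finset.subset_insert _ _)))).1
      have ip := inT p h1.2 h1.1 (hj.mono (Finset.insert_subset_insert _ (Finset.subset_insert _ _)))
      have iq := inT q h2.2 h2.1 (hj.mono (Finset.subset_insert _ _))
      have hsub := Finset.insert_subset ip.1 (Finset.insert_subset iq.1 hsT)
      refine mk _ _ ip.2 iq.2 (fun k hk => d.vT k (hsub hk)) (fun hk => d.hv (hsub hk)) ?_
      by_cases h : insert (if Side K v D i (insert p s) then p else t0) (insert (if Side K v D i (insert q s) then q else t0) s) = T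
      · exact Or.inr h
      · exact Or.inl (d.side_T hsub h i)

theorem np1 (d : S2 K K' v T D V) : K'.NP where
  ne := ⟨T, (d.m0 T (d.vT _) (d.vT _)).mpr (Or.inr rfl)⟩
  pure := d.pure1
  le4 := d.le41
  two := d.two1
  conn := by
    intro s hc x y hx hy hxs hys
    have hT := d.hT
    by_cases h : ∃ i, V i ∈ s
    · obtain ⟨i, hi⟩ := h
      obtain ⟨s', hw', rfl⟩ : ∃ s', V i ∉ s' ∧ s = insert (V i) s' :=
        ⟨s.erase (V i), by simp, (Finset.insert_erase hi).symm⟩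
      rw [Finset.card_insert_of_notMem hw'] at hc
      have hV : ∀ j, V j ∉ s' := by
        intro j hj
        have hij : i ≠ j := by rintro rfl; exact hw' hj
        exact d.m2' hij (by simp) (by simp [hj]) hxs
      have hs : insert (V i) s' ∈ K'.faces := mem_of_subset hxs (Finset.subset_insert _ _) (by simp)
      rw [d.mi hV] at hs
      exact d.conn_c hV hs.1 (by omega) i x y hx hy hxs hys
    · push Not at h
      by_cases hsT : s ⊆ T
      · obtain ⟨t0, ht0, ht0s⟩ := Finset.exists_mem_notMem_of_card_lt_card (s := s) (t := T) (by omega)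
        have h1 := d.conn_a h hc hsT x t0 ht0 ht0s hx hxs
        have h2 := d.conn_a h hc hsT y t0 ht0 ht0s hy hys
        have hsym : ∀ a b, Relation.ReflTransGen (K'.LAdj s) a b → Relation.ReflTransGen (K'.LAdj s) b a := by
          intro a b hab
          induction hab with
          | refl => exact Relation.ReflTransGen.refl
          | tail _ h2 ih => exact Relation.ReflTransGen.head h2.symm ih
        exact (hsym _ _ h1).trans h2
      · have hsne : s.Nonempty := by
          rw [Finset.nonempty_iff_ne_empty]; rintro rfl; simp at hsT
        have hs : s ∈ K'.faces := mem_of_subset hxs (Finset.subset_insert _ _) hsne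
        rw [d.m0 _ (h _) (h _)] at hs
        have hv : v ∉ s := by
          rcases hs with hs | rfl
          · exact hs.2
          · exact d.hv
        exact d.conn_b h hv hc hsT x y hx hy hxs hys

end S2
end SComplex

namespace SComplex
open SData

/-- predicate describing the expanded complex -/
def PM (K : SComplex) (v : ℕ) (T : Finset ℕ) (D : Finset ℕ → Bool) (V : Bool → ℕ) (s : Finset ℕ) : Prop :=
  s.Nonempty ∧ v ∉ s ∧ (s \ {V true, V false} = ∅ ∨ s \ {V true, V false} ∈ K.faces) ∧
  (∀ i, V i ∈ s → Side K v D i (s \ {V true, V false})) ∧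
  (V true ∈ s → V false ∈ s → s \ {V true, V false} ⊆ T ∧ s \ {V true, V false} ≠ T)

theorem PM.mono {K : SComplex} {v : ℕ} {T : Finset ℕ} {D : Finset ℕ → Bool} {V : Bool → ℕ} {s t : Finset ℕ}
    (h : PM K v T D V s) (hts : t ⊆ s) (ht : t.Nonempty) : PM K v T D V t := by
  obtain ⟨h1, h2, h3, h4, h5⟩ := h
  have hsub : t \ {V true, V false} ⊆ s \ {V true, V false} := Finset.sdiff_subset_sdiff hts subset_rfl
  refine ⟨ht, fun h => h2 (hts h), ?_, fun i hi => (h4 i (hts hi)).mono hsub, fun a b => ?_⟩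
  · by_cases h : t \ {V true, V false} = ∅
    · exact Or.inl h
    · right
      rcases h3 with h3 | h3
      · rw [h3] at hsub; exact absurd (Finset.subset_empty.mp hsub) h
      · exact mem_of_subset h3 hsub (Finset.nonempty_iff_ne_empty.mpr h)
  · obtain ⟨h6, h7⟩ := h5 (hts a) (hts b)
    refine ⟨hsub.trans h6, fun h => h7 ?_⟩
    exact le_antisymm h6 (h ▸ hsub)

theorem split_exists {K : SComplex} {v : ℕ} {T : Finset ℕ} {D : Finset ℕ → Bool} (d : SData K v T D) :
    ∃ M K' V, S2 K K' v T D V ∧ EdgeContraction M K ∧ BistellarTwoMove M K' := by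
  classical
  obtain ⟨a, b, c, hab, hac, hbc, hTe⟩ := Finset.card_eq_three.mp d.hT
  obtain ⟨V1, hV1⟩ : ∃ x, x ∉ insert v (K.vertexSet ∪ T) := Infinite.exists_notMem_finset _
  obtain ⟨V2, hV2⟩ : ∃ x, x ∉ insert V1 (insert v (K.vertexSet ∪ T)) := Infinite.exists_notMem_finset _
  simp only [Finset.mem_insert, Finset.mem_union, not_or] at hV1 hV2
  obtain ⟨hV1v, hV1K, hV1T⟩ := hV1
  obtain ⟨hV21, hV2v, hV2K, hV2T⟩ := hV2
  let V : Bool → ℕ := fun i => if i then V1 else V2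
  have eV1 : V true = V1 := rfl
  have eV2 : V false = V2 := rfl
  have fr : ∀ i, {V i} ∉ K.faces := by
    intro i; cases i
    · rw [eV2, ← mem_vertexSet]; exact hV2K
    · rw [eV1, ← mem_vertexSet]; exact hV1K
  have frs : ∀ s ∈ K.faces, ∀ i, V i ∉ s := fun s hs i h =>
    fr i (mem_of_subset hs (by simpa using h) (by simp))
  have hVv : ∀ i, V i ≠ v := by intro i; cases i <;> simp [V, hV1v, hV2v]
  have hVT : ∀ i, V i ∉ T := by intro i; cases i <;> simp [V, hV1T, hV2T]
  set W : Finset ℕ := {V true, V false} with hW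
  have sd : ∀ s : Finset ℕ, V true ∉ s → V false ∉ s → s \ W = s := by
    intro s h1 h2
    rw [Finset.sdiff_eq_self_iff_disjoint, hW, Finset.disjoint_right]
    simp [h1, h2]
  have sdi : ∀ i, ∀ s : Finset ℕ, (insert (V i) s) \ W = s \ W := by
    intro i s
    ext x; simp only [Finset.mem_sdiff, Finset.mem_insert, hW]; cases i <;> simp <;> tauto
  let Mf : Finset (Finset ℕ) := (K.vertexSet ∪ W).powerset.filter (PM K v T D V)
  have T0 : T ≠ ∅ := by rintro rfl; simpa using d.hT
  have hMf : ∀ s, s ∈ Mf ↔ PM K v T D V s := by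
    intro s
    simp only [Mf, Finset.mem_filter, Finset.mem_powerset, and_iff_right_iff_imp]
    intro h x hx
    by_cases hxW : x ∈ W
    · exact Finset.mem_union_right _ hxW
    · apply Finset.mem_union_left
      rcases h.2.2.1 with h1 | h1
      · have : x ∈ s \ W := Finset.mem_sdiff.mpr ⟨hx, hxW⟩
        rw [h1] at this; simp at this
      · exact face_subset_vertexSet h1 (Finset.mem_sdiff.mpr ⟨hx, hxW⟩)
  let M : SComplex := ⟨Mf, by
    rw [hMf]; rintro ⟨h, -⟩; simp at h, by
    intro s hs t hts ht
    rw [hMf] at hs ⊢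
    exact hs.mono hts (Finset.nonempty_iff_ne_empty.mpr ht)⟩
  have hM : ∀ s, s ∈ M.faces ↔ PM K v T D V s := hMf
  have M0 : ∀ s, V true ∉ s → V false ∉ s → (s ∈ M.faces ↔ s ∈ K.faces ∧ v ∉ s) := by
    intro s h1 h2
    rw [hM, PM, ← hW, sd s h1 h2]
    constructor
    · rintro ⟨h3, h4, h5, -⟩
      exact ⟨h5.resolve_left (Finset.nonempty_iff_ne_empty.mp h3), h4⟩
    · rintro ⟨h3, h4⟩
      exact ⟨face_nonempty h3, h4, Or.inr h3, fun i hi => absurd hi (frs _ h3 i), fun h => absurd h h1⟩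
  have side0 : ∀ i s, v ∉ s → Side K v D i s → s = ∅ ∨ s ∈ K.faces := by
    intro i s _ h
    by_cases hs : s = ∅
    · exact Or.inl hs
    · exact Or.inr (mem_of_subset h.mem (Finset.subset_insert _ _) (Finset.nonempty_iff_ne_empty.mpr hs))
  have hij : ∀ i j, V i = V j → i = j := by
    intro i j; cases i <;> cases j <;> simp [V] <;> intro h
    · exact hV21 h
    · exact hV21 h.symm
  have M1 : ∀ i s, V true ∉ s → V false ∉ s → (insert (V i) s ∈ M.faces ↔ v ∉ s ∧ Side K v D i s) := by
    intro i s h1 h2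
    rw [hM, PM, ← hW, sdi, sd s h1 h2]
    have hj : ∀ j, V j ∈ insert (V i) s → j = i := by
      intro j hj
      rcases Finset.mem_insert.mp hj with h | h
      · exact hij _ _ h
      · cases j <;> contradiction
    constructor
    · rintro ⟨h3, h4, h5, h6, h7⟩
      exact ⟨fun h => h4 (Finset.mem_insert_of_mem h), h6 i (by simp)⟩
    · rintro ⟨h3, h4⟩
      refine ⟨by simp, by simp [h3, (hVv i).symm], side0 i s h3 h4, ?_, ?_⟩
      · intro j hj'; rw [hj j hj']; exact h4
      · intro ha hb; exact absurd ((hj _ ha).trans (hj _ hb).symm) (by simp)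
  have M2 : ∀ s, V true ∉ s → V false ∉ s → (insert (V true) (insert (V false) s) ∈ M.faces ↔ s ⊆ T ∧ s ≠ T) := by
    intro s h1 h2
    rw [hM, PM, ← hW, sdi, sdi, sd s h1 h2]
    constructor
    · rintro ⟨h3, h4, h5, h6, h7⟩
      exact h7 (by simp) (by simp)
    · rintro ⟨h3, h4⟩
      have hv : v ∉ s := fun h => d.hv (h3 h)
      exact ⟨by simp, by simp [hv, (hVv _).symm], side0 true s hv (d.side_T h3 h4 _), fun i _ => d.side_T h3 h4 i,
        fun _ _ => ⟨h3, h4⟩⟩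
  have eW : ∀ s : Finset ℕ, W ⊆ s ↔ V true ∈ s ∧ V false ∈ s := by
    intro s; rw [hW, Finset.insert_subset_iff, Finset.singleton_subset_iff]
  let Kf : Finset (Finset ℕ) := ((M.faces.filter fun α => ¬ W ⊆ α) ∪
      simplexFaces (insert (V true) T)) ∪ simplexFaces (insert (V false) T)
  have hsf : ∀ s t : Finset ℕ, s ∈ simplexFaces t ↔ s ⊆ t ∧ s ≠ ∅ := by
    intro s t; simp [simplexFaces]
  have hKf : ∀ s, s ∈ Kf ↔ (s ∈ M.faces ∧ ¬ W ⊆ s) ∨ (∃ i, s ⊆ insert (V i) T) ∧ s ≠ ∅ := by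
    intro s
    simp only [Kf, Finset.mem_union, Finset.mem_filter, hsf, Bool.exists_bool]
    tauto
  let K' : SComplex := ⟨Kf, by
    rw [hKf]; rintro (h | h)
    · exact M.not_empty_mem h.1
    · exact h.2 rfl, by
    intro s hs t hts ht
    rw [hKf] at hs ⊢
    rcases hs with h | ⟨⟨i, h⟩, -⟩
    · exact Or.inl ⟨M.down_closed s h.1 t hts ht, fun h' => h.2 (h'.trans hts)⟩
    · exact Or.inr ⟨⟨i, hts.trans h⟩, ht⟩⟩
  have hK' : ∀ s, s ∈ K'.faces ↔ (s ∈ M.faces ∧ ¬ W ⊆ s) ∨ (∃ i, s ⊆ insert (V i) T) ∧ s ≠ ∅ := hKf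
  have subT : ∀ s, s ⊆ T → s ≠ ∅ → s ≠ T → s ∈ K.faces ∧ v ∉ s := by
    intro s h1 h2 h3
    exact ⟨mem_of_subset (d.side_T h1 h3 true).mem (Finset.subset_insert _ _) (Finset.nonempty_iff_ne_empty.mpr h2),
      fun h => d.hv (h1 h)⟩
  have vne : V true ≠ V false := fun h => absurd (hij _ _ h) (by simp)
  have hfacet : ∀ s, s ∈ K.faces ∧ v ∉ s ↔ s ∈ M.faces ∧ V true ∉ s ∧ V false ∉ s := by
    intro s
    constructor
    · intro h
      exact ⟨(M0 s (frs s h.1 _) (frs s h.1 _)).mpr h, frs s h.1 _, frs s h.1 _⟩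
    · rintro ⟨h1, h2, h3⟩
      exact (M0 s h2 h3).mp h1
  refine ⟨M, K', V, ⟨d, vne, fr, ?_, ?_, ?_⟩, ⟨V true, V false, ?_, vne, ?_, v, ?_, ?_⟩, 
    ⟨V true, V false, a, b, c, ?_, vne, ?_, ?_, ?_, ?_, ?_, ?_⟩⟩
  · intro s h1 h2
    rw [hK', M0 s h1 h2, eW]
    constructor
    · rintro (h | ⟨⟨i, h⟩, h'⟩)
      · exact Or.inl h.1
      · have : s ⊆ T := by
          rw [Finset.subset_insert_iff_of_notMem] at h
          · exact h
          · cases i <;> assumption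
        by_cases hs : s = T
        · exact Or.inr hs
        · exact Or.inl (subT s this h' hs)
    · rintro (h | rfl)
      · exact Or.inl ⟨h, fun h' => h1 h'.1⟩
      · exact Or.inr ⟨⟨true, Finset.subset_insert _ _⟩, T0⟩
  · intro i s h1 h2
    have hi : V i ∉ s := by cases i <;> assumption
    rw [hK', M1 i s h1 h2, eW]
    constructor
    · rintro (⟨h, -⟩ | ⟨⟨j, h⟩, -⟩)
      · exact ⟨h.1, Or.inl h.2⟩
      · have : i = j := by
          rcases Finset.mem_insert.mp (h (Finset.mem_insert_self _ _)) with h' | h'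
          · exact hij _ _ h'
          · exact absurd h' (hVT i)
        subst this
        have hs : s ⊆ T := by
          rwa [Finset.insert_subset_insert_iff hi] at h
        refine ⟨fun h => d.hv (hs h), ?_⟩
        by_cases hs' : s = T
        · exact Or.inr hs'
        · exact Or.inl (d.side_T hs hs' i)
    · rintro ⟨h3, h4 | rfl⟩
      · refine Or.inl ⟨⟨h3, h4⟩, ?_⟩
        rintro ⟨ha, hb⟩
        cases i
        · rcases Finset.mem_insert.mp ha with h | h
          · exact vne h
          · exact h1 h
        · rcases Finset.mem_insert.mp hb with h | h
          · exact vne h.symm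
          · exact h2 h
      · exact Or.inr ⟨⟨i, subset_rfl⟩, by simp⟩
  · intro s h1 h2
    rw [hK', eW]
    rintro (⟨-, h⟩ | ⟨⟨j, h⟩, -⟩)
    · exact h ⟨h1, h2⟩
    · have e : ∀ i, V i ∈ s → i = j := by
        intro i hi
        rcases Finset.mem_insert.mp (h hi) with h' | h'
        · exact hij _ _ h'
        · exact absurd h' (hVT i)
      exact absurd ((e _ h1).trans (e _ h2).symm) (by simp)
  · exact (M2 ∅ (by simp) (by simp)).mpr ⟨by simp, T0.symm⟩
  · ext s
    rw [Finset.mem_inter, mem_lk, mem_lk, mem_lk]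
    have e1 : ∀ x, s ∩ {x} = ∅ ↔ x ∉ s := by
      intro x
      rw [← Finset.disjoint_iff_inter_eq_empty, Finset.disjoint_singleton_right]
    have e2 : s ∩ {V true, V false} = ∅ ↔ V true ∉ s ∧ V false ∉ s := by
      rw [← Finset.disjoint_iff_inter_eq_empty, Finset.disjoint_right]
      simp
    have e3 : ∀ x, s ∪ {x} = insert x s := by intro x; ext; simp
    have e4 : s ∪ {V true, V false} = insert (V true) (insert (V false) s) := by ext; simp
    rw [e1, e1, e2, e3, e3, e4]
    constructor
    · rintro ⟨⟨h1, h2, h3⟩, h4, h5, h6⟩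
      rw [M1 _ s h2 h5] at h3 h6
      exact ⟨h1, ⟨h2, h5⟩, (M2 s h2 h5).mpr (d.both h3.1 (face_nonempty h1) h3.2 h6.2)⟩
    · rintro ⟨h1, ⟨h2, h3⟩, h4⟩
      refine ⟨⟨h1, h2, mem_of_subset h4 (Finset.insert_subset_insert _ (Finset.subset_insert _ _)) (by simp)⟩,
        h1, h3, mem_of_subset h4 (Finset.subset_insert _ _) (by simp)⟩
  · rw [mem_vertexSet, hM]
    rintro ⟨-, h, -⟩; simp at h
  · have hb := fun s => bdry_iff d.np (u := v) (v := v) (s := s) (fun _ _ _ _ _ _ => rfl)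
      (M.faces.filter fun α => V true ∉ α ∧ V false ∉ α) (by
        intro α
        rw [Finset.mem_filter, ← hfacet]; simp)
    ext s
    rw [coneFaces]
    simp only [Finset.mem_union, hb, Finset.mem_image, Finset.mem_filter, Finset.mem_singleton, ← hfacet]
    constructor
    · intro hs
      by_cases hv : v ∈ s
      · right
        by_cases hs1 : s = {v}
        · exact Or.inr hs1
        · left; right
          refine ⟨s.erase v, ⟨mem_of_subset hs (Finset.erase_subset _ _) ?_, by simp, by simp, ?_⟩, Finset.insert_erase hv⟩
          · rw [Finset.nonempty_iff_ne_empty]; intro h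
            rw [Finset.erase_eq_empty_iff] at h
            rcases h with rfl | h
            · simp at hv
            · exact hs1 h
          · rw [Finset.insert_erase hv]; exact Or.inl hs
      · exact Or.inl ⟨hs, hv⟩
    · rintro (h | (h | ⟨r, h, rfl⟩) | rfl)
      · exact h.1
      · exact h.1
      · exact h.2.2.2.elim id id
      · exact (d.side_T (s := ∅) (by simp) T0.symm true).mem
  · exact (M2 ∅ (by simp) (by simp)).mpr ⟨by simp, T0.symm⟩
  · rw [← hTe]; exact d.hT
  · rw [← hTe]; exact hVT _
  · rw [← hTe]; exact hVT _
  · rw [← hTe]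
    ext s
    rw [mem_lk]
    have e2 : s ∩ {V true, V false} = ∅ ↔ V true ∉ s ∧ V false ∉ s := by
      rw [← Finset.disjoint_iff_inter_eq_empty, Finset.disjoint_right]
      simp
    have e4 : s ∪ {V true, V false} = insert (V true) (insert (V false) s) := by ext; simp
    rw [e2, e4]
    simp only [properFaces, Finset.mem_filter, Finset.mem_powerset]
    constructor
    · rintro ⟨h1, h2, h3⟩
      rw [M2 s h2.1 h2.2] at h3
      exact ⟨h3.1, Finset.nonempty_iff_ne_empty.mp (face_nonempty h1), h3.2⟩
    · rintro ⟨h1, h2, h3⟩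
      have h4 : ∀ i, V i ∉ s := fun i h => hVT i (h1 h)
      exact ⟨(M0 s (h4 _) (h4 _)).mpr (subT s h1 h2 h3), ⟨h4 _, h4 _⟩, (M2 s (h4 _) (h4 _)).mpr ⟨h1, h3⟩⟩
  · rw [← hTe, M0 T (hVT _) (hVT _)]
    exact fun h => d.hTK h.1
  · rw [← hTe]

end SComplex

namespace SComplex
open SData

theorem S2.f0 {K K' : SComplex} {v : ℕ} {T : Finset ℕ} {D : Finset ℕ → Bool} {V : Bool → ℕ}
    (d : S2 K K' v T D V) : K.fnum 0 + 1 ≤ K'.fnum 0 := by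
  rw [fnum_zero, fnum_zero]
  have T0 : T ≠ ∅ := by rintro rfl; simpa using d.hT
  have : (K.vertexSet \ {v}) ∪ {V true, V false} ⊆ K'.vertexSet := by
    intro x hx
    rw [mem_vertexSet]
    simp only [Finset.mem_union, Finset.mem_sdiff, Finset.mem_insert, Finset.mem_singleton, mem_vertexSet] at hx
    have hVi : ∀ i, {V i} ∈ K'.faces := by
      intro i
      have := d.m1 i ∅ (by simp) (by simp)
      simp only [insert_empty_eq] at this
      rw [this]
      exact ⟨by simp, Or.inl (d.side_T (by simp) T0.symm i)⟩
    rcases hx with ⟨h1, h2⟩ | rfl | rfl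
    · rw [d.m0 _ (d.vs h1 _) (d.vs h1 _)]
      exact Or.inl ⟨h1, by simpa using Ne.symm h2⟩
    · exact hVi _
    · exact hVi _
  have h1 := Finset.card_le_card this
  rw [Finset.card_union_of_disjoint, Finset.card_pair d.hV] at h1
  · have h2 := Finset.le_card_sdiff {v} K.vertexSet
    simp at h2
    omega
  · rw [Finset.disjoint_right]
    intro a ha
    simp only [Finset.mem_insert, Finset.mem_singleton] at ha
    simp only [Finset.mem_sdiff, mem_vertexSet, not_and]
    rcases ha with rfl | rfl
    · exact fun h => absurd h (d.fresh _)
    · exact fun h => absurd h (d.fresh _)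

theorem S2.f1 {K K' : SComplex} {v : ℕ} {T : Finset ℕ} {D : Finset ℕ → Bool} {V : Bool → ℕ}
    (d : S2 K K' v T D V) : K'.fnum 1 ≤ K.fnum 1 + 3 := by
  classical
  unfold fnum
  set E := K.faces.filter fun s => s.card = 1 + 1 with hE
  have hT := d.hT
  have hsub : (K'.faces.filter fun s => s.card = 1 + 1) ⊆
      E.image (fun e => if v ∉ e then e else
        insert (V (if Side K v D true (e.erase v) then true else false)) (e.erase v)) ∪
      T.image (fun x => ({V false, x} : Finset ℕ)) := by
    intro s hs
    rw [Finset.mem_filter] at hs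
    obtain ⟨hs, hc⟩ := hs
    rw [Finset.mem_union, Finset.mem_image, Finset.mem_image]
    by_cases h : ∀ i, V i ∉ s
    · left
      rw [d.m0 s (h _) (h _)] at hs
      rcases hs with ⟨h1, h2⟩ | rfl
      · refine ⟨s, by rw [hE, Finset.mem_filter]; exact ⟨h1, hc⟩, by simp [h2]⟩
      · omega
    · push Not at h
      obtain ⟨i, hi⟩ := h
      obtain ⟨s', hi', rfl⟩ : ∃ s', V i ∉ s' ∧ s = insert (V i) s' :=
        ⟨s.erase (V i), by simp, (Finset.insert_erase hi).symm⟩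
      rw [Finset.card_insert_of_notMem hi'] at hc
      obtain ⟨x, rfl⟩ := Finset.card_eq_one.mp (show s'.card = 1 by omega)
      have hx : ∀ j, V j ∉ ({x} : Finset ℕ) := by
        intro j hj
        by_cases hij : i = j
        · exact hi' (hij ▸ hj)
        · exact d.m2' hij hi (Finset.mem_insert_of_mem hj) hs
      rw [d.mi hx] at hs
      obtain ⟨hv, hs | hs⟩ := hs
      swap
      · rw [← hs] at hT; simp at hT
      have hvx : v ≠ x := by simpa using hv
      have e1 : ({v, x} : Finset ℕ).erase v = {x} := by
        rw [Finset.erase_insert hv]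
      have hE' : ({v, x} : Finset ℕ) ∈ E := by
        rw [hE, Finset.mem_filter]; exact ⟨hs.mem, Finset.card_pair hvx⟩
      cases i
      · by_cases hst : Side K v D true {x}
        · right
          have := (d.both hv (by simp) hst hs).1
          exact ⟨x, by simpa using this, rfl⟩
        · left
          refine ⟨_, hE', ?_⟩
          rw [e1]; simp [hst]
      · left
        refine ⟨_, hE', ?_⟩
        rw [e1]; simp [hs]
  have h1 := Finset.card_le_card hsub
  have h2 := Finset.card_union_le (E.image (fun e => if v ∉ e then e else
        insert (V (if Side K v D true (e.erase v) then true else false)) (e.erase v)))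
      (T.image (fun x => ({V false, x} : Finset ℕ)))
  have h3 := Finset.card_image_le (s := E) (f := fun e => if v ∉ e then e else
        insert (V (if Side K v D true (e.erase v) then true else false)) (e.erase v))
  have h4 := Finset.card_image_le (s := T) (f := fun x => ({V false, x} : Finset ℕ))
  omega

theorem no_split {K : SComplex} (hK : InClassR K) {v : ℕ} {T : Finset ℕ} {D : Finset ℕ → Bool}
    (d : SData K v T D) : False := by
  obtain ⟨M, K', V, d2, h1, h2⟩ := split_exists d
  have := hK.2.2.2.2 K' d2.np1.toNPM (Or.inr (Or.inr (Or.inl ⟨M, h1, h2⟩)))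
  have hf0 := d2.f0
  have hf1 := d2.f1
  unfold g2 at this
  omega

end SComplex

namespace SComplex

/-- `x y z w` are distinct and span a facet -/
def Q (K : SComplex) (x y z w : ℕ) : Prop :=
  x ≠ y ∧ x ≠ z ∧ x ≠ w ∧ y ≠ z ∧ y ≠ w ∧ z ≠ w ∧ {x, y, z, w} ∈ K.faces

variable {K : SComplex}

theorem Q.s12 {x y z w : ℕ} (h : K.Q x y z w) : K.Q y x z w := by
  obtain ⟨h1, h2, h3, h4, h5, h6, h7⟩ := h
  exact ⟨h1.symm, h4, h5, h2, h3, h6, by rw [Finset.insert_comm]; exact h7⟩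
theorem Q.s23 {x y z w : ℕ} (h : K.Q x y z w) : K.Q x z y w := by
  obtain ⟨h1, h2, h3, h4, h5, h6, h7⟩ := h
  exact ⟨h2, h1, h3, h4.symm, h6, h5, by rw [Finset.insert_comm z]; exact h7⟩
theorem Q.s34 {x y z w : ℕ} (h : K.Q x y z w) : K.Q x y w z := by
  obtain ⟨h1, h2, h3, h4, h5, h6, h7⟩ := h
  exact ⟨h1, h3, h2, h5, h4, h6.symm, by rw [Finset.pair_comm w]; exact h7⟩

theorem Q.L12 {x y z w : ℕ} (h : K.Q x y z w) : z ∈ K.L x y := by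
  rw [mem_L]
  exact ⟨h.1, h.2.1.symm, h.2.2.2.1.symm, mem_of_subset h.2.2.2.2.2.2 (by intro a; simp; tauto) (by simp)⟩

theorem N_symm {x y : ℕ} : y ∈ K.N x ↔ x ∈ K.N y := by
  rw [mem_N, mem_N, Finset.pair_comm, ne_comm]
theorem N_irr {x : ℕ} : x ∉ K.N x := by rw [mem_N]; simp
theorem L_comm (x y : ℕ) : K.L x y = K.L y x := by
  ext z
  rw [mem_L, mem_L, Finset.insert_comm, ne_comm]; tauto
theorem L_rot {x y z : ℕ} : z ∈ K.L x y ↔ y ∈ K.L x z := by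
  rw [mem_L, mem_L, Finset.pair_comm]; tauto
theorem L_rot' {x y z : ℕ} : z ∈ K.L x y ↔ x ∈ K.L y z := by
  rw [L_comm, L_rot, L_comm]
theorem L_sub_left {x y z : ℕ} (h : z ∈ K.L x y) : z ∈ K.N x := by
  rw [mem_L] at h
  exact mem_N.mpr ⟨h.2.1, mem_of_subset h.2.2.2 (by intro a; simp; tauto) (by simp)⟩
theorem L_sub_right {x y z : ℕ} (h : z ∈ K.L x y) : z ∈ K.N y := by
  rw [L_comm] at h; exact L_sub_left h
theorem L_N {x y z : ℕ} (h : z ∈ K.L x y) : y ∈ K.N x := L_sub_left (L_rot.mp h)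
theorem N_vert {x y : ℕ} (h : y ∈ K.N x) : y ∈ K.vertexSet :=
  face_subset_vertexSet (mem_N.mp h).2 (by simp)
theorem N_vert' {x y : ℕ} (h : y ∈ K.N x) : x ∈ K.vertexSet := N_vert (N_symm.mp h)
theorem not_L_self1 {x y : ℕ} : x ∉ K.L x y := by rw [mem_L]; tauto
theorem not_L_self2 {x y : ℕ} : y ∉ K.L x y := by rw [mem_L]; tauto

theorem ladj_Q {x y a b : ℕ} (hxy : x ≠ y) (hab : a ≠ b) : K.LAdj {x, y} a b ↔ K.Q x y a b := by
  unfold LAdj Q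
  simp only [Finset.mem_insert, Finset.mem_singleton, not_or]
  have : ({x, y, a, b} : Finset ℕ) = insert a (insert b {x, y}) := by ext; simp; tauto
  rw [this]
  constructor
  · rintro ⟨⟨h1, h2⟩, ⟨h3, h4⟩, h5⟩
    exact ⟨hxy, Ne.symm h1, Ne.symm h3, Ne.symm h2, Ne.symm h4, hab, h5⟩
  · rintro ⟨h1, h2, h3, h4, h5, h6, h7⟩
    exact ⟨⟨h2.symm, h4.symm⟩, ⟨h3.symm, h5.symm⟩, h7⟩

theorem NP.deg2 (h : K.NP) {x y a : ℕ} (ha : a ∈ K.L x y) : ∃ p q, p ≠ q ∧ ∀ r, K.Q x y a r ↔ r = p ∨ r = q := by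
  rw [mem_L] at ha
  obtain ⟨p, q, hpq, hr⟩ := h.two _ ha.2.2.2 (by
    rw [Finset.card_eq_three]; exact ⟨x, y, a, ha.1, ha.2.1.symm, ha.2.2.1.symm, rfl⟩)
  refine ⟨p, q, hpq, fun r => ?_⟩
  rw [← hr]
  unfold Q
  have : ({x, y, a, r} : Finset ℕ) = insert r {x, y, a} := by ext; simp; tauto
  rw [this]
  simp only [Finset.mem_insert, Finset.mem_singleton, not_or]
  constructor
  · rintro ⟨h1, h2, h3, h4, h5, h6, h7⟩
    exact ⟨⟨h3.symm, h5.symm, h6.symm⟩, h7⟩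
  · rintro ⟨⟨h1, h2, h3⟩, h4⟩
    exact ⟨ha.1, ha.2.1.symm, Ne.symm h1, ha.2.2.1.symm, Ne.symm h2, Ne.symm h3, h4⟩

theorem NP.ecycle (h : K.NP) {x y : ℕ} (P : ℕ → Prop) (p : ℕ) (hex : ∃ a ∈ K.L x y, P a) (hp : ¬ P p)
    (hcl : ∀ a b, P a → K.Q x y a b → P b ∨ b = p) : ∀ b ∈ K.L x y, P b ∨ b = p := by
  obtain ⟨a, ha, hPa⟩ := hex
  rw [mem_L] at ha
  have e : ∀ a, insert a {x, y} = ({x, y, a} : Finset ℕ) := by intro a; ext; simp; tauto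
  intro b hb
  rw [mem_L] at hb
  refine h.cycle (s := {x, y}) (Finset.card_pair ha.1) P p ⟨a, by simp [ha.2.1, ha.2.2.1], by rw [e]; exact ha.2.2.2, hPa⟩
    hp ?_ b (by simp [hb.2.1, hb.2.2.1]) (by rw [e]; exact hb.2.2.2)
  intro a b hPa hab hl
  exact hcl a b hPa ((ladj_Q ha.1 hab).mp hl)

theorem NP.vconn (h : K.NP) {x : ℕ} (P : ℕ → Prop) (hex : ∃ a ∈ K.N x, P a)
    (hcl : ∀ a b, P a → b ∈ K.L x a → P b) : ∀ b ∈ K.N x, P b := by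
  obtain ⟨a, ha, hPa⟩ := hex
  intro b hb
  rw [mem_N] at ha hb
  have e : ∀ a, insert a {x} = ({x, a} : Finset ℕ) := by intro a; ext; simp; tauto
  have path := h.conn {x} (by simp) a b (by simpa using ha.1) (by simpa using hb.1) (by rw [e]; exact ha.2)
    (by rw [e]; exact hb.2)
  clear hb
  induction path with
  | refl => exact hPa
  | tail hprev hyz IH =>
    rename_i c d
    by_cases hcd : c = d
    · exact hcd ▸ IH
    · refine hcl c d IH ?_
      obtain ⟨h1, h2, h3⟩ := hyz
      rw [mem_L]
      simp only [Finset.mem_singleton] at h1 h2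
      exact ⟨Ne.symm h1, h2, Ne.symm hcd, by
        have : ({x, c, d} : Finset ℕ) = insert c (insert d {x}) := by ext; simp; tauto
        rw [this]; exact h3⟩

theorem two_f1 (X : SComplex) : ∑ x ∈ X.vertexSet, (X.N x).card = 2 * X.fnum 1 := by
  have := Finset.sum_card_bipartiteAbove_eq_sum_card_bipartiteBelow (s := X.vertexSet)
    (t := X.faces.filter fun s => s.card = 1 + 1) (fun x e => x ∈ e)
  have e1 : ∀ x ∈ X.vertexSet, (Finset.bipartiteAbove (fun x e => x ∈ e) (X.faces.filter fun s => s.card = 1 + 1) x).card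
      = (X.N x).card := by
    intro x _
    symm
    refine Finset.card_bij (fun y _ => {x, y}) ?_ ?_ ?_
    · intro y hy
      rw [mem_N] at hy
      rw [Finset.mem_bipartiteAbove, Finset.mem_filter]
      exact ⟨⟨hy.2, Finset.card_pair hy.1.symm⟩, by simp⟩
    · intro y hy z hz h
      rw [mem_N] at hy
      have : y ∈ ({x, z} : Finset ℕ) := by rw [← h]; simp
      simpa [hy.1] using this
    · intro e he
      rw [Finset.mem_bipartiteAbove, Finset.mem_filter] at he
      obtain ⟨⟨h1, h2⟩, h3⟩ := he
      obtain ⟨y, hy, rfl⟩ := insert_of_card (Finset.singleton_subset_iff.mpr h3) (by simp) h2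
      have e : insert y {x} = ({x, y} : Finset ℕ) := by ext; simp; tauto
      refine ⟨y, mem_N.mpr ⟨by simpa using hy, by rw [← e]; exact h1⟩, e.symm⟩
  rw [Finset.sum_congr rfl e1] at this
  rw [this]
  have e2 : ∀ e ∈ X.faces.filter fun s => s.card = 1 + 1, (Finset.bipartiteBelow (fun x e => x ∈ e) X.vertexSet e).card = 2 := by
    intro e he
    rw [Finset.mem_filter] at he
    refine Eq.trans ?_ he.2
    congr 1
    ext x
    rw [Finset.mem_bipartiteBelow]
    exact ⟨fun h => h.2, fun h => ⟨face_subset_vertexSet he.1 h, h⟩⟩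
  rw [Finset.sum_congr rfl e2, Finset.sum_const, smul_eq_mul, mul_comm]; rfl

theorem mem_lk1 {x : ℕ} {γ : Finset ℕ} : γ ∈ (K.lk {x}).faces ↔ γ.Nonempty ∧ x ∉ γ ∧ insert x γ ∈ K.faces := by
  rw [mem_lk]
  have e1 : γ ∩ {x} = ∅ ↔ x ∉ γ := by
    rw [← Finset.disjoint_iff_inter_eq_empty, Finset.disjoint_singleton_right]
  have e3 : γ ∪ {x} = insert x γ := by ext; simp
  rw [e1, e3]
  constructor
  · rintro ⟨h1, h2, h3⟩; exact ⟨face_nonempty h1, h2, h3⟩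
  · rintro ⟨h1, h2, h3⟩; exact ⟨mem_of_subset h3 (Finset.subset_insert _ _) h1, h2, h3⟩

theorem lk_vert (x : ℕ) : (K.lk {x}).vertexSet = K.N x := by
  ext y
  rw [mem_vertexSet, mem_lk1, mem_N]
  simp [ne_comm]

theorem lk_N {x y : ℕ} (_hxy : y ≠ x) : (K.lk {x}).N y = K.L x y := by
  ext z
  rw [mem_N, mem_lk1, mem_L]
  simp only [Finset.mem_insert, Finset.mem_singleton, not_or]
  constructor
  · rintro ⟨h1, -, ⟨h2, h3⟩, h4⟩; exact ⟨h2, Ne.symm h3, h1, h4⟩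
  · rintro ⟨h2, h3, h1, h4⟩; exact ⟨h1, by simp, ⟨h2, Ne.symm h3⟩, h4⟩

theorem lk_three (h : K.NP) (x : ℕ) : 2 * (K.lk {x}).fnum 1 = 3 * (K.lk {x}).fnum 2 := by
  have := Finset.sum_card_bipartiteAbove_eq_sum_card_bipartiteBelow (s := (K.lk {x}).faces.filter fun s => s.card = 1 + 1)
    (t := (K.lk {x}).faces.filter fun s => s.card = 2 + 1) (fun e f => e ⊆ f)
  have e1 : ∀ e ∈ (K.lk {x}).faces.filter fun s => s.card = 1 + 1,
      (Finset.bipartiteAbove (fun e f => e ⊆ f) ((K.lk {x}).faces.filter fun s => s.card = 2 + 1) e).card = 2 := by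
    intro e he
    rw [Finset.mem_filter, mem_lk1] at he
    obtain ⟨⟨h1, h2, h3⟩, h4⟩ := he
    obtain ⟨p, q, hpq, hr⟩ := h.two (insert x e) h3 (by rw [Finset.card_insert_of_notMem h2, h4])
    have hp := (hr p).mpr (Or.inl rfl)
    have hq := (hr q).mpr (Or.inr rfl)
    simp only [Finset.mem_insert, not_or] at hp hq
    have : Finset.bipartiteAbove (fun e f => e ⊆ f) ((K.lk {x}).faces.filter fun s => s.card = 2 + 1) e
        = {insert p e, insert q e} := by
      ext f
      rw [Finset.mem_bipartiteAbove, Finset.mem_filter, mem_lk1, Finset.mem_insert, Finset.mem_singleton]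
      constructor
      · rintro ⟨⟨⟨h5, h6, h7⟩, h8⟩, h9⟩
        obtain ⟨r, hr1, rfl⟩ := insert_of_card h9 h4 h8
        simp only [Finset.mem_insert, not_or] at h6
        rcases (hr r).mp ⟨by simp [hr1, Ne.symm h6.1], by rw [Finset.insert_comm]; exact h7⟩ with rfl | rfl
        · exact Or.inl rfl
        · exact Or.inr rfl
      · rintro (rfl | rfl)
        · exact ⟨⟨⟨by simp, by simp [h2, Ne.symm hp.1.1], by rw [Finset.insert_comm]; exact hp.2⟩,
            by rw [Finset.card_insert_of_notMem hp.1.2, h4]⟩, Finset.subset_insert _ _⟩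
        · exact ⟨⟨⟨by simp, by simp [h2, Ne.symm hq.1.1], by rw [Finset.insert_comm]; exact hq.2⟩,
            by rw [Finset.card_insert_of_notMem hq.1.2, h4]⟩, Finset.subset_insert _ _⟩
    rw [this, Finset.card_pair]
    intro h'
    have : p ∈ insert q e := by rw [← h']; simp
    simp [hpq, hp.1.2] at this
  have e2 : ∀ f ∈ (K.lk {x}).faces.filter fun s => s.card = 2 + 1,
      (Finset.bipartiteBelow (fun e f => e ⊆ f) ((K.lk {x}).faces.filter fun s => s.card = 1 + 1) f).card = 3 := by
    intro f hf
    rw [Finset.mem_filter] at hf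
    have : Finset.bipartiteBelow (fun e f => e ⊆ f) ((K.lk {x}).faces.filter fun s => s.card = 1 + 1) f = f.powersetCard 2 := by
      ext e
      rw [Finset.mem_bipartiteBelow, Finset.mem_filter, Finset.mem_powersetCard]
      constructor
      · rintro ⟨⟨-, h1⟩, h2⟩; exact ⟨h2, h1⟩
      · rintro ⟨h2, h1⟩
        exact ⟨⟨mem_of_subset hf.1 h2 (by rw [← Finset.card_pos]; omega), h1⟩, h2⟩
    rw [this, Finset.card_powersetCard, hf.2]; rfl
  rw [Finset.sum_congr rfl e1, Finset.sum_congr rfl e2, Finset.sum_const, Finset.sum_const] at this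
  simp only [smul_eq_mul] at this
  unfold fnum
  omega

theorem B6 (h : K.NP) (x : ℕ) : (∑ y ∈ K.N x, (K.L x y).card : ℤ) = 6 * ((K.N x).card - (K.lk {x}).euler) := by
  have h1 := two_f1 (K.lk {x})
  rw [lk_vert] at h1
  have h2 : ∑ y ∈ K.N x, ((K.lk {x}).N y).card = ∑ y ∈ K.N x, (K.L x y).card :=
    Finset.sum_congr rfl fun y hy => by rw [lk_N (mem_N.mp hy).1]
  rw [h2] at h1
  have h3 := lk_three h x
  have h4 := fnum_zero (K.lk {x})
  rw [lk_vert] at h4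
  rw [← Nat.cast_sum, h1]
  unfold euler
  rw [h4]
  push_cast
  omega

end SComplex

namespace SComplex
variable {K : SComplex}

theorem four_mem (hK : InClassR K) {x y a b : ℕ} (h1 : a ∈ K.L x y) (h2 : b ∈ K.L x y) (h3 : b ∈ K.L x a)
    (h4 : b ∈ K.L y a) : K.Q x y a b := by
  rw [mem_L] at h1 h2 h3 h4
  refine ⟨h1.1, h3.1, h2.2.1.symm, h4.1, h2.2.2.1.symm, h3.2.2.1.symm, ?_⟩
  refine hK.2.2.2.1 _ ?_ ?_
  · rw [Finset.card_insert_of_notMem, Finset.card_insert_of_notMem, Finset.card_pair h3.2.2.1.symm]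
    · simp [h4.1, h2.2.2.1.symm]
    · simp [h1.1, h3.1, h2.2.1.symm]
  · intro s hs
    simp only [properFaces, Finset.mem_filter, Finset.mem_powerset] at hs
    obtain ⟨hs1, hs2, hs3⟩ := hs
    have hne := Finset.nonempty_iff_ne_empty.mpr hs2
    have key : ∀ z ∈ ({x, y, a, b} : Finset ℕ), z ∉ s → s ⊆ ({x, y, a, b} : Finset ℕ).erase z := fun z _ hz =>
      Finset.subset_erase.mpr ⟨hs1, hz⟩
    obtain ⟨z, hz, hzs⟩ : ∃ z ∈ ({x, y, a, b} : Finset ℕ), z ∉ s := by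
      by_contra hcon
      push Not at hcon
      exact hs3 (le_antisymm hs1 hcon)
    have hk := key z hz hzs
    simp only [Finset.mem_insert, Finset.mem_singleton] at hz
    rcases hz with rfl | rfl | rfl | rfl
    · refine mem_of_subset h4.2.2.2 (hk.trans ?_) hne
      intro w; simp <;> tauto
    · refine mem_of_subset h3.2.2.2 (hk.trans ?_) hne
      intro w; simp <;> tauto
    · refine mem_of_subset h2.2.2.2 (hk.trans ?_) hne
      intro w; simp <;> tauto
    · refine mem_of_subset h1.2.2.2 (hk.trans ?_) hne
      intro w; simp <;> tauto

theorem L_card_le {x y : ℕ} (_hy : y ∈ K.N x) : (K.L x y).card + 1 ≤ (K.N x).card := by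
  have : insert y (K.L x y) ⊆ K.N x := by
    intro z hz
    rcases Finset.mem_insert.mp hz with rfl | hz
    · exact _hy
    · exact L_sub_left hz
  have h := Finset.card_le_card this
  rwa [Finset.card_insert_of_notMem not_L_self2] at h

theorem L_nonempty (h : K.NP) {x y : ℕ} (hy : y ∈ K.N x) : (K.L x y).Nonempty := by
  rw [mem_N] at hy
  obtain ⟨F, hF, h1, h2⟩ := h.pure _ hy.2
  obtain ⟨a, ha, hs⟩ := Finset.exists_mem_notMem_of_card_lt_card (s := {x, y}) (t := F)
    (by rw [Finset.card_pair hy.1.symm]; omega)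
  simp only [Finset.mem_insert, Finset.mem_singleton, not_or] at hs
  refine ⟨a, mem_L.mpr ⟨hy.1.symm, hs.1, hs.2, mem_of_subset hF ?_ (by simp)⟩⟩
  intro z hz
  simp only [Finset.mem_insert, Finset.mem_singleton] at hz
  rcases hz with rfl | rfl | rfl
  · exact h1 (by simp)
  · exact h1 (by simp)
  · exact ha

theorem N_nonempty (h : K.NP) {x : ℕ} (hx : {x} ∈ K.faces) : (K.N x).Nonempty := by
  obtain ⟨F, hF, h1, h2⟩ := h.pure _ hx
  obtain ⟨a, ha, hs⟩ := Finset.exists_mem_notMem_of_card_lt_card (s := {x}) (t := F) (by simp; omega)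
  simp only [Finset.mem_singleton] at hs
  refine ⟨a, mem_N.mpr ⟨hs, mem_of_subset hF ?_ (by simp)⟩⟩
  intro z hz
  simp only [Finset.mem_insert, Finset.mem_singleton] at hz
  rcases hz with rfl | rfl
  · exact h1 (by simp)
  · exact ha

theorem deg_t (h : K.NP) {t : ℕ} (ht : {t} ∈ K.faces) (hχ : (K.lk {t}).euler ≤ 1) : 6 ≤ (K.N t).card := by
  have h1 := B6 h t
  obtain ⟨y, hy⟩ := N_nonempty h ht
  obtain ⟨z, hz⟩ := L_nonempty h hy
  have h2 : 2 ≤ (K.N t).card := by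
    have := L_card_le hy
    have := Finset.card_pos.mpr ⟨z, hz⟩
    omega
  have h3 : (∑ y ∈ K.N t, (K.L t y).card : ℤ) ≤ ∑ y ∈ K.N t, (((K.N t).card : ℤ) - 1) := by
    refine Finset.sum_le_sum fun y hy => ?_
    have := L_card_le hy
    omega
  rw [Finset.sum_const, nsmul_eq_mul, h1] at h3
  by_contra hcon
  have : ((K.N t).card : ℤ) ≤ 5 := by omega
  have h4 : (2 : ℤ) ≤ (K.N t).card := by exact_mod_cast h2
  nlinarith

theorem B1 (hK : InClassR K) {t : ℕ} (ht : {t} ∈ K.faces) (hχ : (K.lk {t}).euler ≤ 1) {x y : ℕ} (hy : y ∈ K.N x) :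
    4 ≤ (K.L x y).card := by
  classical
  have np := NP.ofNPM hK.1
  obtain ⟨a, ha⟩ := L_nonempty np hy
  obtain ⟨p, q, hpq, hr⟩ := np.deg2 ha
  have hp := (hr p).mpr (Or.inl rfl)
  have hq := (hr q).mpr (Or.inr rfl)
  have hpL := hp.s34.L12
  have hqL := hq.s34.L12
  have hap : a ≠ p := hp.2.2.2.2.2.1
  have haq : a ≠ q := hq.2.2.2.2.2.1
  have hxy : x ≠ y := hp.1
  have hsub : ({a, p, q} : Finset ℕ) ⊆ K.L x y := by
    intro z hz
    simp only [Finset.mem_insert, Finset.mem_singleton] at hz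
    rcases hz with rfl | rfl | rfl <;> assumption
  have hc3 : ({a, p, q} : Finset ℕ).card = 3 := Finset.card_eq_three.mpr ⟨a, p, q, hap, haq, hpq, rfl⟩
  by_contra hlt
  have hL : K.L x y = {a, p, q} := (Finset.eq_of_subset_of_card_le hsub (by omega)).symm
  have hpq' : K.Q x y p q := by
    obtain ⟨b, c, hbc, hr'⟩ := np.deg2 hpL
    have hb := (hr' b).mpr (Or.inl rfl)
    have hc := (hr' c).mpr (Or.inr rfl)
    have e1 := hb.s34.L12
    have e2 := hc.s34.L12
    rw [hL] at e1 e2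
    simp only [Finset.mem_insert, Finset.mem_singleton] at e1 e2
    have n1 := hb.2.2.2.2.2.1
    have n2 := hc.2.2.2.2.2.1
    have : b = q ∨ c = q := by omega
    rcases this with rfl | rfl
    · exact hb
    · exact hc
  have hQ : ∀ u ∈ K.L x y, ∀ w ∈ K.L x y, u ≠ w → K.Q x y u w := by
    intro u hu w hw huw
    rw [hL] at hu hw
    simp only [Finset.mem_insert, Finset.mem_singleton] at hu hw
    rcases hu with rfl | rfl | rfl <;> rcases hw with rfl | rfl | rfl
    · exact absurd rfl huw
    · exact hp
    · exact hq
    · exact hp.s34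
    · exact absurd rfl huw
    · exact hpq'
    · exact hq.s34
    · exact hpq'.s34
    · exact absurd rfl huw
  have hxa : x ∉ K.L x y := not_L_self1
  have hya : y ∉ K.L x y := not_L_self2
  by_cases hT : K.L x y ∈ K.faces
  · -- five vertices only
    set W := insert x (insert y (K.L x y)) with hW
    have hWc : W.card = 5 := by
      rw [hW, Finset.card_insert_of_notMem (by simp [hxy, hxa]), Finset.card_insert_of_notMem hya, hL, hc3]
    have hqap : q ∈ K.L a p := by
      rw [hL] at hT
      exact mem_L.mpr ⟨hap, haq.symm, hpq.symm, hT⟩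
    have hxT : insert x (K.L x y) ∈ K.faces := by
      have : K.Q x a p q := four_mem hK hp.s23.s34.L12 hq.s23.s34.L12 hpq'.s23.s34.L12 hqap
      rw [hL]; exact this.2.2.2.2.2.2
    have hyT : insert y (K.L x y) ∈ K.faces := by
      have : K.Q y a p q := four_mem hK hp.s12.s23.s34.L12 hq.s12.s23.s34.L12 hpq'.s12.s23.s34.L12 hqap
      rw [hL]; exact this.2.2.2.2.2.2
    have hall : ∀ z ∈ W, W.erase z ∈ K.faces := by
      intro z hz
      rw [hW, Finset.mem_insert, Finset.mem_insert, hL] at hz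
      simp only [Finset.mem_insert, Finset.mem_singleton] at hz
      have hxpq := hpq'.2.2.2.2.2.2
      have hxaq := hq.2.2.2.2.2.2
      have hxap := hp.2.2.2.2.2.2
      have hne : ∀ z, (W.erase z).Nonempty := by
        intro z; rw [← Finset.card_pos]
        have := Finset.pred_card_le_card_erase (s := W) (a := z)
        omega
      rcases hz with rfl | rfl | rfl | rfl | rfl
      · refine mem_of_subset hyT ?_ (hne _); rw [hW]; intro w; simp <;> tauto
      · refine mem_of_subset hxT ?_ (hne _); rw [hW]; intro w; simp <;> tauto
      · refine mem_of_subset hxpq ?_ (hne _); rw [hW, hL]; intro w; simp <;> tauto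
      · refine mem_of_subset hxaq ?_ (hne _); rw [hW, hL]; intro w; simp <;> tauto
      · refine mem_of_subset hxap ?_ (hne _); rw [hW, hL]; intro w; simp <;> tauto
    have hF0 : K.IsFacet (W.erase x) := np.facet_iff.mpr ⟨hall x (by simp [hW]), by
      rw [Finset.card_erase_of_mem (by simp [hW]), hWc]⟩
    have hFW : ∀ F, K.IsFacet F → F ⊆ W := by
      intro F hF
      have path := hK.1.2.1 _ F hF0 hF
      clear hF
      induction path with
      | refl => exact Finset.erase_subset _ _
      | tail hprev hyz IH =>
        rename_i F G
        obtain ⟨h1, h2, h3⟩ := hyz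
        rw [np.facet_iff] at h1 h2
        have hr3 : (F ∩ G).card = 3 := by omega
        have hrK : F ∩ G ∈ K.faces := mem_of_subset h1.1 Finset.inter_subset_left (by rw [← Finset.card_pos]; omega)
        obtain ⟨p', q', hpq2, hr2⟩ := np.two _ hrK hr3
        have hrW : F ∩ G ⊆ W := Finset.inter_subset_left.trans IH
        have hcd : (W \ (F ∩ G)).card = 2 := by rw [Finset.card_sdiff_of_subset hrW]; omega
        obtain ⟨c, d, hcd', hcde⟩ := Finset.card_eq_two.mp hcd
        have hcm : c ∈ W \ (F ∩ G) := by rw [hcde]; simp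
        have hdm : d ∈ W \ (F ∩ G) := by rw [hcde]; simp
        have hin : ∀ c d, c ≠ d → W \ (F ∩ G) = {c, d} → c ∉ F ∩ G ∧ insert c (F ∩ G) ∈ K.faces := by
          intro c d hcd hcde
          have hcm : c ∈ W \ (F ∩ G) := by rw [hcde]; simp
          have hdm : d ∈ W \ (F ∩ G) := by rw [hcde]; simp
          rw [Finset.mem_sdiff] at hcm hdm
          refine ⟨hcm.2, mem_of_subset (hall d hdm.1) ?_ (by simp)⟩
          intro z hz
          rcases Finset.mem_insert.mp hz with rfl | hz
          · exact Finset.mem_erase.mpr ⟨hcd, hcm.1⟩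
          · exact Finset.mem_erase.mpr ⟨by rintro rfl; exact hdm.2 hz, hrW hz⟩
        have h4 := (hr2 c).mp (hin c d hcd' hcde)
        have h5 := (hr2 d).mp (hin d c hcd'.symm (by rw [hcde, Finset.pair_comm]))
        obtain ⟨g, hg, hG⟩ := insert_of_card (Finset.inter_subset_right (s₁ := F) (s₂ := G)) hr3 h2.2
        have h6 := (hr2 g).mp ⟨hg, hG ▸ h2.1⟩
        have h7 : g = c ∨ g = d := by omega
        rw [Finset.mem_sdiff] at hcm hdm
        have hgW : g ∈ W := by
          rcases h7 with rfl | rfl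
          · exact hcm.1
          · exact hdm.1
        rw [hG]
        exact Finset.insert_subset hgW hrW
    have hvW : K.vertexSet ⊆ W := by
      intro z hz
      rw [mem_vertexSet] at hz
      obtain ⟨F, hF, hzF⟩ := exists_facet hz
      exact hFW F hF (hzF (by simp))
    have h1 := deg_t np ht hχ
    have h2 : K.N t ⊆ W := fun z hz => hvW (N_vert hz)
    have := Finset.card_le_card h2
    omega
  · refine no_split hK (v := x) (T := K.L x y) (D := fun F => decide (y ∈ F)) ⟨np, by rw [hL, hc3], hxa, hT, ?_, ?_⟩
    · intro e he he2 i
      have hye : y ∉ e := fun h => hya (he h)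
      have hxe : x ∉ e := fun h => hxa (he h)
      have hyK : insert y (insert x e) ∈ K.faces := by
        obtain ⟨u, w, huw, rfl⟩ := Finset.card_eq_two.mp he2
        rw [Finset.insert_comm]
        exact (hQ u (he (by simp)) w (he (by simp)) huw).2.2.2.2.2.2
      have hyxe : y ∉ insert x e := by simp [hye, hxy.symm]
      cases i
      · obtain ⟨p, q, hpq, hr⟩ := np.two (insert x e) (mem_of_subset hyK (Finset.subset_insert _ _) (by simp))
          (by rw [Finset.card_insert_of_notMem hxe, he2])
        have hy1 := (hr y).mp ⟨hyxe, hyK⟩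
        obtain ⟨r, hry, hrr⟩ : ∃ r, r ≠ y ∧ (r = p ∨ r = q) := by
          rcases hy1 with rfl | rfl
          · exact ⟨q, hpq.symm, Or.inr rfl⟩
          · exact ⟨p, hpq, Or.inl rfl⟩
        have := (hr r).mpr hrr
        refine ⟨r, this.1, this.2, ?_⟩
        simp [hye, hxy.symm, hry.symm]
      · exact ⟨y, hyxe, hyK, by simp⟩
    · intro e he2 hxe heT p q hp hq hpK hqK
      by_cases hye : y ∈ e
      · simp [hye]
      · have key : ∀ p, p ∉ insert x e → insert p (insert x e) ∈ K.faces → y ≠ p := by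
          rintro p hp hpK rfl
          apply heT
          intro z hz
          refine mem_L.mpr ⟨hxy, ?_, ?_, mem_of_subset hpK ?_ (by simp)⟩
          · rintro rfl; exact hxe hz
          · rintro rfl; exact hye hz
          · intro w hw
            simp only [Finset.mem_insert, Finset.mem_singleton] at hw
            rcases hw with rfl | rfl | rfl <;> simp [*]
        simp [hye, hxy.symm, key p hp hpK, key q hq hqK]

theorem B2 (hK : InClassR K) {t : ℕ} (ht : {t} ∈ K.faces) (hχ : (K.lk {t}).euler ≤ 1) {x y : ℕ} (hy : y ∈ K.N x) :
    ∃ z, z ∈ K.N x ∧ z ∈ K.N y ∧ z ∉ K.L x y := by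
  by_contra hcon
  push Not at hcon
  have np := NP.ofNPM hK.1
  have hxy := (mem_N.mp hy).1.symm
  have hB := B1 hK ht hχ hy
  have := no_contr hK hxy (mem_N.mp hy).2 ?_
  · omega
  intro s hs hxs hys h1 h2
  have hsL : ∀ z ∈ s, z ∈ K.L x y := by
    intro z hz
    refine hcon z (mem_N.mpr ⟨by rintro rfl; exact hxs hz, mem_of_subset h1 ?_ (by simp)⟩)
      (mem_N.mpr ⟨by rintro rfl; exact hys hz, mem_of_subset h2 ?_ (by simp)⟩)
    · intro w hw
      simp only [Finset.mem_insert, Finset.mem_singleton] at hw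
      rcases hw with rfl | rfl <;> simp [*]
    · intro w hw
      simp only [Finset.mem_insert, Finset.mem_singleton] at hw
      rcases hw with rfl | rfl <;> simp [*]
  have hQ : ∀ a ∈ s, ∀ b ∈ s, a ≠ b → K.Q x y a b := by
    intro a ha b hb hab
    have sub : ∀ x, ({x, a, b} : Finset ℕ) ⊆ insert x s := by
      intro x w hw
      simp only [Finset.mem_insert, Finset.mem_singleton] at hw
      rcases hw with rfl | rfl | rfl <;> simp [*]
    refine four_mem hK (hsL a ha) (hsL b hb) ?_ ?_
    · exact mem_L.mpr ⟨by rintro rfl; exact hxs ha, by rintro rfl; exact hxs hb, hab.symm, mem_of_subset h1 (sub x) (by simp)⟩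
    · exact mem_L.mpr ⟨by rintro rfl; exact hys ha, by rintro rfl; exact hys hb, hab.symm, mem_of_subset h2 (sub y) (by simp)⟩
  have hle := np.le4 _ h1
  rw [Finset.card_insert_of_notMem hxs] at hle
  have hpos := Finset.card_pos.mpr hs
  have hc : s.card = 1 ∨ s.card = 2 ∨ s.card = 3 := by omega
  rcases hc with hc | hc | hc
  · obtain ⟨z, rfl⟩ := Finset.card_eq_one.mp hc
    exact (mem_L.mp (hsL z (by simp))).2.2.2
  · obtain ⟨a, b, hab, rfl⟩ := Finset.card_eq_two.mp hc
    exact (hQ a (by simp) b (by simp) hab).2.2.2.2.2.2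
  · exfalso
    have h3 := np.ecycle (x := x) (y := y) (fun z => z ∈ s) x ⟨hs.choose, hsL _ hs.choose_spec, hs.choose_spec⟩ hxs ?_
    · have : K.L x y ⊆ s := by
        intro z hz
        exact (h3 z hz).resolve_right fun h => by subst h; exact not_L_self1 hz
      have := Finset.card_le_card this
      omega
    · intro a b ha hab
      left
      have h4 : (s.erase a).card = 2 := by rw [Finset.card_erase_of_mem ha, hc]
      obtain ⟨u, w, huw, he⟩ := Finset.card_eq_two.mp h4
      have hu : u ∈ s.erase a := by rw [he]; simp
      have hw : w ∈ s.erase a := by rw [he]; simp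
      rw [Finset.mem_erase] at hu hw
      obtain ⟨p, q, hpq, hr⟩ := np.deg2 (hsL a ha)
      have h5 := (hr u).mp (hQ a ha u hu.2 hu.1.symm)
      have h6 := (hr w).mp (hQ a ha w hw.2 hw.1.symm)
      have h7 := (hr b).mp hab
      have : b = u ∨ b = w := by omega
      rcases this with rfl | rfl
      · exact hu.2
      · exact hw.2

end SComplex

namespace SComplex

theorem contract_loop {Y : Type*} [TopologicalSpace Y]
    (h : Y ≃ₜ ↥(Metric.sphere (0 : EuclideanSpace ℝ (Fin 3)) 1)) (p : Y) (γ : ℝ → Y) (hγ : Continuous γ)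
    (hp : ∀ s, γ s ≠ p) : ∃ H : ℝ × ℝ → Y, Continuous H ∧ (∀ s, H (s, 0) = γ s) ∧ (∀ s, H (s, 1) = γ 0) ∧
      ∀ s, γ s = γ 0 → ∀ τ, H (s, τ) = γ 0 := by
  have hv : ‖((h p : ↥(Metric.sphere (0 : EuclideanSpace ℝ (Fin 3)) 1)) : EuclideanSpace ℝ (Fin 3))‖ = 1 := by
    have := (h p).2
    rwa [mem_sphere_zero_iff_norm] at this
  let st := stereographic hv
  have hsrc : ∀ s, h (γ s) ∈ st.source := by
    intro s
    rw [stereographic_source]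
    intro hh
    exact hp s (h.injective (by rw [Set.mem_singleton_iff] at hh; exact hh))
  have hf : Continuous fun s => st (h (γ s)) :=
    st.continuousOn.comp_continuous (h.continuous.comp hγ) hsrc
  have hsymm : Continuous st.symm := by
    rw [← continuousOn_univ]
    have := st.continuousOn_symm
    rwa [stereographic_target] at this
  refine ⟨fun q => h.symm (st.symm ((1 - q.2) • st (h (γ q.1)) + q.2 • st (h (γ 0)))), ?_, ?_, ?_, ?_⟩
  · refine h.symm.continuous.comp (hsymm.comp ?_)
    have h1 : Continuous fun q : ℝ × ℝ => st (h (γ q.1)) := hf.comp continuous_fst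
    exact ((continuous_const.sub continuous_snd).smul h1).add (continuous_snd.smul continuous_const)
  · intro s
    simp [st.left_inv (hsrc s)]
  · intro s
    simp [st.left_inv (hsrc 0)]
  · intro s hs τ
    simp only [hs]
    rw [← add_smul]
    simp [st.left_inv (hsrc 0)]

theorem tel {φ : ℕ → ℕ → ZMod 2} (c : ℕ → ℕ) (k : ℕ) (h0 : φ (c 0) (c 0) = 0)
    (h : ∀ i < k, φ (c 0) (c i) + φ (c i) (c (i + 1)) = φ (c 0) (c (i + 1))) :
    ∑ i ∈ Finset.range k, φ (c i) (c (i + 1)) = φ (c 0) (c k) := by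
  induction k with
  | zero => simp [h0]
  | succ k ih =>
    rw [Finset.sum_range_succ, ih (fun i hi => h i (by omega)), h k (by omega)]

theorem row {φ : ℕ → ℕ → ZMod 2} (c d : ℕ → ℕ) (k : ℕ)
    (h1 : ∀ i < k, φ (c i) (c (i + 1)) + φ (c (i + 1)) (d (i + 1)) = φ (c i) (d (i + 1)))
    (h2 : ∀ i < k, φ (c i) (d i) + φ (d i) (d (i + 1)) = φ (c i) (d (i + 1))) :
    ∑ i ∈ Finset.range k, φ (c i) (c (i + 1)) + φ (c k) (d k) =
      φ (c 0) (d 0) + ∑ i ∈ Finset.range k, φ (d i) (d (i + 1)) := by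
  induction k with
  | zero => simp
  | succ k ih =>
    rw [Finset.sum_range_succ, Finset.sum_range_succ]
    have e := ih (fun i hi => h1 i (by omega)) (fun i hi => h2 i (by omega))
    have e1 := h1 k (by omega)
    have e2 := h2 k (by omega)
    rw [add_assoc, e1, ← e2, ← add_assoc, e]; abel

/-- the grid argument -/
theorem grid (X : SComplex) {φ : ℕ → ℕ → ZMod 2}
    (hφ : ∀ a b c, {a, b, c} ∈ X.faces → φ a b + φ b c = φ a c) {a b c : ℕ}
    (H : ℝ × ℝ → X.realSpace) (hH : Continuous H)
    (hab : ∀ s, 0 ≤ s → s ≤ 1 → ∀ x, (H (s, 0)).1 x ≠ 0 → x = a ∨ x = b)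
    (hbc : ∀ s, 1 ≤ s → s ≤ 2 → ∀ x, (H (s, 0)).1 x ≠ 0 → x = b ∨ x = c)
    (hca : ∀ s, 2 ≤ s → s ≤ 3 → ∀ x, (H (s, 0)).1 x ≠ 0 → x = c ∨ x = a)
    (hb : ∀ x, (H (1, 0)).1 x ≠ 0 → x = b) (hc : ∀ x, (H (2, 0)).1 x ≠ 0 → x = c)
    (h0 : ∀ τ x, (H (0, τ)).1 x ≠ 0 → x = a) (h3 : ∀ τ x, (H (3, τ)).1 x ≠ 0 → x = a)
    (h1 : ∀ s x, (H (s, 1)).1 x ≠ 0 → x = a)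
    (Ea : {a, b} ∈ X.faces) (Eb : {b, c} ∈ X.faces) (Ec : {c, a} ∈ X.faces) :
    φ a b + φ b c + φ c a = 0 := by
  have hpos : ∀ q, ∃ x, (H q).1 x ≠ 0 := by
    intro q
    obtain ⟨h1, s, hs, h2, h3⟩ := (H q).2
    by_contra hcon
    push Not at hcon
    rw [Finset.sum_eq_zero (fun x _ => hcon x)] at h3
    exact zero_ne_one h3
  have hface : ∀ q x y z, (H q).1 x ≠ 0 → (H q).1 y ≠ 0 → (H q).1 z ≠ 0 → {x, y, z} ∈ X.faces := by
    intro q x y z hx hy hz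
    obtain ⟨h1, s, hs, h2, h3⟩ := (H q).2
    refine mem_of_subset hs ?_ (by simp)
    intro w hw
    simp only [Finset.mem_insert, Finset.mem_singleton] at hw
    rcases hw with rfl | rfl | rfl
    · exact h2 _ hx
    · exact h2 _ hy
    · exact h2 _ hz
  have hopen : ∀ x, IsOpen {q | (H q).1 x ≠ 0} := by
    intro x
    have : Continuous fun q => (H q).1 x := (continuous_apply x).comp (continuous_subtype_val.comp hH)
    exact isOpen_ne_fun this continuous_const
  obtain ⟨δ, hδ, hL⟩ := lebesgue_number_lemma_of_metric (s := Set.Icc (0 : ℝ) 3 ×ˢ Set.Icc (0 : ℝ) 1)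
    (isCompact_Icc.prod isCompact_Icc) (c := fun x : ℕ => {q | (H q).1 x ≠ 0}) hopen (by
      intro q _
      obtain ⟨x, hx⟩ := hpos q
      exact Set.mem_iUnion.mpr ⟨x, hx⟩)
  obtain ⟨n, hn⟩ := exists_nat_one_div_lt hδ
  set m := n + 1 with hm
  have hm0 : (0 : ℝ) < m := by positivity
  let Z : ℕ → ℕ → ℝ × ℝ := fun i j => ((i : ℝ) / m, (j : ℝ) / m)
  have hZ : ∀ i j, i ≤ 3 * m → j ≤ m → Z i j ∈ Set.Icc (0 : ℝ) 3 ×ˢ Set.Icc (0 : ℝ) 1 := by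
    intro i j hi hj
    have hi' : (i : ℝ) ≤ 3 * m := by exact_mod_cast hi
    have hj' : (j : ℝ) ≤ m := by exact_mod_cast hj
    refine ⟨⟨by positivity, ?_⟩, ⟨by positivity, ?_⟩⟩
    · show (i : ℝ) / m ≤ 3
      rw [div_le_iff₀ hm0]; exact hi'
    · show (j : ℝ) / m ≤ 1
      rw [div_le_iff₀ hm0]; linarith
  have hex : ∀ i j, ∃ x, i ≤ 3 * m → j ≤ m → Metric.ball (Z i j) δ ⊆ {q | (H q).1 x ≠ 0} := by
    intro i j
    by_cases h : i ≤ 3 * m ∧ j ≤ m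
    · obtain ⟨x, hx⟩ := hL (Z i j) (hZ i j h.1 h.2)
      exact ⟨x, fun _ _ => hx⟩
    · exact ⟨0, fun h1 h2 => absurd ⟨h1, h2⟩ h⟩
  choose C hC using hex
  have hdist : ∀ i j i' j', (i' = i ∨ i' = i + 1) → (j' = j ∨ j' = j + 1) → Z i j ∈ Metric.ball (Z i' j') δ := by
    intro i j i' j' hi hj
    have key : ∀ i i' : ℕ, (i' = i ∨ i' = i + 1) → |(i : ℝ) / m - (i' : ℝ) / m| < δ := by
      rintro i i' (rfl | rfl)
      · simpa using hδ
      · have : (i : ℝ) / m - ((i + 1 : ℕ) : ℝ) / m = - (1 / (m : ℝ)) := by push_cast; ring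
        rw [this, abs_neg, abs_of_pos (by positivity), hm]
        push_cast; exact hn
    rw [Metric.mem_ball, Prod.dist_eq, Real.dist_eq, Real.dist_eq]
    exact max_lt (key i i' hi) (key j j' hj)
  have hCn : ∀ i j i' j', (i' = i ∨ i' = i + 1) → (j' = j ∨ j' = j + 1) → i' ≤ 3 * m → j' ≤ m →
      (H (Z i j)).1 (C i' j') ≠ 0 := fun i j i' j' h1 h2 h3 h4 => hC i' j' h3 h4 (hdist i j i' j' h1 h2)
  have hself : ∀ i j, i ≤ 3 * m → j ≤ m → (H (Z i j)).1 (C i j) ≠ 0 := fun i j h1 h2 =>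
    hCn i j i j (Or.inl rfl) (Or.inl rfl) h1 h2
  have φaa : ∀ x, {x} ∈ X.faces → φ x x = 0 := by
    intro x hx
    have := hφ x x x (by simpa using hx)
    simpa using this
  have ha0 : φ a a = 0 := φaa a (mem_of_subset Ea (by simp) (by simp))
  have hC0 : ∀ j, j ≤ m → C 0 j = a := by
    intro j hj
    have := hself 0 j (by omega) hj
    have e : Z 0 j = (0, (j : ℝ) / m) := by simp [Z]
    rw [e] at this
    exact h0 _ _ this
  have hC3 : ∀ j, j ≤ m → C (3 * m) j = a := by
    intro j hj
    have := hself (3 * m) j (by omega) hj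
    have e : Z (3 * m) j = (3, (j : ℝ) / m) := by
      simp only [Z]; push_cast; rw [mul_div_assoc, div_self hm0.ne', mul_one]
    rw [e] at this
    exact h3 _ _ this
  have hrow : ∀ j, j ≤ m → ∑ i ∈ Finset.range (3 * m), φ (C i 0) (C (i + 1) 0) =
      ∑ i ∈ Finset.range (3 * m), φ (C i j) (C (i + 1) j) := by
    intro j
    induction j with
    | zero => intro _; rfl
    | succ j ih =>
      intro hj
      rw [ih (by omega)]
      have := row (φ := φ) (fun i => C i j) (fun i => C i (j + 1)) (3 * m) ?_ ?_
      · rwa [hC0 j (by omega), hC0 (j + 1) hj, hC3 j (by omega), hC3 (j + 1) hj, ha0, add_zero, zero_add] at this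
      · intro i hi
        refine hφ _ _ _ (hface (Z i j) _ _ _ ?_ ?_ ?_)
        · exact hCn _ _ _ _ (by simp) (by simp) (by omega) (by omega)
        · exact hCn _ _ _ _ (by simp) (by simp) (by omega) (by omega)
        · exact hCn _ _ _ _ (by simp) (by simp) (by omega) (by omega)
      · intro i hi
        refine hφ _ _ _ (hface (Z i j) _ _ _ ?_ ?_ ?_)
        · exact hCn _ _ _ _ (by simp) (by simp) (by omega) (by omega)
        · exact hCn _ _ _ _ (by simp) (by simp) (by omega) (by omega)
        · exact hCn _ _ _ _ (by simp) (by simp) (by omega) (by omega)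
  have htop : ∑ i ∈ Finset.range (3 * m), φ (C i m) (C (i + 1) m) = 0 := by
    have hCm : ∀ i, i ≤ 3 * m → C i m = a := by
      intro i hi
      have := hself i m hi le_rfl
      have e : Z i m = ((i : ℝ) / m, 1) := by simp only [Z]; rw [div_self hm0.ne']
      rw [e] at this
      exact h1 _ _ this
    refine Finset.sum_eq_zero fun i hi => ?_
    rw [Finset.mem_range] at hi
    rw [hCm i (by omega), hCm (i + 1) (by omega), ha0]
  have hR := hrow m le_rfl
  rw [htop] at hR
  have seg : ∀ k : ℕ, k ≤ 2 → ∀ x y, {x, y} ∈ X.faces → C (k * m) 0 = x → C (k * m + m) 0 = y →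
      (∀ s : ℝ, (k : ℝ) ≤ s → s ≤ k + 1 → ∀ z, (H (s, 0)).1 z ≠ 0 → z = x ∨ z = y) →
      ∑ i ∈ Finset.range m, φ (C (k * m + i) 0) (C (k * m + (i + 1)) 0) = φ x y := by
    intro k hk x y hxy hx hy hs
    have hxx : φ x x = 0 := φaa x (mem_of_subset hxy (by simp) (by simp))
    have hmem : ∀ i, i ≤ m → C (k * m + i) 0 = x ∨ C (k * m + i) 0 = y := by
      intro i hi
      have hi' : (i : ℝ) ≤ m := by exact_mod_cast hi
      have hkm : k * m ≤ 2 * m := Nat.mul_le_mul_right _ hk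
      have := hself (k * m + i) 0 (by omega) (by omega)
      have e : Z (k * m + i) 0 = (k + (i : ℝ) / m, 0) := by
        simp only [Z]; push_cast; rw [add_div, mul_div_assoc, div_self hm0.ne', mul_one, zero_div]
      rw [e] at this
      refine hs _ ?_ ?_ _ this
      · have : 0 ≤ (i : ℝ) / m := by positivity
        linarith
      · have : (i : ℝ) / m ≤ 1 := by rw [div_le_iff₀ hm0]; linarith
        linarith
    have := tel (φ := φ) (fun i => C (k * m + i) 0) m (by simp only [add_zero]; rw [hx]; exact hxx) ?_
    · simp only [add_zero] at this
      rw [this, hx, hy]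
    · intro i hi
      refine hφ _ _ _ (mem_of_subset hxy ?_ (by simp))
      intro w hw
      simp only [Finset.mem_insert, Finset.mem_singleton] at hw ⊢
      rcases hw with rfl | rfl | rfl
      · exact hmem 0 (by omega)
      · exact hmem i (by omega)
      · exact hmem (i + 1) (by omega)
  have hC1 : C m 0 = b := by
    have := hself m 0 (by omega) (by omega)
    have e : Z m 0 = (1, 0) := by simp only [Z]; rw [div_self hm0.ne']; simp
    rw [e] at this; exact hb _ this
  have hC2 : C (2 * m) 0 = c := by
    have := hself (2 * m) 0 (by omega) (by omega)
    have e : Z (2 * m) 0 = (2, 0) := by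
      simp only [Z]; push_cast; rw [mul_div_assoc, div_self hm0.ne']; simp
    rw [e] at this; exact hc _ this
  have s1 := seg 0 (by omega) a b Ea (by simpa using hC0 0 (by omega)) (by simpa using hC1)
    (by intro s h1 h2; exact hab s (by simpa using h1) (by simpa using h2))
  have s2 := seg 1 (by omega) b c Eb (by simpa using hC1) (by rw [one_mul, ← two_mul]; exact hC2)
    (by intro s h1 h2; exact hbc s (by simpa using h1) (by norm_num at h2; linarith))
  have s3 := seg 2 (by omega) c a Ec hC2 (by rw [show 2 * m + m = 3 * m by ring]; exact hC3 0 (by omega))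
    (by intro s h1 h2; exact hca s (by simpa using h1) (by norm_num at h2; linarith))
  rw [show 3 * m = 2 * m + m by ring, Finset.sum_range_add, show 2 * m = m + m by ring, Finset.sum_range_add] at hR
  simp only [zero_mul, zero_add, one_mul] at s1 s2 s3
  rw [show 2 * m = m + m by ring] at s3
  rw [← s1, ← s2, ← s3]
  rw [← hR]
  rfl

end SComplex

namespace SComplex

theorem top_thm (X : SComplex) (hX : Nonempty (X.realSpace ≃ₜ ↥(Metric.sphere (0 : EuclideanSpace ℝ (Fin 3)) 1)))
    {φ : ℕ → ℕ → ZMod 2} (hφ : ∀ a b c, {a, b, c} ∈ X.faces → φ a b + φ b c = φ a c) {a b c : ℕ}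
    (hab : a ≠ b) (hbc : b ≠ c) (hca : c ≠ a)
    (Ea : {a, b} ∈ X.faces) (Eb : {b, c} ∈ X.faces) (Ec : {c, a} ∈ X.faces)
    (h3 : ∃ T ∈ X.faces, T.card = 3) : φ a b + φ b c + φ c a = 0 := by
  obtain ⟨h⟩ := hX
  obtain ⟨T, hT, hT3⟩ := h3
  -- the base point
  let p : X.realSpace := ⟨fun x => if x ∈ T then 1 / 3 else 0, by
    refine ⟨fun v => by dsimp only; split_ifs <;> norm_num, T, hT, ?_, ?_⟩
    · intro v hv
      by_contra hcon
      exact hv (by simp [hcon])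
    · rw [Finset.sum_congr rfl (fun x hx => if_pos hx), Finset.sum_const, hT3]
      norm_num⟩
  let sc : ℝ → ℝ := fun s => max 0 (min 3 s)
  have hsc : Continuous sc := by fun_prop
  let α : ℝ → ℝ := fun s => max 0 (1 - sc s) + max 0 (sc s - 2)
  let β : ℝ → ℝ := fun s => max 0 (1 - |sc s - 1|)
  let κ : ℝ → ℝ := fun s => max 0 (1 - |sc s - 2|)
  let w : ℝ → ℕ → ℝ := fun s x => if x = a then α s else if x = b then β s else if x = c then κ s else 0
  have hw : Continuous w := by
    refine continuous_pi fun x => ?_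
    dsimp only [w]
    split_ifs
    · fun_prop
    · fun_prop
    · fun_prop
    · fun_prop
  have wa : ∀ s, w s a = α s := fun s => by simp [w]
  have wb : ∀ s, w s b = β s := fun s => by simp [w, hab.symm]
  have wc : ∀ s, w s c = κ s := fun s => by simp [w, hbc.symm, hca]
  have wx : ∀ s x, x ≠ a → x ≠ b → x ≠ c → w s x = 0 := fun s x h1 h2 h3 => by simp [w, h1, h2, h3]
  have s0 : ∀ s, 0 ≤ sc s := fun s => le_max_left _ _
  have s3 : ∀ s, sc s ≤ 3 := fun s => max_le (by norm_num) (min_le_left _ _)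
  have r1 : ∀ s, sc s ≤ 1 → α s = 1 - sc s ∧ β s = sc s ∧ κ s = 0 := by
    intro s hs
    have := s0 s
    refine ⟨?_, ?_, ?_⟩
    · simp only [α]; rw [max_eq_right (by linarith), max_eq_left (by linarith), add_zero]
    · simp only [β]; rw [abs_of_nonpos (by linarith), max_eq_right (by linarith)]; ring
    · simp only [κ]; rw [abs_of_nonpos (by linarith), max_eq_left (by linarith)]
  have r2 : ∀ s, 1 ≤ sc s → sc s ≤ 2 → α s = 0 ∧ β s = 2 - sc s ∧ κ s = sc s - 1 := by
    intro s hs hs'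
    refine ⟨?_, ?_, ?_⟩
    · simp only [α]; rw [max_eq_left (by linarith), max_eq_left (by linarith), add_zero]
    · simp only [β]; rw [abs_of_nonneg (by linarith), max_eq_right (by linarith)]; ring
    · simp only [κ]; rw [abs_of_nonpos (by linarith), max_eq_right (by linarith)]; ring
  have r3 : ∀ s, 2 ≤ sc s → α s = sc s - 2 ∧ β s = 0 ∧ κ s = 3 - sc s := by
    intro s hs
    have := s3 s
    refine ⟨?_, ?_, ?_⟩
    · simp only [α]; rw [max_eq_left (by linarith), max_eq_right (by linarith), zero_add]
    · simp only [β]; rw [abs_of_nonneg (by linarith), max_eq_left (by linarith)]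
    · simp only [κ]; rw [abs_of_nonneg (by linarith), max_eq_right (by linarith)]; ring
  have hnn : ∀ s x, 0 ≤ w s x := by
    intro s x
    dsimp only [w]
    split_ifs
    · exact add_nonneg (le_max_left _ _) (le_max_left _ _)
    · exact le_max_left _ _
    · exact le_max_left _ _
    · exact le_rfl
  have hsupp : ∀ s, ∃ e ∈ X.faces, e.card = 2 ∧ (∀ v, w s v ≠ 0 → v ∈ e) ∧ ∑ v ∈ e, w s v = 1 := by
    intro s
    rcases le_total (sc s) 1 with h1 | h1
    · obtain ⟨e1, e2, e3⟩ := r1 s h1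
      refine ⟨_, Ea, Finset.card_pair hab, ?_, ?_⟩
      · intro v hv
        by_contra hcon
        simp only [Finset.mem_insert, Finset.mem_singleton, not_or] at hcon
        by_cases hc : v = c
        · subst hc; exact hv (by rw [wc, e3])
        · exact hv (wx s v hcon.1 hcon.2 hc)
      · rw [Finset.sum_pair hab, wa, wb, e1, e2]; ring
    rcases le_total (sc s) 2 with h2 | h2
    · obtain ⟨e1, e2, e3⟩ := r2 s h1 h2
      refine ⟨_, Eb, Finset.card_pair hbc, ?_, ?_⟩
      · intro v hv
        by_contra hcon
        simp only [Finset.mem_insert, Finset.mem_singleton, not_or] at hcon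
        by_cases hc : v = a
        · subst hc; exact hv (by rw [wa, e1])
        · exact hv (wx s v hc hcon.1 hcon.2)
      · rw [Finset.sum_pair hbc, wb, wc, e3, e2]; ring
    · obtain ⟨e1, e2, e3⟩ := r3 s h2
      refine ⟨_, Ec, Finset.card_pair hca, ?_, ?_⟩
      · intro v hv
        by_contra hcon
        simp only [Finset.mem_insert, Finset.mem_singleton, not_or] at hcon
        by_cases hc : v = b
        · subst hc; exact hv (by rw [wb, e2])
        · exact hv (wx s v hcon.2 hc hcon.1)
      · rw [Finset.sum_pair hca, wa, wc, e3, e1]; ring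
  let γ : ℝ → X.realSpace := fun s => ⟨w s, hnn s, by
    obtain ⟨e, h1, _, h2, h3⟩ := hsupp s
    exact ⟨e, h1, h2, h3⟩⟩
  have hγ : Continuous γ := Continuous.subtype_mk hw _
  have hp : ∀ s, γ s ≠ p := by
    intro s hs
    obtain ⟨e, h1, h2, h3, _⟩ := hsupp s
    have : T ⊆ e := by
      intro x hx
      refine h3 x ?_
      have : (γ s).1 x = p.1 x := by rw [hs]
      have e1 : p.1 x = 1 / 3 := by simp only [p]; rw [if_pos hx]
      rw [e1] at this
      have e2 : w s x = 1 / 3 := this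
      rw [e2]; norm_num
    have := Finset.card_le_card this
    omega
  obtain ⟨H, hH, H0, H1, H2⟩ := contract_loop h p γ hγ hp
  have scid : ∀ s, 0 ≤ s → s ≤ 3 → sc s = s := by
    intro s h1 h2
    simp only [sc]; rw [min_eq_right h2, max_eq_right h1]
  have e0 := scid 0 (by norm_num) (by norm_num)
  have e1 := scid 1 (by norm_num) (by norm_num)
  have e2 := scid 2 (by norm_num) (by norm_num)
  have e3 := scid 3 (by norm_num) (by norm_num)
  have gen : ∀ s x, w s x ≠ 0 → x = a ∨ x = b ∨ x = c := by
    intro s x hx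
    by_contra hcon
    push Not at hcon
    exact hx (wx s x hcon.1 hcon.2.1 hcon.2.2)
  have b0 : ∀ x, (γ 0).1 x ≠ 0 → x = a := by
    intro x hx
    change w 0 x ≠ 0 at hx
    obtain ⟨f1, f2, f3⟩ := r1 0 (by rw [e0]; norm_num)
    rcases gen _ _ hx with rfl | rfl | rfl
    · rfl
    · rw [wb, f2, e0] at hx; exact absurd rfl hx
    · rw [wc, f3] at hx; exact absurd rfl hx
  have b3 : γ 3 = γ 0 := by
    apply Subtype.ext
    show w 3 = w 0
    funext x
    obtain ⟨f1, f2, f3⟩ := r1 0 (by rw [e0]; norm_num)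
    obtain ⟨g1, g2, g3⟩ := r3 3 (by rw [e3]; norm_num)
    dsimp only [w]
    rw [f1, f2, f3, g1, g2, g3, e0, e3]
    norm_num
  refine grid X hφ (a := a) (b := b) (c := c) H hH ?_ ?_ ?_ ?_ ?_ ?_ ?_ ?_ Ea Eb Ec
  · intro s h1 h2 x hx
    rw [H0] at hx
    change w s x ≠ 0 at hx
    obtain ⟨f1, f2, f3⟩ := r1 s (by rw [scid s h1 (by linarith)]; exact h2)
    rcases gen _ _ hx with rfl | rfl | rfl
    · simp
    · simp
    · rw [wc, f3] at hx; exact absurd rfl hx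
  · intro s h1 h2 x hx
    rw [H0] at hx
    change w s x ≠ 0 at hx
    have := scid s (by linarith) (by linarith)
    obtain ⟨f1, f2, f3⟩ := r2 s (by rw [this]; exact h1) (by rw [this]; exact h2)
    rcases gen _ _ hx with rfl | rfl | rfl
    · rw [wa, f1] at hx; exact absurd rfl hx
    · simp
    · simp
  · intro s h1 h2 x hx
    rw [H0] at hx
    change w s x ≠ 0 at hx
    have := scid s (by linarith) (by linarith)
    obtain ⟨f1, f2, f3⟩ := r3 s (by rw [this]; exact h1)
    rcases gen _ _ hx with rfl | rfl | rfl
    · simp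
    · rw [wb, f2] at hx; exact absurd rfl hx
    · simp
  · intro x hx
    rw [H0] at hx
    change w 1 x ≠ 0 at hx
    obtain ⟨f1, f2, f3⟩ := r1 1 (by rw [e1])
    rcases gen _ _ hx with rfl | rfl | rfl
    · rw [wa, f1, e1] at hx; exact absurd (by norm_num) hx
    · rfl
    · rw [wc, f3] at hx; exact absurd rfl hx
  · intro x hx
    rw [H0] at hx
    change w 2 x ≠ 0 at hx
    obtain ⟨f1, f2, f3⟩ := r3 2 (by rw [e2])
    rcases gen _ _ hx with rfl | rfl | rfl
    · rw [wa, f1, e2] at hx; exact absurd (by norm_num) hx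
    · rw [wb, f2] at hx; exact absurd rfl hx
    · rfl
  · intro τ x hx
    rw [H2 0 rfl] at hx
    exact b0 x hx
  · intro τ x hx
    rw [H2 3 b3] at hx
    exact b0 x hx
  · intro s x hx
    rw [H1] at hx
    exact b0 x hx

end SComplex

namespace SComplex
variable {K : SComplex}

/-- two facets at `v` sharing a triangle `v p q` with `p q` not inside `T` -/
def SRel (K : SComplex) (v : ℕ) (T : Finset ℕ) (F G : Finset ℕ) : Prop :=
  ∃ p q r s, ¬ ({p, q} : Finset ℕ) ⊆ T ∧ K.Q v p q r ∧ K.Q v p q s ∧ F = {v, p, q, r} ∧ G = {v, p, q, s}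

theorem SRel.symm {v : ℕ} {T F G : Finset ℕ} (h : SRel K v T F G) : SRel K v T G F := by
  obtain ⟨p, q, r, s, h1, h2, h3, h4, h5⟩ := h
  exact ⟨p, q, s, r, h1, h3, h2, h5, h4⟩

theorem pair_eq_iff {a b p q : ℕ} : ({a, b} : Finset ℕ) = {p, q} ↔ (a = p ∧ b = q) ∨ (a = q ∧ b = p) := by
  rw [← Finset.coe_inj]; push_cast; exact Set.pair_eq_pair_iff

open Classical in
/-- indicator with values in `ZMod 2` -/
noncomputable def ind (P : Prop) : ZMod 2 := if P then 1 else 0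

theorem ind_true {P : Prop} (h : P) : ind P = 1 := if_pos h
theorem ind_false {P : Prop} (h : ¬ P) : ind P = 0 := if_neg h

theorem ind_sum_aux (h : K.NP) {v p q r s z : ℕ} (h1 : K.Q v p q r) (h2 : K.Q v p q s) (hrs : r ≠ s)
    (h3 : K.Q v p q z) :
    (1 : ZMod 2) = ind (({v, p, q, z} : Finset ℕ) = {v, p, q, r}) + ind (({v, p, q, z} : Finset ℕ) = {v, p, q, s}) := by
  obtain ⟨p', q', hpq, hr⟩ := h.deg2 h1.L12
  have e1 := (hr r).mp h1
  have e2 := (hr s).mp h2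
  have e3 := (hr z).mp h3
  have key : ∀ u w, K.Q v p q u → K.Q v p q w → ({v, p, q, u} : Finset ℕ) = {v, p, q, w} → u = w := by
    intro u w hu hw he
    have : u ∈ ({v, p, q, w} : Finset ℕ) := by rw [← he]; simp
    simp only [Finset.mem_insert, Finset.mem_singleton] at this
    rcases this with h | h | h | h
    · exact absurd h.symm hu.2.2.1
    · exact absurd h.symm hu.2.2.2.2.1
    · exact absurd h.symm hu.2.2.2.2.2.1
    · exact h
  have : z = r ∨ z = s := by
    rcases e1 with rfl | rfl <;> rcases e2 with rfl | rfl <;> tauto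
  rcases this with rfl | rfl
  · rw [ind_true rfl, ind_false (fun he => hrs (key _ _ h1 h2 he)), add_zero]
  · rw [ind_true rfl, ind_false (fun he => hrs (key _ _ h1 h2 he.symm)), zero_add]

theorem ind_sum (h : K.NP) {v p q r s x y z : ℕ} (h1 : K.Q v p q r) (h2 : K.Q v p q s) (hrs : r ≠ s)
    (h3 : K.Q v x y z) :
    ind (({x, y} : Finset ℕ) = {p, q}) + ind (({y, z} : Finset ℕ) = {p, q}) + ind (({x, z} : Finset ℕ) = {p, q}) =
    ind (({v, x, y, z} : Finset ℕ) = {v, p, q, r}) + ind (({v, x, y, z} : Finset ℕ) = {v, p, q, s}) := by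
  have hd := h3
  obtain ⟨d1, d2, d3, d4, d5, d6, -⟩ := hd
  by_cases c1 : ({x, y} : Finset ℕ) = {p, q}
  · have e1 : ({v, x, y, z} : Finset ℕ) = {v, p, q, z} := by
      rcases pair_eq_iff.mp c1 with ⟨rfl, rfl⟩ | ⟨rfl, rfl⟩
      · rfl
      · ext; simp; tauto
    have hz : K.Q v p q z := by
      rcases pair_eq_iff.mp c1 with ⟨rfl, rfl⟩ | ⟨rfl, rfl⟩
      · exact h3
      · exact h3.s23
    rw [ind_true c1, ind_false (P := ({y, z} : Finset ℕ) = _) (by rw [← c1, pair_eq_iff]; tauto),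
      ind_false (P := ({x, z} : Finset ℕ) = _) (by rw [← c1, pair_eq_iff]; tauto), e1, ← ind_sum_aux h h1 h2 hrs hz]; rfl
  by_cases c2 : ({y, z} : Finset ℕ) = {p, q}
  · have e1 : ({v, x, y, z} : Finset ℕ) = {v, p, q, x} := by
      rcases pair_eq_iff.mp c2 with ⟨rfl, rfl⟩ | ⟨rfl, rfl⟩
      · ext; simp; tauto
      · ext; simp; tauto
    have hz : K.Q v p q x := by
      rcases pair_eq_iff.mp c2 with ⟨rfl, rfl⟩ | ⟨rfl, rfl⟩
      · exact h3.s23.s34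
      · exact h3.s23.s34.s23
    rw [ind_true c2, ind_false c1,
      ind_false (P := ({x, z} : Finset ℕ) = _) (by rw [← c2, pair_eq_iff]; tauto), e1, ← ind_sum_aux h h1 h2 hrs hz]; rfl
  by_cases c3 : ({x, z} : Finset ℕ) = {p, q}
  · have e1 : ({v, x, y, z} : Finset ℕ) = {v, p, q, y} := by
      rcases pair_eq_iff.mp c3 with ⟨rfl, rfl⟩ | ⟨rfl, rfl⟩
      · ext; simp; tauto
      · ext; simp; tauto
    have hz : K.Q v p q y := by
      rcases pair_eq_iff.mp c3 with ⟨rfl, rfl⟩ | ⟨rfl, rfl⟩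
      · exact h3.s34
      · exact h3.s34.s23
    rw [ind_true c3, ind_false c1, ind_false c2, e1, ← ind_sum_aux h h1 h2 hrs hz]; rfl
  have key : ∀ u, K.Q v p q u → ({v, x, y, z} : Finset ℕ) ≠ {v, p, q, u} := by
    intro u hu he
    have hp : p ∈ ({v, x, y, z} : Finset ℕ) := by rw [he]; simp
    have hq : q ∈ ({v, x, y, z} : Finset ℕ) := by rw [he]; simp
    simp only [Finset.mem_insert, Finset.mem_singleton] at hp hq
    rw [pair_eq_iff] at c1 c2 c3
    have h1 := hu.1
    have h2 := hu.2.1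
    have h3 := hu.2.2.2.1
    rcases hp with rfl | rfl | rfl | rfl <;> rcases hq with rfl | rfl | rfl | rfl <;> tauto
  rw [ind_false c1, ind_false c2, ind_false c3, ind_false (key _ h1), ind_false (key _ h2)]; rfl

theorem path_cocycle (h : K.NP) {v : ℕ} {T F1 F : Finset ℕ} (hp : Relation.ReflTransGen (SRel K v T) F1 F) :
    ∃ ψ : Finset ℕ → ZMod 2, (∀ e ⊆ T, ψ e = 0) ∧ ∀ x y z, K.Q v x y z →
      ψ {x, y} + ψ {y, z} + ψ {x, z} = ind (({v, x, y, z} : Finset ℕ) = F1) + ind (({v, x, y, z} : Finset ℕ) = F) := by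
  induction hp with
  | refl => exact ⟨fun _ => 0, fun _ _ => rfl, fun x y z _ => by
      rw [CharTwo.add_self_eq_zero (ind _)]; rfl⟩
  | tail hprev hyz IH =>
    obtain ⟨ψ, h1, h2⟩ := IH
    obtain ⟨p, q, r, s, g1, g2, g3, rfl, rfl⟩ := hyz
    by_cases hrs : r = s
    · subst hrs; exact ⟨ψ, h1, h2⟩
    refine ⟨fun e => ψ e + ind (e = {p, q}), ?_, ?_⟩
    · intro e he
      dsimp only
      rw [h1 e he, ind_false, add_zero]
      rintro rfl; exact g1 he
    · intro x y z hQ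
      have e1 := h2 x y z hQ
      have e2 := ind_sum h g2 g3 hrs hQ
      dsimp only
      have : ∀ a b c d e f : ZMod 2, a + d + (b + e) + (c + f) = (a + b + c) + (d + e + f) := by intros; abel
      rw [this, e1, e2]
      have : ∀ a b c : ZMod 2, a + b + (b + c) = a + c := by decide
      rw [this]

theorem Q_lk {v x y z : ℕ} : {x, y, z} ∈ (K.lk {v}).faces → x ≠ y → y ≠ z → x ≠ z → K.Q v x y z := by
  intro h h1 h2 h3
  rw [mem_lk1] at h
  obtain ⟨-, g1, g2⟩ := h
  simp only [Finset.mem_insert, Finset.mem_singleton, not_or] at g1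
  exact ⟨g1.1, g1.2.1, g1.2.2, h1, h3, h2, g2⟩

theorem L_lk {v x y : ℕ} (h : y ∈ K.L v x) : {x, y} ∈ (K.lk {v}).faces := by
  rw [mem_L] at h
  rw [mem_lk1]
  refine ⟨by simp, ?_, h.2.2.2⟩
  simp only [Finset.mem_insert, Finset.mem_singleton, not_or]
  exact ⟨h.1, h.2.1.symm⟩

/-- the two sides of `ab` are separated -/
theorem sep (h : K.NP) {v : ℕ} (hs : K.HasSphereLink 3 v) {a b c p q : ℕ} (h1 : b ∈ K.L v a) (h2 : c ∈ K.L v b)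
    (h3 : a ∈ K.L v c) (hp : K.Q v a b p) (hq : K.Q v a b q) (hpq : p ≠ q) :
    ¬ Relation.ReflTransGen (SRel K v {a, b, c}) {v, a, b, p} {v, a, b, q} := by
  intro hpath
  obtain ⟨ψ, g1, g2⟩ := path_cocycle h hpath
  let χ : Finset ℕ → ZMod 2 := fun e => ψ e + ind (e = {a, b})
  have hχ : ∀ x y z, K.Q v x y z → χ {x, y} + χ {y, z} + χ {x, z} = 0 := by
    intro x y z hQ
    have e1 := g2 x y z hQ
    have e2 := ind_sum h hp hq hpq hQ
    have : ∀ a b c d e f : ZMod 2, a + d + (b + e) + (c + f) = (a + b + c) + (d + e + f) := by intros; abel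
    show ψ _ + ind _ + (ψ _ + ind _) + (ψ _ + ind _) = 0
    rw [this, e1, e2, CharTwo.add_self_eq_zero]
  let φ : ℕ → ℕ → ZMod 2 := fun x y => if x = y then 0 else χ {x, y}
  have φs : ∀ x y, φ x y = φ y x := by
    intro x y
    simp only [φ]; rw [Finset.pair_comm]; simp only [eq_comm]
  have φd : ∀ x, φ x x = 0 := fun x => by simp [φ]
  have hab : a ≠ b := (mem_L.mp h1).2.2.1.symm
  have hbc : b ≠ c := (mem_L.mp h2).2.2.1.symm
  have hca : c ≠ a := (mem_L.mp h3).2.2.1.symm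
  have T := top_thm (K.lk {v}) hs (φ := φ) (a := a) (b := b) (c := c) ?_ hab hbc hca (L_lk h1) (L_lk h2) (L_lk h3) ?_
  · simp only [φ, χ] at T
    rw [if_neg hab, if_neg hbc, if_neg hca, g1 _ (by intro x; simp <;> tauto), g1 _ (by intro x; simp <;> tauto),
      g1 _ (by intro x; simp <;> tauto), ind_true trivial, ind_false (by rw [pair_eq_iff]; tauto),
      ind_false (by rw [pair_eq_iff]; tauto)] at T
    exact absurd T (by decide)
  · intro x y z hf
    by_cases e1 : x = y
    · subst e1; rw [φd, zero_add]
    by_cases e2 : y = z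
    · subst e2; rw [φd, add_zero]
    by_cases e3 : x = z
    · subst e3; rw [φd, φs y x, CharTwo.add_self_eq_zero]
    have := hχ x y z (Q_lk hf e1 e2 e3)
    simp only [φ]
    rw [if_neg e1, if_neg e2, if_neg e3]
    revert this
    generalize χ {x, y} = A
    generalize χ {y, z} = B
    generalize χ {x, z} = C
    revert A B C; decide
  · refine ⟨{a, b, p}, ?_, Finset.card_eq_three.mpr ⟨a, b, p, hp.2.2.2.1, hp.2.2.2.2.1, hp.2.2.2.2.2.1, rfl⟩⟩
    rw [mem_lk1]
    refine ⟨by simp, ?_, hp.2.2.2.2.2.2⟩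
    simp only [Finset.mem_insert, Finset.mem_singleton, not_or]
    exact ⟨hp.1, hp.2.1, hp.2.2.1⟩

theorem parity (h : K.NP) {v b a : ℕ} {D : Finset ℕ → Bool}
    (hD : ∀ z ≠ a, ∀ r s, K.Q v b z r → K.Q v b z s → D {v, b, z, r} = D {v, b, z, s})
    {r s : ℕ} (hr : K.Q v b a r) (hs : K.Q v b a s) (h1 : D {v, b, a, r} = true) : D {v, b, a, s} = true := by
  have sw : ∀ x y, ({v, b, x, y} : Finset ℕ) = {v, b, y, x} := by intro x y; ext; simp; tauto
  have := h.ecycle (x := v) (y := b) (fun z => z ≠ a ∧ ∀ r, K.Q v b z r → D {v, b, z, r} = true) a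
    ⟨r, hr.s34.L12, hr.2.2.2.2.2.1.symm, fun u hu => by
      rw [hD r hr.2.2.2.2.2.1.symm u a hu hr.s34, sw]; exact h1⟩ (by simp) (by
      rintro z u ⟨hz, hz2⟩ hQ
      by_cases hu : u = a
      · exact Or.inr hu
      refine Or.inl ⟨hu, fun w hw => ?_⟩
      rw [hD u hu w z hw hQ.s34, sw]; exact hz2 u hQ) s hs.s34.L12
  rcases this with ⟨_, h2⟩ | h2
  · rw [sw]; exact h2 a hs.s34
  · exact absurd h2.symm hs.2.2.2.2.2.1

theorem B3 (hK : InClassR K) {v : ℕ} (hs : K.HasSphereLink 3 v) {a b c : ℕ} (h1 : b ∈ K.L v a) (h2 : c ∈ K.L v b)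
    (h3 : a ∈ K.L v c) : K.Q v a b c := by
  classical
  by_contra hQ
  have np := NP.ofNPM hK.1
  have hab : a ≠ b := (mem_L.mp h1).2.2.1.symm
  have hbc : b ≠ c := (mem_L.mp h2).2.2.1.symm
  have hca : c ≠ a := (mem_L.mp h3).2.2.1.symm
  have hT : ({a, b, c} : Finset ℕ) ∉ K.faces := by
    intro hT
    exact hQ (four_mem hK h1 (L_rot.mp h3) h2 (mem_L.mpr ⟨hab, hca, hbc.symm, hT⟩))
  obtain ⟨p1, p2, hp, hr⟩ := np.deg2 h1
  have q1 := (hr p1).mpr (Or.inl rfl)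
  have q2 := (hr p2).mpr (Or.inr rfl)
  have hsep := sep np hs h1 h2 h3 q1 q2 hp
  let D : Finset ℕ → Bool := fun F => decide (Relation.ReflTransGen (SRel K v {a, b, c}) {v, a, b, p1} F)
  have D1 : D {v, a, b, p1} = true := by simp only [D, decide_eq_true_eq]; exact Relation.ReflTransGen.refl
  have D2 : D {v, a, b, p2} = false := by simp only [D, decide_eq_false_iff_not]; exact hsep
  have same : ∀ x y r s, ¬ ({x, y} : Finset ℕ) ⊆ {a, b, c} → K.Q v x y r → K.Q v x y s →
      D {v, x, y, r} = D {v, x, y, s} := by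
    intro x y r s hxy hr hs
    have : SRel K v {a, b, c} {v, x, y, r} {v, x, y, s} := ⟨x, y, r, s, hxy, hr, hs, rfl, rfl⟩
    simp only [D, decide_eq_decide]
    exact ⟨fun h => h.tail this, fun h => h.tail this.symm⟩
  have sub : ∀ x y, ({x, y} : Finset ℕ) ⊆ {a, b, c} ↔ (x = a ∨ x = b ∨ x = c) ∧ (y = a ∨ y = b ∨ y = c) := by
    intro x y
    simp [Finset.insert_subset_iff]
  have both : ∀ x y r s, (K.Q v x y r) → (K.Q v x y s) → D {v, x, y, r} = true → D {v, x, y, s} = false →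
      ∀ z, z ∈ K.L v x → (∀ u, u ≠ y → u ≠ z → u ∈ K.L v x → ¬ ({x, u} : Finset ℕ) ⊆ {a, b, c}) →
      ∀ i, ∃ p, K.Q v x z p ∧ D {v, x, z, p} = i := by
    intro x y r s hr hs hDr hDs z hz hu
    obtain ⟨m1, m2, hm, hmm⟩ := np.deg2 hz
    have w1 := (hmm m1).mpr (Or.inl rfl)
    have w2 := (hmm m2).mpr (Or.inr rfl)
    have hne : D {v, x, z, m1} ≠ D {v, x, z, m2} := by
      intro he
      have := parity np (v := v) (b := x) (a := y) (D := D) ?_ hr hs hDr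
      · rw [hDs] at this; exact absurd this (by simp)
      · intro u huy r s hr hs
        by_cases huz : u = z
        · subst huz
          rcases (hmm r).mp hr with rfl | rfl <;> rcases (hmm s).mp hs with rfl | rfl <;> simp [he]
        · exact same x u r s (hu u huy huz hr.L12) hr hs
    intro i
    rcases hi : D {v, x, z, m1} with _ | _ <;> rcases hj : D {v, x, z, m2} with _ | _ <;> rcases i with _ | _
    all_goals first
      | exact ⟨m1, w1, hi⟩
      | exact ⟨m2, w2, hj⟩
      | (rw [hi, hj] at hne; exact absurd rfl hne)
  have sw : ∀ x y r, ({v, x, y, r} : Finset ℕ) = {v, y, x, r} := by intros; ext; simp; tauto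
  have Cab : ∀ i, ∃ p, K.Q v a b p ∧ D {v, a, b, p} = i := by
    intro i
    cases i
    · exact ⟨p2, q2, D2⟩
    · exact ⟨p1, q1, D1⟩
  have Cac := both a b p1 p2 q1 q2 D1 D2 c (L_rot.mp h3) (by
    intro u u1 u2 u3
    rw [sub]
    have : u ≠ a := (mem_L.mp u3).2.2.1
    tauto)
  have Cbc := both b a p1 p2 q1.s23 q2.s23 (by rw [sw]; exact D1) (by rw [sw]; exact D2) c h2 (by
    intro u u1 u2 u3
    rw [sub]
    have : u ≠ b := (mem_L.mp u3).2.2.1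
    tauto)
  have conv : ∀ x y r, insert r (insert v ({x, y} : Finset ℕ)) = {v, x, y, r} := by intros; ext; simp; tauto
  have conv2 : ∀ x y, (∀ i, ∃ p, K.Q v x y p ∧ D {v, x, y, p} = i) → ∀ i, ∃ p, p ∉ insert v ({x, y} : Finset ℕ) ∧
      insert p (insert v ({x, y} : Finset ℕ)) ∈ K.faces ∧ D (insert p (insert v {x, y})) = i := by
    intro x y hh i
    obtain ⟨p, g1, g2⟩ := hh i
    refine ⟨p, ?_, ?_, ?_⟩
    · simp only [Finset.mem_insert, Finset.mem_singleton, not_or]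
      exact ⟨g1.2.2.1.symm, g1.2.2.2.2.1.symm, g1.2.2.2.2.2.1.symm⟩
    · rw [conv]; exact g1.2.2.2.2.2.2
    · rw [conv]; exact g2
  refine no_split hK (v := v) (T := {a, b, c}) (D := D)
    ⟨np, Finset.card_eq_three.mpr ⟨a, b, c, hab, hca.symm, hbc, rfl⟩, ?_, hT, ?_, ?_⟩
  · simp only [Finset.mem_insert, Finset.mem_singleton, not_or]
    exact ⟨(mem_L.mp h1).1, (mem_L.mp h2).1, (mem_L.mp h3).1⟩
  · intro e he hc
    obtain ⟨x, y, hxy, rfl⟩ := Finset.card_eq_two.mp hc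
    obtain ⟨hx, hy⟩ := (sub x y).mp he
    rcases hx with rfl | rfl | rfl <;> rcases hy with rfl | rfl | rfl
    · exact absurd rfl hxy
    · exact conv2 _ _ Cab
    · exact conv2 _ _ Cac
    · rw [Finset.pair_comm]; exact conv2 _ _ Cab
    · exact absurd rfl hxy
    · exact conv2 _ _ Cbc
    · rw [Finset.pair_comm]; exact conv2 _ _ Cac
    · rw [Finset.pair_comm]; exact conv2 _ _ Cbc
    · exact absurd rfl hxy
  · intro e hc hv he p q hp hq hpK hqK
    obtain ⟨x, y, hxy, rfl⟩ := Finset.card_eq_two.mp hc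
    have mk : ∀ r, r ∉ insert v ({x, y} : Finset ℕ) → insert r (insert v ({x, y} : Finset ℕ)) ∈ K.faces → K.Q v x y r := by
      intro r hr hrK
      rw [conv] at hrK
      simp only [Finset.mem_insert, Finset.mem_singleton, not_or] at hr hv
      exact ⟨hv.1, hv.2, Ne.symm hr.1, hxy, Ne.symm hr.2.1, Ne.symm hr.2.2, hrK⟩
    rw [conv, conv]
    exact same x y p q he (mk p hp hpK) (mk q hq hqK)

/-- in a spherical link, adjacent vertices have exactly two common neighbours -/
theorem B3' (hK : InClassR K) {v : ℕ} (hs : K.HasSphereLink 3 v) {p q : ℕ} (h : q ∈ K.L v p) :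
    (K.L v p ∩ K.L v q).card = 2 := by
  have np := NP.ofNPM hK.1
  obtain ⟨a, b, hab, hr⟩ := np.deg2 h
  have : K.L v p ∩ K.L v q = {a, b} := by
    ext z
    rw [Finset.mem_inter, Finset.mem_insert, Finset.mem_singleton, ← hr]
    constructor
    · rintro ⟨h1, h2⟩
      exact B3 hK hs h h2 (L_rot.mp h1)
    · intro hQ
      exact ⟨hQ.s34.L12, hQ.s23.s34.L12⟩
  rw [this, Finset.card_pair hab]

end SComplex

namespace SComplex
variable {K : SComplex}

/-- the combinatorial facts used in the counting argument -/
structure Ctx (K : SComplex) (t t1 h : ℕ) : Prop where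
  np : K.NP
  ne : t ≠ t1
  tV : t ∈ K.vertexSet
  t1V : t1 ∈ K.vertexSet
  B1 : ∀ x y, y ∈ K.N x → 4 ≤ (K.L x y).card
  B2 : ∀ x y, y ∈ K.N x → ∃ z, z ∈ K.N x ∧ z ∈ K.N y ∧ z ∉ K.L x y
  B3 : ∀ v, v ≠ t → v ≠ t1 → ∀ a b c, b ∈ K.L v a → c ∈ K.L v b → a ∈ K.L v c → K.Q v a b c
  B3' : ∀ v, v ≠ t → v ≠ t1 → ∀ p q, q ∈ K.L v p → (K.L v p ∩ K.L v q).card = 2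
  six : ∀ x, 6 ∣ ∑ y ∈ K.N x, (K.L x y).card
  sumt : ∑ y ∈ K.N t, (K.L t y).card + 12 = 6 * ((K.N t).card + h)
  sumt1 : ∑ y ∈ K.N t1, (K.L t1 y).card + 6 = 6 * (K.N t1).card
  hodd : Odd h

theorem vert_N (np : K.NP) {x : ℕ} (hx : x ∈ K.vertexSet) : (K.N x).Nonempty :=
  N_nonempty np (mem_vertexSet.mp hx)

namespace Ctx
variable {t t1 h : ℕ}

theorem Lle2 (c : Ctx K t t1 h) {x y : ℕ} (hy : y ∈ K.N x) : (K.L x y).card + 2 ≤ (K.N x).card := by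
  obtain ⟨z, h1, h2, h3⟩ := c.B2 x y hy
  have hzy : z ≠ y := by rintro rfl; exact N_irr h2
  have : insert y (insert z (K.L x y)) ⊆ K.N x := by
    intro w hw
    simp only [Finset.mem_insert] at hw
    rcases hw with rfl | rfl | hw
    · exact hy
    · exact h1
    · exact L_sub_left hw
  have h4 := Finset.card_le_card this
  rw [Finset.card_insert_of_notMem (by simp only [Finset.mem_insert, not_or]; exact ⟨hzy.symm, not_L_self2⟩),
    Finset.card_insert_of_notMem h3] at h4
  exact h4

theorem sum_le (c : Ctx K t t1 h) (x : ℕ) : ∑ y ∈ K.N x, (K.L x y).card + 2 * (K.N x).card ≤ (K.N x).card * (K.N x).card := by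
  have h1 : ∑ y ∈ K.N x, ((K.L x y).card + 2) ≤ ∑ y ∈ K.N x, (K.N x).card :=
    Finset.sum_le_sum fun y hy => c.Lle2 hy
  rw [Finset.sum_add_distrib, Finset.sum_const, Finset.sum_const, smul_eq_mul, smul_eq_mul] at h1
  omega

theorem deg6 (c : Ctx K t t1 h) {x : ℕ} (hx : x ∈ K.vertexSet) : 6 ≤ (K.N x).card := by
  obtain ⟨y, hy⟩ := vert_N c.np hx
  have := c.Lle2 hy
  have := c.B1 x y hy
  omega

theorem n8 (c : Ctx K t t1 h) : 8 ≤ (K.N t).card := by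
  have h1 := c.deg6 c.tV
  have h2 := c.sum_le t
  have h3 := c.sumt
  have h4 : 1 ≤ h := c.hodd.pos
  generalize (K.N t).card = n at *
  by_contra hc
  have : n = 6 ∨ n = 7 := by omega
  rcases this with rfl | rfl <;> omega

theorem t18 (c : Ctx K t t1 h) : 8 ≤ (K.N t1).card := by
  have h1 := c.deg6 c.t1V
  have h2 := c.sum_le t1
  have h3 := c.sumt1
  generalize (K.N t1).card = n at *
  by_contra hc
  have : n = 6 ∨ n = 7 := by omega
  rcases this with rfl | rfl <;> omega

theorem d6 (c : Ctx K t t1 h) {v y : ℕ} (hv : (K.N v).card = 6) (hy : y ∈ K.N v) : (K.L v y).card = 4 := by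
  have := c.Lle2 hy
  have := c.B1 v y hy
  omega

theorem d7 (c : Ctx K t t1 h) {v : ℕ} (hv : (K.N v).card = 7) :
    ((K.N v).filter fun x => (K.L v x).card = 5).card = 2 := by
  have h1 : ∀ y ∈ K.N v, (K.L v y).card = 4 + if (K.L v y).card = 5 then 1 else 0 := by
    intro y hy
    have := c.Lle2 hy
    have := c.B1 v y hy
    split_ifs <;> omega
  have h2 := c.six v
  rw [Finset.sum_congr rfl h1, Finset.sum_add_distrib, Finset.sum_const, hv, ← Finset.card_filter, smul_eq_mul] at h2
  have h3 := Finset.card_filter_le (K.N v) fun x => (K.L v x).card = 5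
  omega

theorem d7' (c : Ctx K t t1 h) {v x x' : ℕ} (h1 : v ≠ t) (h2 : v ≠ t1) (hv : (K.N v).card = 7) (hx : x ∈ K.N v)
    (hx5 : (K.L v x).card = 5) (hx' : x' ∈ K.N v) (hne : x' ≠ x) (hL : x' ∉ K.L v x) : (K.L v x').card = 5 := by
  have h3 := c.d7 hv
  obtain ⟨p, hp, hpx⟩ := Finset.exists_mem_ne (by rw [h3]; norm_num) x
  rw [Finset.mem_filter] at hp
  have hpL : p ∉ K.L v x := by
    intro hpL
    have e1 := c.B3' v h1 h2 x p hpL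
    have e2 := Finset.card_union_add_card_inter (K.L v x) (K.L v p)
    have e3 : (K.L v x ∪ K.L v p).card ≤ (K.N v).card :=
      Finset.card_le_card (Finset.union_subset (fun z hz => L_sub_left hz) (fun z hz => L_sub_left hz))
    omega
  by_contra hne5
  have hpx' : p ≠ x' := by rintro rfl; exact hne5 hp.2
  have : insert p (insert x' (insert x (K.L v x))) ⊆ K.N v := by
    intro w hw
    simp only [Finset.mem_insert] at hw
    rcases hw with rfl | rfl | rfl | hw
    · exact hp.1
    · exact hx'
    · exact hx
    · exact L_sub_left hw
  have h4 := Finset.card_le_card this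
  rw [Finset.card_insert_of_notMem, Finset.card_insert_of_notMem, Finset.card_insert_of_notMem not_L_self2] at h4
  · omega
  · simp only [Finset.mem_insert, not_or]; exact ⟨hne, hL⟩
  · simp only [Finset.mem_insert, not_or]; exact ⟨hpx', hpx, hpL⟩

end Ctx

/-- vertices outside the closed star of `t` -/
def Vout (K : SComplex) (t : ℕ) : Finset ℕ := (K.vertexSet \ K.N t).erase t

theorem mem_Vout {t v : ℕ} : v ∈ K.Vout t ↔ v ≠ t ∧ v ∈ K.vertexSet ∧ v ∉ K.N t := by
  unfold Vout; rw [Finset.mem_erase, Finset.mem_sdiff]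

/-- low vertices -/
def Low (K : SComplex) (t v : ℕ) : Prop := v ∈ K.Vout t ∧ (K.N v).card ≤ 7

instance (K : SComplex) (t v : ℕ) : Decidable (Low K t v) := by unfold Low; infer_instance

/-- the amount given by `x` to `v` -/
def gv (K : SComplex) (t x v : ℕ) : ℕ :=
  if v ∈ K.Vout t ∧ x ∈ K.N v then
    (if (K.N v).card = 6 then 2 else if (K.N v).card = 7 ∧ (K.L v x).card = 5 then 3 else 0) else 0

theorem gv_pos {t x v : ℕ} (hg : 0 < gv K t x v) : v ∈ K.Vout t ∧ x ∈ K.N v ∧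
    ((K.N v).card = 6 ∧ gv K t x v = 2 ∨ (K.N v).card = 7 ∧ (K.L v x).card = 5 ∧ gv K t x v = 3) := by
  unfold gv at *
  split_ifs at * with h1 h2 h3
  · exact ⟨h1.1, h1.2, Or.inl ⟨h2, rfl⟩⟩
  · exact ⟨h1.1, h1.2, Or.inr ⟨h3.1, h3.2, rfl⟩⟩
  · omega
  · omega

theorem gv_low {t x v : ℕ} (hg : 0 < gv K t x v) : Low K t v := by
  obtain ⟨h1, h2, h3⟩ := gv_pos hg
  exact ⟨h1, by omega⟩

namespace Ctx
variable {t t1 h : ℕ}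

theorem low_ne (c : Ctx K t t1 h) {v : ℕ} (hv : Low K t v) : v ≠ t1 := by
  rintro rfl
  have := c.t18
  have := hv.2
  omega

theorem low_nt {v x : ℕ} (hv : Low K t v) (hx : x ∈ K.N v) : x ≠ t := by
  rintro rfl
  exact (mem_Vout.mp hv.1).2.2 (N_symm.mp hx)

theorem ext_inter (c : Ctx K t t1 h) {v x x' q : ℕ} (hv : Low K t v) (hx : x' ∉ K.L v x)
    (h1 : q ∈ K.L x v) (h2 : q ∈ K.L x x') (hq : q ≠ t1) : q ∉ K.L v x' := by
  intro h3
  have hqt : q ≠ t := low_nt hv (L_sub_right h1)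
  have := c.B3 q hqt hq x v x' (L_rot'.mp (L_rot'.mp h1)) (L_rot'.mp (L_rot'.mp h3)) (by
    rw [L_rot, ]; exact L_rot'.mp (L_rot'.mp h2))
  exact hx this.s12.s23.s12.s34.L12

theorem ext_card (c : Ctx K t t1 h) {v x x' : ℕ} (hv : Low K t v) (hxN : x ∈ K.N v) (hx'N : x' ∈ K.N v)
    (hne : x' ≠ x) (hx : x' ∉ K.L v x) :
    ((K.L x v ∩ K.L x x').erase t1).card + (K.L v x').card + 2 ≤ (K.N v).card := by
  have hd : Disjoint ((K.L x v ∩ K.L x x').erase t1) (K.L v x') := by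
    rw [Finset.disjoint_left]
    intro q hq
    rw [Finset.mem_erase, Finset.mem_inter] at hq
    exact c.ext_inter hv hx hq.2.1 hq.2.2 hq.1
  have hsub : insert x (insert x' ((K.L x v ∩ K.L x x').erase t1 ∪ K.L v x')) ⊆ K.N v := by
    intro w hw
    simp only [Finset.mem_insert, Finset.mem_union, Finset.mem_erase, Finset.mem_inter] at hw
    rcases hw with rfl | rfl | hw | hw
    · exact hxN
    · exact hx'N
    · exact L_sub_right hw.2.1
    · exact L_sub_left hw
  have h4 := Finset.card_le_card hsub
  rw [Finset.card_insert_of_notMem, Finset.card_insert_of_notMem, Finset.card_union_of_disjoint hd] at h4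
  · omega
  · simp only [Finset.mem_union, Finset.mem_erase, Finset.mem_inter, not_or]
    exact ⟨fun h => not_L_self2 h.2.2, not_L_self2⟩
  · simp only [Finset.mem_insert, Finset.mem_union, Finset.mem_erase, Finset.mem_inter, not_or]
    exact ⟨hne.symm, fun h => not_L_self1 h.2.1, fun h => hx (L_rot.mp h)⟩

theorem card_nbrs {v x x' : ℕ} (hxN : x ∈ K.N v) (hx'N : x' ∈ K.N v) (hx'x : x' ∈ K.N x) (hx : x' ∉ K.L v x) :
    (K.L x v).card + (K.L x x').card + 2 ≤ (K.N x).card + (K.L x v ∩ K.L x x').card := by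
  have hsub : insert v (insert x' (K.L x v ∪ K.L x x')) ⊆ K.N x := by
    intro w hw
    simp only [Finset.mem_insert, Finset.mem_union] at hw
    rcases hw with rfl | rfl | hw | hw
    · exact N_symm.mp hxN
    · exact hx'x
    · exact L_sub_left hw
    · exact L_sub_left hw
  have h4 := Finset.card_le_card hsub
  have h5 := Finset.card_union_add_card_inter (K.L x v) (K.L x x')
  rw [Finset.card_insert_of_notMem, Finset.card_insert_of_notMem] at h4
  · omega
  · simp only [Finset.mem_union, not_or]
    exact ⟨by rwa [L_comm], not_L_self2⟩
  · simp only [Finset.mem_insert, Finset.mem_union, not_or]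
    refine ⟨?_, not_L_self2, ?_⟩
    · rintro rfl; exact N_irr hx'N
    · intro h; rw [L_rot, L_comm] at h; exact hx h

theorem low_nbr8 (c : Ctx K t t1 h) {v x : ℕ} (hv : Low K t v) (hxN : x ∈ K.N v) : 8 ≤ (K.N x).card := by
  obtain ⟨x', g1, g2, g3⟩ := c.B2 v x hxN
  have hne : x' ≠ x := by rintro rfl; exact N_irr g2
  have e1 := c.ext_card hv hxN g1 hne g3
  have e2 := card_nbrs hxN g1 g2 g3
  have e3 := c.B1 x v (N_symm.mp hxN)
  have e4 := c.B1 x x' g2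
  have e5 := c.B1 v x' g1
  have e6 := Finset.pred_card_le_card_erase (s := K.L x v ∩ K.L x x') (a := t1)
  have := hv.2
  omega

theorem low_indep (c : Ctx K t t1 h) {v x : ℕ} (hv : Low K t v) (hxN : x ∈ K.N v) : ¬ Low K t x := by
  intro hx
  have := c.low_nbr8 hv hxN
  have := hx.2
  omega

theorem taker_inter (c : Ctx K t t1 h) {v x x' : ℕ} (hg : 0 < gv K t x v) (hx'N : x' ∈ K.N v)
    (hne : x' ≠ x) (hx : x' ∉ K.L v x) : K.L x v ∩ K.L x x' ⊆ {t1} := by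
  have hv := gv_low hg
  obtain ⟨h1, h2, h3⟩ := gv_pos hg
  have e1 := c.ext_card hv h2 hx'N hne hx
  have : ((K.L x v ∩ K.L x x').erase t1).card = 0 := by
    rcases h3 with ⟨h3, _⟩ | ⟨h3, h4, _⟩
    · have := c.d6 h3 hx'N; omega
    · have := c.d7' (mem_Vout.mp h1).1 (c.low_ne hv) h3 h2 h4 hx'N hne hx
      omega
  intro q hq
  rw [Finset.card_eq_zero] at this
  by_contra hcon
  have : q ∈ (K.L x v ∩ K.L x x').erase t1 := Finset.mem_erase.mpr ⟨by simpa using hcon, hq⟩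
  simp_all

theorem taker (c : Ctx K t t1 h) {v x : ℕ} (hg : 0 < gv K t x v) : 9 ≤ (K.N x).card ∧
    (gv K t x v = 3 → 10 ≤ (K.N x).card) ∧ ((K.N x).filter (Low K t)).card + 6 ≤ (K.N x).card := by
  have hv := gv_low hg
  obtain ⟨h1, hxN, h3⟩ := gv_pos hg
  obtain ⟨x', g1, g2, g3⟩ := c.B2 v x hxN
  have hne : x' ≠ x := by rintro rfl; exact N_irr g2
  have hI := c.taker_inter hg g1 hne g3
  have hI1 : (K.L x v ∩ K.L x x').card ≤ 1 := by
    have := Finset.card_le_card hI; simpa using this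
  have e2 := card_nbrs hxN g1 g2 g3
  have e3 := c.B1 x v (N_symm.mp hxN)
  have e4 := c.B1 x x' g2
  refine ⟨by omega, ?_, ?_⟩
  · intro h3'
    have : (K.L x v).card = 5 := by rw [L_comm]; omega
    omega
  -- two adjacent vertices in `L x x'`
  obtain ⟨q1, hq1, hq1t⟩ := Finset.exists_mem_ne (show 1 < (K.L x x').card by omega) t1
  obtain ⟨r1, r2, hr, hrr⟩ := c.np.deg2 hq1
  have : ∃ q2, K.Q x x' q1 q2 ∧ q2 ≠ t1 := by
    by_cases hr1 : r1 = t1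
    · exact ⟨r2, (hrr r2).mpr (Or.inr rfl), fun h => hr (by rw [hr1, h])⟩
    · exact ⟨r1, (hrr r1).mpr (Or.inl rfl), hr1⟩
  obtain ⟨q2, hQ, hq2t⟩ := this
  have : ∃ q, q ∈ K.L x x' ∧ q ≠ t1 ∧ ¬ Low K t q := by
    by_cases hl : Low K t q1
    · exact ⟨q2, hQ.s34.L12, hq2t, c.low_indep hl (L_sub_left hQ.s23.s12.s34.L12)⟩
    · exact ⟨q1, hq1, hq1t, hl⟩
  obtain ⟨q, hq1, hq2, hq3⟩ := this
  have hsub : insert q (insert x' (K.L x v)) ⊆ (K.N x).filter fun y => ¬ Low K t y := by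
    intro w hw
    rw [Finset.mem_filter]
    simp only [Finset.mem_insert] at hw
    rcases hw with rfl | rfl | hw
    · exact ⟨L_sub_left hq1, hq3⟩
    · exact ⟨g2, c.low_indep hv g1⟩
    · exact ⟨L_sub_left hw, c.low_indep hv (L_sub_right hw)⟩
  have h4 := Finset.card_le_card hsub
  rw [Finset.card_insert_of_notMem, Finset.card_insert_of_notMem (by rw [L_comm]; exact g3)] at h4
  · have := Finset.card_filter_add_card_filter_not (s := K.N x) (Low K t)
    omega
  · simp only [Finset.mem_insert, not_or]
    refine ⟨by rintro rfl; exact not_L_self2 hq1, fun h => hq2 ?_⟩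
    have := hI (Finset.mem_inter.mpr ⟨h, hq1⟩)
    simpa using this

theorem gv_le3 (t x v : ℕ) : gv K t x v ≤ 3 := by
  unfold gv; split_ifs <;> omega

/-- discharging inequality at vertices outside the star of `t` -/
theorem disch (c : Ctx K t t1 h) {x : ℕ} (hx : x ∈ K.Vout t) :
    ∑ y ∈ K.N x, gv K t x y + 48 ≤ 6 * (K.N x).card + ∑ y ∈ K.N x, gv K t y x := by
  by_cases hl : Low K t x
  · have h0 : ∑ y ∈ K.N x, gv K t x y = 0 := by
      refine Finset.sum_eq_zero fun y hy => ?_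
      by_contra hcon
      exact c.low_indep hl hy (gv_low (Nat.pos_of_ne_zero hcon))
    rw [h0]
    have h6 := c.deg6 (mem_Vout.mp hx).2.1
    have h7 := hl.2
    have : (K.N x).card = 6 ∨ (K.N x).card = 7 := by omega
    rcases this with h6 | h7
    · have : ∑ y ∈ K.N x, gv K t y x = ∑ y ∈ K.N x, 2 := by
        refine Finset.sum_congr rfl fun y hy => ?_
        unfold gv
        rw [if_pos ⟨hx, hy⟩, if_pos h6]
      rw [this, Finset.sum_const, h6]; norm_num
    · have : ∑ y ∈ K.N x, gv K t y x = ∑ y ∈ K.N x, if (K.L x y).card = 5 then 3 else 0 := by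
        refine Finset.sum_congr rfl fun y hy => ?_
        unfold gv
        rw [if_pos ⟨hx, hy⟩, if_neg (by omega)]
        simp [h7]
      rw [this, ← Finset.sum_filter, Finset.sum_const, c.d7 h7, h7]; norm_num
  · have h8 : 8 ≤ (K.N x).card := by
      by_contra hcon
      exact hl ⟨hx, by omega⟩
    have key : ∀ k, (∀ y ∈ K.N x, gv K t x y ≤ k) → ∑ y ∈ K.N x, gv K t x y ≤ ((K.N x).filter (Low K t)).card * k := by
      intro k hk
      have : ∑ y ∈ K.N x, gv K t x y ≤ ∑ y ∈ K.N x, if Low K t y then k else 0 := by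
        refine Finset.sum_le_sum fun y hy => ?_
        split_ifs with hy2
        · exact hk y hy
        · by_contra hcon
          exact hy2 (gv_low (x := x) (by omega))
      rw [← Finset.sum_filter, Finset.sum_const, smul_eq_mul] at this
      exact this
    by_cases h3 : ∃ y ∈ K.N x, gv K t x y = 3
    · obtain ⟨y, hy, hy3⟩ := h3
      have := c.taker (show 0 < gv K t x y by omega)
      have h10 := this.2.1 hy3
      have := key 3 fun y _ => gv_le3 t x y
      omega
    · push Not at h3
      by_cases h2 : ∃ y ∈ K.N x, 0 < gv K t x y
      · obtain ⟨y, hy, hy3⟩ := h2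
        have := c.taker hy3
        have := key 2 fun y hy => by have := gv_le3 (K := K) t x y; have := h3 y hy; omega
        omega
      · push Not at h2
        rw [Finset.sum_eq_zero fun y hy => Nat.le_zero.mp (h2 y hy)]
        omega

end Ctx
end SComplex

namespace SComplex
variable {K : SComplex}

/-- neighbours of `u` off the closed star of `tu` -/
def Out (K : SComplex) (t u : ℕ) : Finset ℕ := (K.N u \ K.L t u).erase t
/-- out-neighbours inside the link of `t` -/
def Gr (K : SComplex) (t u : ℕ) : Finset ℕ := K.Out t u ∩ K.N t
/-- weights -/
def om (K : SComplex) (t u : ℕ) : ℕ := ∑ y ∈ K.Out t u, (6 - gv K t u y)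

theorem mem_Out {t u y : ℕ} : y ∈ K.Out t u ↔ y ≠ t ∧ y ∈ K.N u ∧ y ∉ K.L t u := by
  unfold Out; rw [Finset.mem_erase, Finset.mem_sdiff]
theorem mem_Gr {t u y : ℕ} : y ∈ K.Gr t u ↔ y ∈ K.N u ∧ y ∉ K.L t u ∧ y ∈ K.N t := by
  unfold Gr; rw [Finset.mem_inter, mem_Out]
  constructor
  · tauto
  · rintro ⟨h1, h2, h3⟩
    exact ⟨⟨(mem_N.mp h3).1, h1, h2⟩, h3⟩
theorem Gr_symm {t u y : ℕ} (hu : u ∈ K.N t) (h : y ∈ K.Gr t u) : u ∈ K.Gr t y := by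
  rw [mem_Gr] at *
  exact ⟨N_symm.mp h.1, fun h' => h.2.1 (L_rot.mp h'), hu⟩
theorem Gr_Out {t u y : ℕ} (h : y ∈ K.Gr t u) : y ∈ K.Out t u := (Finset.mem_inter.mp h).1
theorem Gr_N {t u y : ℕ} (h : y ∈ K.Gr t u) : y ∈ K.N t := (Finset.mem_inter.mp h).2
theorem gv_N {t u y : ℕ} (h : y ∈ K.N t) : gv K t u y = 0 := by
  unfold gv; rw [if_neg]; intro hc; exact (mem_Vout.mp hc.1).2.2 h

theorem N_card {t u : ℕ} (hu : u ∈ K.N t) : (K.N u).card = 1 + (K.L t u).card + (K.Out t u).card := by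
  have h1 : K.N u = insert t (K.L t u ∪ K.Out t u) := by
    ext y
    rw [Finset.mem_insert, Finset.mem_union, mem_Out]
    constructor
    · intro hy; tauto
    · rintro (rfl | h | h)
      · exact N_symm.mp hu
      · exact L_sub_right h
      · exact h.2.1
  rw [h1, Finset.card_insert_of_notMem, Finset.card_union_of_disjoint]
  · omega
  · rw [Finset.disjoint_left]; intro a ha hb; exact (mem_Out.mp hb).2.2 ha
  · rw [Finset.mem_union, mem_Out, not_or]
    exact ⟨not_L_self1, by tauto⟩

namespace Ctx
variable {t t1 h : ℕ}

/-- flow conservation -/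
theorem flow (c : Ctx K t t1 h) : ∑ x ∈ K.Vout t, ∑ y ∈ K.N x, gv K t y x ≤
    ∑ x ∈ K.Vout t, ∑ y ∈ K.N x, gv K t x y + ∑ u ∈ K.N t, ∑ y ∈ K.Out t u, gv K t u y := by
  have hd : Disjoint (K.Vout t) (K.N t) := by
    rw [Finset.disjoint_left]; intro a ha; exact (mem_Vout.mp ha).2.2
  have h1 : ∀ x ∈ K.Vout t, ∑ y ∈ K.N x, gv K t y x ≤ ∑ y ∈ K.Vout t ∪ K.N t, gv K t y x := by
    intro x hx
    refine Finset.sum_le_sum_of_subset fun y hy => ?_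
    rw [Finset.mem_union]
    by_cases hyt : y ∈ K.N t
    · exact Or.inr hyt
    · refine Or.inl (mem_Vout.mpr ⟨?_, N_vert hy, hyt⟩)
      rintro rfl; exact (mem_Vout.mp hx).2.2 (N_symm.mp hy)
  refine (Finset.sum_le_sum h1).trans ?_
  rw [Finset.sum_comm, Finset.sum_union hd]
  have key : ∀ (y : ℕ) (S : Finset ℕ), (∀ x ∈ K.Vout t, y ∈ K.N x → x ∈ S) → ∑ x ∈ K.Vout t, gv K t y x ≤ ∑ x ∈ S, gv K t y x := by
    intro y S hS
    have : ∑ x ∈ K.Vout t, gv K t y x = ∑ x ∈ (K.Vout t).filter (fun x => y ∈ K.N x), gv K t y x := by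
      rw [Finset.sum_filter]
      refine Finset.sum_congr rfl fun x hx => ?_
      split_ifs with hy
      · rfl
      · unfold gv; rw [if_neg (by tauto)]
    rw [this]
    refine Finset.sum_le_sum_of_subset fun x hx => ?_
    rw [Finset.mem_filter] at hx
    exact hS x hx.1 hx.2
  refine Nat.add_le_add (Finset.sum_le_sum fun y hy => key y _ ?_) (Finset.sum_le_sum fun y hy => key y _ ?_)
  · intro x hx hyx; exact N_symm.mp hyx
  · intro x hx hyx
    refine mem_Out.mpr ⟨(mem_Vout.mp hx).1, N_symm.mp hyx, fun hL => (mem_Vout.mp hx).2.2 (L_sub_left hL)⟩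

theorem vset (c : Ctx K t t1 h) : K.vertexSet = insert t (K.N t ∪ K.Vout t) := by
  ext x
  rw [Finset.mem_insert, Finset.mem_union, mem_Vout]
  constructor
  · intro hx; tauto
  · rintro (rfl | hx | hx)
    · exact c.tV
    · exact N_vert hx
    · exact hx.2.1

theorem reduction (c : Ctx K t t1 h) (hom : 120 ≤ ∑ u ∈ K.N t, om K t u) : 4 * K.vertexSet.card + 3 * h ≤ K.fnum 1 := by
  have hd : Disjoint (K.N t) (K.Vout t) := by
    rw [Finset.disjoint_right]; intro a ha; exact (mem_Vout.mp ha).2.2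
  have ht : t ∉ K.N t ∪ K.Vout t := by
    rw [Finset.mem_union, mem_Vout, not_or]; exact ⟨N_irr, by tauto⟩
  have e1 := two_f1 K
  rw [c.vset, Finset.sum_insert ht, Finset.sum_union hd] at e1
  have e2 : K.vertexSet.card = 1 + (K.N t).card + (K.Vout t).card := by
    rw [c.vset, Finset.card_insert_of_notMem ht, Finset.card_union_of_disjoint hd]; omega
  have e3 : ∑ u ∈ K.N t, (K.N u).card = ∑ u ∈ K.N t, (1 + (K.L t u).card + (K.Out t u).card) :=
    Finset.sum_congr rfl fun u hu => N_card hu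
  rw [Finset.sum_add_distrib, Finset.sum_add_distrib, Finset.sum_const, smul_eq_mul, mul_one] at e3
  have e4 := c.sumt
  have e5 : ∑ u ∈ K.N t, 6 * (K.Out t u).card = ∑ u ∈ K.N t, (om K t u + ∑ y ∈ K.Out t u, gv K t u y) := by
    refine Finset.sum_congr rfl fun u hu => ?_
    unfold om
    rw [← Finset.sum_add_distrib, Finset.sum_congr rfl (fun y _ =>
      Nat.sub_add_cancel ((gv_le3 (K := K) t u y).trans (by norm_num))), Finset.sum_const, smul_eq_mul]
    ring
  rw [← Finset.mul_sum, Finset.sum_add_distrib] at e5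
  have e6 : ∑ x ∈ K.Vout t, (∑ y ∈ K.N x, gv K t x y + 48) ≤
      ∑ x ∈ K.Vout t, (6 * (K.N x).card + ∑ y ∈ K.N x, gv K t y x) :=
    Finset.sum_le_sum fun x hx => c.disch hx
  rw [Finset.sum_add_distrib, Finset.sum_add_distrib, Finset.sum_const, smul_eq_mul, ← Finset.mul_sum] at e6
  have e7 := c.flow
  omega

theorem pairA (c : Ctx K t t1 h) {u z q : ℕ} (hz : z ∉ K.L t u) (h1 : q ∈ K.L u z) (h2 : q ∈ K.L t u) (h3 : q ∈ K.L t z) :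
    q = t1 := by
  by_contra hq
  have hqt : q ≠ t := fun h => by subst h; exact not_L_self1 h2
  have := c.B3 q hqt hq u z t (L_rot'.mp (L_rot'.mp h1)) (L_rot.mp (L_rot'.mp (L_rot'.mp h3))) (L_rot'.mp (L_rot'.mp h2))
  exact hz this.s34.s23.s12.s23.s34.L12

theorem XOut {u z q : ℕ} (hz : z ∉ K.L t u) (h1 : q ∈ K.L u z) (h2 : q ∉ K.L t u) : q ∈ K.Out t u :=
  mem_Out.mpr ⟨fun h => hz (by subst h; exact L_rot'.mp (L_rot'.mp h1)), L_sub_left h1, h2⟩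

theorem om_half {u z : ℕ} (hz : z ∈ K.Gr t u) :
    6 + ∑ q ∈ K.L u z, (if q ∈ K.L t u then 0 else 6 - gv K t u q) ≤ om K t u := by
  have h1 : ∑ q ∈ K.L u z, (if q ∈ K.L t u then 0 else 6 - gv K t u q) = ∑ q ∈ K.L u z \ K.L t u, (6 - gv K t u q) := by
    rw [Finset.sdiff_eq_filter, Finset.sum_filter]
    refine Finset.sum_congr rfl fun q _ => ?_
    split_ifs <;> tauto
  have hz2 := (mem_Gr.mp hz)
  have hsub : insert z (K.L u z \ K.L t u) ⊆ K.Out t u := by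
    intro q hq
    rw [Finset.mem_insert, Finset.mem_sdiff] at hq
    rcases hq with rfl | hq
    · exact Gr_Out hz
    · exact XOut hz2.2.1 hq.1 hq.2
  have h2 : ∑ q ∈ insert z (K.L u z \ K.L t u), (6 - gv K t u q) ≤ om K t u := Finset.sum_le_sum_of_subset hsub
  rw [Finset.sum_insert (by rw [Finset.mem_sdiff]; exact fun h => not_L_self2 h.1), gv_N hz2.2.2] at h2
  rw [h1]; exact h2

theorem edge_gen (c : Ctx K t t1 h) {u z : ℕ} (hu : u ∈ K.N t) (hz : z ∈ K.Gr t u) :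
    12 + 6 * ((K.L u z) \ (({t1} : Finset ℕ) ∩ K.L t u ∩ K.L t z)).card ≤ om K t u + om K t z := by
  have h1 := om_half hz
  have h2 := om_half (Gr_symm hu hz)
  rw [L_comm z u] at h2
  have hz2 := (mem_Gr.mp hz)
  have h3 : ∑ q ∈ K.L u z, (if q ∈ ({t1} : Finset ℕ) ∩ K.L t u ∩ K.L t z then 0 else 6) ≤
      ∑ q ∈ K.L u z, ((if q ∈ K.L t u then 0 else 6 - gv K t u q) + (if q ∈ K.L t z then 0 else 6 - gv K t z q)) := by
    refine Finset.sum_le_sum fun q hq => ?_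
    have g1 := gv_le3 (K := K) t u q
    have g2 := gv_le3 (K := K) t z q
    by_cases a : q ∈ K.L t u <;> by_cases b : q ∈ K.L t z
    · have := c.pairA hz2.2.1 hq a b
      subst this
      simp [a, b]
    · simp [a, b, gv_N (L_sub_left a)]
    · simp [a, b, gv_N (L_sub_left b)]
    · simp only [a, b, Finset.mem_inter, and_false, if_false]; omega
  have h4 : ∑ q ∈ K.L u z, (if q ∈ ({t1} : Finset ℕ) ∩ K.L t u ∩ K.L t z then 0 else 6) =
      6 * ((K.L u z) \ (({t1} : Finset ℕ) ∩ K.L t u ∩ K.L t z)).card := by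
    rw [Finset.sdiff_eq_filter, Finset.card_filter, Finset.mul_sum]
    refine Finset.sum_congr rfl fun q _ => ?_
    split_ifs <;> tauto
  rw [h4, Finset.sum_add_distrib] at h3
  omega

theorem edge30 (c : Ctx K t t1 h) {u z : ℕ} (hu : u ∈ K.N t) (hz : z ∈ K.Gr t u) : 30 ≤ om K t u + om K t z := by
  have h1 := c.edge_gen hu hz
  have h2 := c.B1 u z (mem_Gr.mp hz).1
  have h3 := Finset.le_card_sdiff (({t1} : Finset ℕ) ∩ K.L t u ∩ K.L t z) (K.L u z)
  have h4 : (({t1} : Finset ℕ) ∩ K.L t u ∩ K.L t z).card ≤ 1 :=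
    (Finset.card_le_card (Finset.inter_subset_left.trans Finset.inter_subset_left)).trans (by simp)
  omega

theorem edge36 (c : Ctx K t t1 h) {u z : ℕ} (hu : u ∈ K.N t) (hz : z ∈ K.Gr t u)
    (hb : ¬ (t1 ∈ K.L t u ∧ t1 ∈ K.L t z)) : 36 ≤ om K t u + om K t z := by
  have h1 := c.edge_gen hu hz
  have h2 := c.B1 u z (mem_Gr.mp hz).1
  have h4 : (({t1} : Finset ℕ) ∩ K.L t u ∩ K.L t z) = ∅ := by
    ext q
    simp only [Finset.mem_inter, Finset.mem_singleton, Finset.notMem_empty, iff_false]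
    rintro ⟨⟨rfl, k1⟩, k2⟩; exact hb ⟨k1, k2⟩
  rw [h4, Finset.sdiff_empty] at h1
  omega

theorem j_ge (c : Ctx K t t1 h) {u : ℕ} (hu : u ∈ K.N t) : ∃ z, z ∈ K.Gr t u := by
  obtain ⟨z, h1, h2, h3⟩ := c.B2 t u hu
  exact ⟨z, mem_Gr.mpr ⟨h2, h3, h1⟩⟩

theorem j_le (c : Ctx K t t1 h) {u : ℕ} (hu : u ∈ K.N t) : (K.Gr t u).card + 5 ≤ (K.N t).card := by
  have h1 : insert u (K.Gr t u ∪ K.L t u) ⊆ K.N t := by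
    intro y
    rw [Finset.mem_insert, Finset.mem_union, mem_Gr]
    rintro (rfl | h | h)
    · exact hu
    · exact h.2.2
    · exact L_sub_left h
  have h2 := Finset.card_le_card h1
  rw [Finset.card_insert_of_notMem, Finset.card_union_of_disjoint] at h2
  · have := c.B1 t u hu
    omega
  · rw [Finset.disjoint_left]; intro a ha hb; exact (mem_Gr.mp ha).2.1 hb
  · rw [Finset.mem_union, mem_Gr, not_or]
    exact ⟨fun h => N_irr h.1, not_L_self2⟩

theorem om_eq {u : ℕ} : om K t u = 6 * (K.Gr t u).card + ∑ y ∈ K.Out t u \ K.N t, (6 - gv K t u y) := by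
  unfold om Gr
  rw [← Finset.sum_inter_add_sum_sdiff (K.Out t u) (K.N t)]
  congr 1
  rw [Finset.sum_congr rfl (g := fun _ => 6), Finset.sum_const, smul_eq_mul, mul_comm]
  intro y hy
  rw [gv_N (Finset.mem_inter.mp hy).2]

theorem om_sub {u : ℕ} {T : Finset ℕ} (hT : T ⊆ K.Out t u \ K.N t) :
    6 * (K.Gr t u).card + ∑ y ∈ T, (6 - gv K t u y) ≤ om K t u := by
  rw [om_eq]
  have := Finset.sum_le_sum_of_subset (f := fun y => 6 - gv K t u y) hT
  omega

theorem om_sub3 {u : ℕ} {T : Finset ℕ} (hT : T ⊆ K.Out t u \ K.N t) :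
    6 * (K.Gr t u).card + 3 * T.card ≤ om K t u := by
  have h1 := om_sub hT
  have h2 : ∑ y ∈ T, 3 ≤ ∑ y ∈ T, (6 - gv K t u y) := Finset.sum_le_sum fun y _ => by
    have := gv_le3 (K := K) t u y
    omega
  rw [Finset.sum_const, smul_eq_mul] at h2
  omega

theorem Out_card {u : ℕ} : (K.Out t u).card = (K.Gr t u).card + (K.Out t u \ K.N t).card := by
  unfold Gr
  rw [Finset.card_inter_add_card_sdiff]

theorem om3 {u : ℕ} : 3 * ((K.Gr t u).card + (K.Out t u).card) ≤ om K t u := by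
  have h1 := om_sub3 (K := K) (t := t) (u := u) (Finset.Subset.refl _)
  have h2 := Out_card (K := K) (t := t) (u := u)
  omega

end Ctx
end SComplex

namespace SComplex
variable {K : SComplex}
namespace Ctx
variable {t t1 h : ℕ}

theorem jz {u z : ℕ} (hu : u ∈ K.N t) (hz : z ∈ K.Gr t u) :
    ((K.L u z ∩ K.L t u) \ K.L t z).card + 1 ≤ (K.Gr t z).card := by
  have hsub : insert u ((K.L u z ∩ K.L t u) \ K.L t z) ⊆ K.Gr t z := by
    intro q
    rw [Finset.mem_insert, Finset.mem_sdiff, Finset.mem_inter]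
    rintro (rfl | h)
    · exact Gr_symm hu hz
    · exact mem_Gr.mpr ⟨L_sub_right h.1.1, h.2, L_sub_left h.1.2⟩
  have := Finset.card_le_card hsub
  rwa [Finset.card_insert_of_notMem] at this
  rw [Finset.mem_sdiff, Finset.mem_inter]
  exact fun h => not_L_self1 h.1.1

theorem type2 (c : Ctx K t t1 h) {u v z : ℕ} (hu : u ∈ K.N t) (hu1 : u ≠ t1) (hO : K.Out t u = {v, z})
    (hg : 0 < gv K t u v) (hz : z ∈ K.N t) : z = t1 ∧ 6 ≤ (K.Gr t t1).card := by
  have hut : u ≠ t := by rintro rfl; exact N_irr hu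
  have hvV := (gv_pos hg).1
  have huv := (gv_pos hg).2.1
  have hvt : v ∉ K.N t := (mem_Vout.mp hvV).2.2
  have hzO : z ∈ K.Out t u := by rw [hO]; simp
  have hzG : z ∈ K.Gr t u := Finset.mem_inter.mpr ⟨hzO, hz⟩
  have hzL : z ∉ K.L t u := (mem_Out.mp hzO).2.2
  have hN : ∀ y ∈ K.N u, y = t ∨ y = v ∨ y = z ∨ y ∈ K.L t u := by
    intro y hy
    by_contra hc
    push Not at hc
    have : y ∈ K.Out t u := mem_Out.mpr ⟨hc.1, hy, hc.2.2.2⟩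
    rw [hO] at this
    simp at this
    tauto
  have htv : t ∉ K.L u v := fun h' => hvt (N_symm.mp (L_sub_right h'))
  have htz : t ∉ K.L u z := fun h' => hzL (L_rot'.mp (L_rot'.mp h'))
  obtain ⟨u', g1, g2, g3⟩ := c.B2 v u huv
  have hu't : u' ≠ t := by rintro rfl; exact hvt (N_symm.mp g1)
  have hu'v : u' ≠ v := by rintro rfl; exact N_irr g1
  have hu'u : u' ≠ u := by rintro rfl; exact N_irr g2
  have hI := c.taker_inter hg g1 hu'u g3
  rw [L_comm v u] at g3
  have B3u := c.B3' u hut hu1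
  have clos : z ∉ K.L u v → K.L t u ⊆ K.L u v := by
    intro hzv
    have hsub : K.L u v ⊆ K.L u t := by
      intro y hy
      rcases hN y (L_sub_left hy) with rfl | rfl | rfl | h'
      · exact absurd hy htv
      · exact absurd hy not_L_self2
      · exact absurd hy hzv
      · rw [L_comm]; exact h'
    have hne : (K.L u v).Nonempty := by
      rw [← Finset.card_pos]; have := c.B1 u v (N_symm.mp huv); omega
    obtain ⟨a0, ha0⟩ := hne
    have key := c.np.ecycle (x := u) (y := t) (fun a => a ∈ K.L u v) t ⟨a0, hsub ha0, ha0⟩ htv (by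
      intro a b ha hab
      left
      have e1 := B3u v a ha
      have e2 := B3u t a (hsub ha)
      have e3 := Finset.eq_of_subset_of_card_le (Finset.inter_subset_inter_right (u := K.L u a) hsub) (by omega)
      have hb : b ∈ K.L u t ∩ K.L u a := Finset.mem_inter.mpr ⟨hab.s34.L12, hab.s23.s34.L12⟩
      rw [← e3] at hb
      exact (Finset.mem_inter.mp hb).1)
    intro b hb
    rw [L_comm] at hb
    rcases key b hb with h' | rfl
    · exact h'
    · exact absurd hb not_L_self2
  have hu'C : u' ∈ K.L t u := by
    rcases hN u' g2 with h' | h' | rfl | h'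
    · exact absurd h' hu't
    · exact absurd h' hu'v
    · exfalso
      have hsub : K.L u u' ⊆ {t1} := by
        intro y hy
        refine hI (Finset.mem_inter.mpr ⟨clos g3 ?_, hy⟩)
        rcases hN y (L_sub_left hy) with rfl | rfl | rfl | h'
        · exact absurd hy htz
        · exact absurd (L_rot.mp hy) g3
        · exact absurd hy not_L_self2
        · exact h'
      have := Finset.card_le_card hsub
      have := c.B1 u u' g2
      simp at *
      omega
    · exact h'
  have hzv : z ∈ K.L u v := by
    by_contra hc
    exact g3 (clos hc hu'C)
  have hzu' : z ∈ K.L u u' := by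
    by_contra hc
    have e1 := B3u t u' (by rw [L_comm]; exact hu'C)
    have hsub : K.L u u' ⊆ insert t (K.L u t ∩ K.L u u') := by
      intro y hy
      rw [Finset.mem_insert, Finset.mem_inter]
      rcases hN y (L_sub_left hy) with rfl | rfl | rfl | h'
      · exact Or.inl rfl
      · exact absurd (L_rot.mp hy) g3
      · exact absurd hy hc
      · rw [L_comm u t]; exact Or.inr ⟨h', hy⟩
    have e2 := (Finset.card_le_card hsub).trans (Finset.card_insert_le _ _)
    have := c.B1 u u' g2
    omega
  have hz1 : z = t1 := by simpa using hI (Finset.mem_inter.mpr ⟨hzv, hzu'⟩)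
  refine ⟨hz1, ?_⟩
  rw [← hz1]
  have e0 := jz hu hzG
  have e1 := B3u u' z hzu'
  have e2 := B3u v z hzv
  have hsub : insert u' ((K.L u u' ∩ K.L u z) ∪ (K.L u v ∩ K.L u z)) ⊆ (K.L u z ∩ K.L t u) \ K.L t z := by
    have mk : ∀ y, y ∈ K.L u z → y ≠ v → y ∈ (K.L u z ∩ K.L t u) \ K.L t z := by
      intro y hy hyv
      have h2 : y ∈ K.L t u := by
        rcases hN y (L_sub_left hy) with rfl | rfl | rfl | h'
        · exact absurd hy htz
        · exact absurd rfl hyv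
        · exact absurd hy not_L_self2
        · exact h'
      rw [Finset.mem_sdiff, Finset.mem_inter]
      refine ⟨⟨hy, h2⟩, fun h3 => ?_⟩
      have := c.pairA hzL hy h2 h3
      rw [← hz1] at this
      rw [this] at hy
      exact not_L_self2 hy
    intro y
    rw [Finset.mem_insert, Finset.mem_union, Finset.mem_inter, Finset.mem_inter]
    rintro (rfl | h' | h')
    · exact mk _ (L_rot.mp hzu') hu'v
    · refine mk _ h'.2 ?_
      rintro rfl; exact g3 (L_rot.mp h'.1)
    · refine mk _ h'.2 ?_
      rintro rfl; exact not_L_self2 h'.1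
  have e3 := Finset.card_le_card hsub
  rw [Finset.card_insert_of_notMem, Finset.card_union_of_disjoint] at e3
  · omega
  · rw [Finset.disjoint_left]
    intro q hq hq'
    rw [Finset.mem_inter] at hq hq'
    have := hI (Finset.mem_inter.mpr ⟨hq'.1, hq.1⟩)
    rw [Finset.mem_singleton, ← hz1] at this
    rw [this] at hq
    exact not_L_self2 hq.2
  · rw [Finset.mem_union, Finset.mem_inter, Finset.mem_inter]
    rintro (h' | h')
    · exact not_L_self2 h'.1
    · exact g3 h'.1

/-- special out-neighbours -/
def Sp (K : SComplex) (t z : ℕ) : Finset ℕ := (K.Gr t z).filter (fun u => K.L u z ⊆ K.L t u)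

theorem G2 (c : Ctx K t t1 h) {z : ℕ} (hz : z ∈ K.N t) (hS : (Sp K t z).Nonempty) :
    (Sp K t z).card + 2 ≤ (K.Gr t z).card := by
  by_contra hcon
  have hle : Sp K t z ⊆ K.Gr t z := Finset.filter_subset _ _
  have hc1 : (K.Gr t z \ Sp K t z).card ≤ 1 := by
    have := Finset.card_sdiff_add_card_eq_card hle
    omega
  have htz : t ∈ K.N z := N_symm.mp hz
  have hztn : z ≠ t := by rintro rfl; exact N_irr hz
  have hzS : z ∉ Sp K t z := fun h' => N_irr (mem_Gr.mp (hle h')).1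
  have htS : t ∉ Sp K t z := fun h' => N_irr (mem_Gr.mp (hle h')).2.2
  obtain ⟨q, hqt, hqS, hq⟩ : ∃ q, q ≠ t ∧ q ∉ Sp K t z ∧ ∀ y ∈ K.Gr t z, y ∈ Sp K t z ∨ y = q := by
    rcases (K.Gr t z \ Sp K t z).eq_empty_or_nonempty with he | ⟨q, hq⟩
    · refine ⟨z, hztn, hzS, fun y hy => ?_⟩
      by_contra hc
      push Not at hc
      have : y ∈ K.Gr t z \ Sp K t z := Finset.mem_sdiff.mpr ⟨hy, hc.1⟩
      rw [he] at this; simp at this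
    · have hq' := Finset.mem_sdiff.mp hq
      refine ⟨q, ?_, hq'.2, fun y hy => ?_⟩
      · rintro rfl; exact N_irr (Gr_N hq'.1)
      · by_contra hc
        push Not at hc
        exact hc.2 (Finset.card_le_one.mp hc1 y (Finset.mem_sdiff.mpr ⟨hy, hc.1⟩) q hq)
  have nb0 : ∀ u ∈ Sp K t z, ∀ y ∈ K.L z u, y ∈ Sp K t z ∨ y = q ∨ (y = t1 ∧ t1 ∈ K.L t z) := by
    intro u hu y hy
    have hu2 := (Finset.mem_filter.mp hu).2
    have huG := mem_Gr.mp (hle hu)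
    have hyu : y ∈ K.L u z := by rw [L_comm]; exact hy
    have hyt := hu2 hyu
    by_cases hyz : y ∈ K.L t z
    · have hzu : z ∉ K.L t u := fun h' => huG.2.1 (L_rot.mp h')
      have := c.pairA hzu hyu hyt hyz
      subst this
      exact Or.inr (Or.inr ⟨rfl, hyz⟩)
    · have := hq y (mem_Gr.mpr ⟨L_sub_left hy, hyz, L_sub_left hyt⟩)
      tauto
  have step1 : ∀ u ∈ Sp K t z, t1 ∈ K.L z u → t1 ∈ K.L t z → False := by
    intro u hu h1 h2
    have h3 : u ∈ K.L t1 z := by rw [L_comm]; exact L_rot.mp h1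
    have := c.np.ecycle (x := t1) (y := z) (fun a => a ∈ Sp K t z) q ⟨u, h3, hu⟩ hqS (by
      intro a b ha hab
      have hb : b ∈ K.L z a := hab.s12.s23.s34.L12
      rcases nb0 a ha b hb with h' | h' | h'
      · exact Or.inl h'
      · exact Or.inr h'
      · exfalso
        have : b ∈ K.L t1 z := hab.s34.L12
        rw [h'.1] at this
        exact not_L_self1 this) t (by rw [L_comm]; exact L_rot'.mp h2)
    rcases this with h' | h'
    · exact htS h'
    · exact hqt h'.symm
  have nb : ∀ u ∈ Sp K t z, ∀ y ∈ K.L z u, y ∈ Sp K t z ∨ y = q := by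
    intro u hu y hy
    rcases nb0 u hu y hy with h' | h' | h'
    · exact Or.inl h'
    · exact Or.inr h'
    · exfalso
      have h2 := h'.1
      subst h2
      exact step1 u hu hy h'.2
  obtain ⟨u0, hu0⟩ := hS
  have fin := c.np.vconn (x := z) (fun y => y ∈ Sp K t z ∨ (y = q ∧ ∃ u ∈ Sp K t z, u ∈ K.L z q))
    ⟨u0, (mem_Gr.mp (hle hu0)).1, Or.inl hu0⟩ (by
      intro a b ha hb
      rcases ha with ha | ⟨rfl, u, hu, huq⟩
      · rcases nb a ha b hb with h' | h'
        · exact Or.inl h'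
        · subst h'
          exact Or.inr ⟨rfl, a, ha, L_rot.mp hb⟩
      · have := c.np.ecycle (x := a) (y := z) (fun a => a ∈ Sp K t z) z ⟨u, by rw [L_comm]; exact huq, hu⟩ hzS (by
          intro a' b' ha' hab
          rcases nb a' ha' b' hab.s12.s23.s34.L12 with h' | h'
          · exact Or.inl h'
          · exfalso
            have hh : b' ∈ K.L a z := hab.s34.L12
            rw [h'] at hh
            exact not_L_self1 hh) b (by rw [L_comm]; exact hb)
        rcases this with h' | h'
        · exact Or.inl h'
        · exfalso; subst h'; exact not_L_self1 hb) t htz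
  rcases fin with h' | h'
  · exact htS h'
  · exact hqt h'.1.symm

end Ctx
end SComplex

namespace SComplex
variable {K : SComplex}
namespace Ctx
variable {t t1 h : ℕ}

theorem gv_pair (c : Ctx K t t1 h) {u z e : ℕ} (he : e ∈ K.L u z) : gv K t z e + 2 * gv K t u e ≤ 6 := by
  have a1 := gv_le3 (K := K) t z e
  have a2 := gv_le3 (K := K) t u e
  by_cases h1 : 0 < gv K t u e
  · have hl := gv_low h1
    have het := (mem_Vout.mp hl.1).1
    have he1 := c.low_ne hl
    by_cases h2 : 0 < gv K t z e
    · rcases (gv_pos h1).2.2 with ⟨b1, b2⟩ | ⟨b1, b2, b3⟩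
      · rcases (gv_pos h2).2.2 with ⟨b4, b5⟩ | ⟨b4, b5⟩
        · omega
        · omega
      · rcases (gv_pos h2).2.2 with ⟨b4, b5⟩ | ⟨b4, b5, b6⟩
        · omega
        · exfalso
          have e1 := c.B3' e het he1 u z (L_rot.mp (L_rot'.mp (L_rot'.mp (L_rot.mp (L_rot'.mp he)))))
          have e2 := Finset.card_union_add_card_inter (K.L e u) (K.L e z)
          have e3 : (K.L e u ∪ K.L e z).card ≤ (K.N e).card :=
            Finset.card_le_card (Finset.union_subset (fun z hz => L_sub_left hz) (fun z hz => L_sub_left hz))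
          omega
    · omega
  · omega

/-- a local case analysis used when the link of `t` has eight vertices -/
theorem case8 (c : Ctx K t t1 h) (hn : (K.N t).card = 8) {u z : ℕ} (hu : u ∈ K.N t) (hz : z ∈ K.Gr t u)
    (hom : om K t u < 15) : 12 ≤ om K t u ∧ (24 ≤ om K t z ∨
      ((K.Gr t z).card = 2 ∧ (K.Gr t u).card = 1 ∧ 18 + 2 * (15 - om K t u) ≤ om K t z) ∨
      ((K.Gr t z).card = 3 ∧ (K.Gr t z).erase u ⊆ K.L u z ∧ t1 ∈ K.L u z ∧ t1 ∈ K.L t z ∧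
        (((K.Gr t u).card = 1 ∧ 21 ≤ om K t z) ∨ ((K.Gr t u).card = 2 ∧ 18 ≤ om K t z)))) := by
  have hz' := mem_Gr.mp hz
  have hzN := hz'.2.2
  have huz := Gr_symm hu hz
  have ju : 1 ≤ (K.Gr t u).card := Finset.card_pos.mpr ⟨z, hz⟩
  have jzz : (K.Gr t z).card ≤ 3 := by have := c.j_le hzN; omega
  have o3 := om3 (K := K) (t := t) (u := u)
  have oz3 := om3 (K := K) (t := t) (u := z)
  have oc := Out_card (K := K) (t := t) (u := u)
  have ocz := Out_card (K := K) (t := t) (u := z)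
  have hX := c.B1 u z hz'.1
  have hj := jz hu hz
  have hA1 := Finset.card_inter_add_card_sdiff (K.L u z) (K.L t u)
  have hA2 := Finset.card_inter_add_card_sdiff (K.L u z ∩ K.L t u) (K.L t z)
  have hXO : insert z (K.L u z \ K.L t u) ⊆ K.Out t u := by
    intro q
    rw [Finset.mem_insert, Finset.mem_sdiff]
    rintro (rfl | h')
    · exact Gr_Out hz
    · exact XOut hz'.2.1 h'.1 h'.2
  have hXOc := Finset.card_le_card hXO
  rw [Finset.card_insert_of_notMem (by rw [Finset.mem_sdiff]; exact fun h' => not_L_self2 h'.1)] at hXOc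
  -- when `u` has a single out-neighbour in the link
  have hone : (K.Gr t u).card = 1 → K.L u z \ K.L t u ⊆ K.Out t u \ K.N t ∧ K.L u z \ K.L t u ⊆ K.Out t z \ K.N t := by
    intro h1
    have hG : K.Gr t u = {z} := by
      obtain ⟨a, ha⟩ := Finset.card_eq_one.mp h1
      rw [ha] at hz ⊢
      rw [Finset.mem_singleton.mp hz]
    have hnot : ∀ q ∈ K.L u z \ K.L t u, q ∉ K.N t := by
      intro q hq hqt
      have : q ∈ K.Gr t u := Finset.mem_inter.mpr ⟨hXO (Finset.mem_insert_of_mem hq), hqt⟩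
      rw [hG, Finset.mem_singleton] at this
      subst this
      exact not_L_self2 (Finset.mem_sdiff.mp hq).1
    constructor
    · intro q hq
      exact Finset.mem_sdiff.mpr ⟨hXO (Finset.mem_insert_of_mem hq), hnot q hq⟩
    · intro q hq
      refine Finset.mem_sdiff.mpr ⟨?_, hnot q hq⟩
      refine XOut (u := z) (z := u) (mem_Gr.mp huz).2.1 (by rw [L_comm]; exact (Finset.mem_sdiff.mp hq).1) ?_
      exact fun h' => hnot q hq (L_sub_left h')
  by_cases hAB : (K.L u z ∩ K.L t u) ∩ K.L t z = ∅
  · rw [hAB, Finset.card_empty] at hA2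
    have h1 : (K.Gr t u).card = 1 := by omega
    have h2 := om_sub3 (hone h1).2
    refine ⟨by omega, Or.inl (by omega)⟩
  · obtain ⟨q, hq⟩ := Finset.nonempty_iff_ne_empty.mpr hAB
    have hAB1 : (K.L u z ∩ K.L t u) ∩ K.L t z ⊆ {t1} := by
      intro q hq
      rw [Finset.mem_inter, Finset.mem_inter] at hq
      rw [Finset.mem_singleton]
      exact c.pairA hz'.2.1 hq.1.1 hq.1.2 hq.2
    have hq1 := hAB1 hq
    rw [Finset.mem_singleton] at hq1
    subst hq1
    rw [Finset.mem_inter, Finset.mem_inter] at hq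
    have hABc := Finset.card_le_card hAB1
    rw [Finset.card_singleton] at hABc
    have huq : u ≠ q := by rintro rfl; exact not_L_self1 hq.1.1
    have h12 : 12 ≤ om K t u := by
      by_cases hj2 : 2 ≤ (K.Gr t u).card
      · omega
      by_cases hO3 : 3 ≤ (K.Out t u).card
      · omega
      have hc2 : (K.Out t u \ K.N t).card = 1 := by omega
      obtain ⟨v, hv⟩ := Finset.card_eq_one.mp hc2
      have e1 := om_eq (K := K) (t := t) (u := u)
      rw [hv, Finset.sum_singleton] at e1
      by_cases hg : 0 < gv K t u v
      · exfalso
        have hO : K.Out t u = {v, z} := by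
          symm
          refine Finset.eq_of_subset_of_card_le ?_ ?_
          · intro y
            rw [Finset.mem_insert, Finset.mem_singleton]
            rintro (rfl | rfl)
            · have : y ∈ K.Out t u \ K.N t := by rw [hv]; simp
              exact (Finset.mem_sdiff.mp this).1
            · exact Gr_Out hz
          · rw [Finset.card_pair]
            · omega
            · rintro rfl
              exact (mem_Vout.mp (gv_pos hg).1).2.2 hzN
        have := c.type2 hu huq hO hg hzN
        rw [← this.1] at this
        omega
      · omega
    refine ⟨h12, ?_⟩
    by_cases hA : 2 ≤ ((K.L u z ∩ K.L t u) \ K.L t z).card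
    · right; right
      have j3 : (K.Gr t z).card = 3 := by omega
      refine ⟨j3, ?_, hq.1.1, hq.2, ?_⟩
      · have hsub : (K.L u z ∩ K.L t u) \ K.L t z ⊆ (K.Gr t z).erase u := by
          intro y hy
          rw [Finset.mem_sdiff, Finset.mem_inter] at hy
          rw [Finset.mem_erase]
          refine ⟨?_, mem_Gr.mpr ⟨L_sub_right hy.1.1, hy.2, L_sub_left hy.1.2⟩⟩
          rintro rfl; exact not_L_self1 hy.1.1
        have he := Finset.eq_of_subset_of_card_le hsub (by rw [Finset.card_erase_of_mem huz]; omega)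
        rw [← he]
        intro y hy
        rw [Finset.mem_sdiff, Finset.mem_inter] at hy
        exact hy.1.1
      · by_cases h1 : (K.Gr t u).card = 1
        · left
          refine ⟨h1, ?_⟩
          have h2 := om_sub3 (hone h1).2
          omega
        · right
          exact ⟨by omega, by omega⟩
    · have h1 : (K.Gr t u).card = 1 := by omega
      have h2 := om_sub3 (hone h1).2
      have h3 := om_sub (hone h1).2
      have heq := Finset.eq_of_subset_of_card_le (hone h1).1 (by omega)
      have h4 := om_eq (K := K) (t := t) (u := u)
      rw [← heq] at h4
      have h5 : ∑ y ∈ K.L u z \ K.L t u, (18 : ℕ) ≤ ∑ y ∈ K.L u z \ K.L t u, ((6 - gv K t z y) + 2 * (6 - gv K t u y) + 6) := by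
        refine Finset.sum_le_sum fun y hy => ?_
        have := c.gv_pair (Finset.mem_sdiff.mp hy).1
        have a1 := gv_le3 (K := K) t z y
        have a2 := gv_le3 (K := K) t u y
        omega
      rw [Finset.sum_const, Finset.sum_add_distrib, Finset.sum_add_distrib, ← Finset.mul_sum, Finset.sum_const, smul_eq_mul, smul_eq_mul] at h5
      have h6 : (K.L u z \ K.L t u).card = 2 := by omega
      rw [h6] at h5
      by_cases j3 : (K.Gr t z).card = 3
      · left; omega
      · right; left
        have j2 : (K.Gr t z).card = 2 := by omega
        exact ⟨j2, h1, by omega⟩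

/-- the amount requested by `u` from each out-neighbour in the link -/
def pay (K : SComplex) (t u : ℕ) : ℕ := if (K.Gr t u).card = 1 then 2 * (15 - om K t u) else 15 - om K t u

theorem pay_sum (c : Ctx K t t1 h) {u : ℕ} (hu : u ∈ K.N t) : (K.Gr t u).card * pay K t u = 2 * (15 - om K t u) := by
  obtain ⟨z, hz⟩ := c.j_ge hu
  have ju : 1 ≤ (K.Gr t u).card := Finset.card_pos.mpr ⟨z, hz⟩
  unfold pay
  split_ifs with h1
  · rw [h1, one_mul]
  · have h2 := om3 (K := K) (t := t) (u := u)
    have h3 := Out_card (K := K) (t := t) (u := u)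
    by_cases h4 : (K.Gr t u).card = 2
    · rw [h4]
    · have : 15 - om K t u = 0 := by omega
      rw [this, mul_zero, mul_zero]

/-- not all three out-neighbours are deficient -/
theorem no_three (c : Ctx K t t1 h) {z u a b : ℕ} (hzt : z ≠ t) (hz1 : z ≠ t1) (hab : a ≠ b) (hua : u ≠ a) (hub : u ≠ b)
    (h1 : t1 ∈ K.L u z) (h2 : a ∈ K.L u z) (h3 : b ∈ K.L u z) (h4 : t1 ∈ K.L a z) (h5 : b ∈ K.L a z)
    (h6 : t1 ∈ K.L b z) : False := by
  have ha1 : a ≠ t1 := by rintro rfl; exact not_L_self1 h4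
  have hb1 : b ≠ t1 := by rintro rfl; exact not_L_self1 h6
  have h0 := c.B1 u z (L_sub_right (L_rot'.mp h1) |> N_symm.mp |> fun _ => L_N h1)
  have ea : K.L z u ∩ K.L z a = {t1, b} := by
    symm
    refine Finset.eq_of_subset_of_card_le ?_ ?_
    · intro y
      rw [Finset.mem_insert, Finset.mem_singleton, L_comm z u, L_comm z a, Finset.mem_inter]
      rintro (rfl | rfl)
      · exact ⟨h1, h4⟩
      · exact ⟨h3, h5⟩
    · rw [c.B3' z hzt hz1 u a (by rw [L_comm]; exact h2), Finset.card_pair hb1.symm]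
  have eb : K.L z u ∩ K.L z b = {t1, a} := by
    symm
    refine Finset.eq_of_subset_of_card_le ?_ ?_
    · intro y
      rw [Finset.mem_insert, Finset.mem_singleton, L_comm z u, L_comm z b, Finset.mem_inter]
      rintro (rfl | rfl)
      · exact ⟨h1, h6⟩
      · exact ⟨h2, by rw [L_comm] at h5 ⊢; exact L_rot.mp h5⟩
    · rw [c.B3' z hzt hz1 u b (by rw [L_comm]; exact h3), Finset.card_pair ha1.symm]
  have key := c.np.ecycle (x := z) (y := u) (fun y => y = a ∨ y = b) t1 ⟨a, by rw [L_comm]; exact h2, Or.inl rfl⟩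
    (by rintro (h' | h') <;> [exact ha1 h'.symm; exact hb1 h'.symm]) (by
      intro p q hp hpq
      have hq : q ∈ K.L z u ∩ K.L z p := Finset.mem_inter.mpr ⟨hpq.s34.L12, hpq.s23.s34.L12⟩
      rcases hp with rfl | rfl
      · rw [ea, Finset.mem_insert, Finset.mem_singleton] at hq; tauto
      · rw [eb, Finset.mem_insert, Finset.mem_singleton] at hq; tauto)
  have hsub : K.L u z ⊆ {a, b, t1} := by
    intro y hy
    rw [L_comm] at hy
    have := key y hy
    simp only [Finset.mem_insert, Finset.mem_singleton]
    tauto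
  have := (Finset.card_le_card hsub).trans Finset.card_le_three
  omega

theorem pay_le (c : Ctx K t t1 h) (hn : (K.N t).card = 8) {z : ℕ} (hz : z ∈ K.N t) :
    ∑ u ∈ K.Gr t z, pay K t u + 30 ≤ 2 * om K t z + 2 * (15 - om K t z) := by
  have hpay : ∀ u, om K t u ≥ 15 → pay K t u = 0 := by
    intro u hu; unfold pay; split_ifs <;> omega
  by_cases hd : ∃ u ∈ K.Gr t z, om K t u < 15
  · have cs : ∀ u ∈ K.Gr t z, om K t u < 15 → _ := fun u hu ho => c.case8 hn (Gr_N hu) (Gr_symm hz hu) ho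
    have p6 : ∀ u ∈ K.Gr t z, pay K t u ≤ 6 := by
      intro u hu
      by_cases ho : om K t u < 15
      · have := (cs u hu ho).1
        unfold pay; split_ifs <;> omega
      · rw [hpay u (by omega)]; omega
    have jz3 : (K.Gr t z).card ≤ 3 := by have := c.j_le hz; omega
    by_cases h24 : 24 ≤ om K t z
    · have := Finset.sum_le_card_nsmul _ (fun u => pay K t u) _ p6
      rw [smul_eq_mul] at this
      omega
    obtain ⟨u0, hu0, ho0⟩ := hd
    have h18 : 18 ≤ om K t z := by
      rcases (cs u0 hu0 ho0).2 with h' | h' | h'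
      · omega
      · omega
      · rcases h'.2.2.2.2 with h'' | h'' <;> omega
    have hle : ∀ u ∈ K.Gr t z, 2 * pay K t u + 30 ≤ 2 * om K t z := by
      intro u hu
      by_cases ho : om K t u < 15
      · have hc := cs u hu ho
        rcases hc.2 with h' | h' | h'
        · omega
        · unfold pay; rw [if_pos h'.2.1]; omega
        · rcases h'.2.2.2.2 with h'' | h''
          · unfold pay; rw [if_pos h''.1]; omega
          · unfold pay; rw [if_neg (by omega)]; omega
      · rw [hpay u (by omega)]; omega
    have two : ∀ T ⊆ K.Gr t z, T.card = 2 → ∑ u ∈ T, pay K t u + 30 ≤ 2 * om K t z := by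
      intro T hT h2
      have : ∑ u ∈ T, (2 * pay K t u + 30) ≤ ∑ u ∈ T, 2 * om K t z :=
        Finset.sum_le_sum fun u hu => hle u (hT hu)
      rw [Finset.sum_add_distrib, ← Finset.mul_sum, Finset.sum_const, Finset.sum_const, smul_eq_mul, smul_eq_mul, h2] at this
      omega
    by_cases j2 : (K.Gr t z).card = 2
    · have := two _ (Finset.Subset.refl _) j2
      omega
    · have j3 : (K.Gr t z).card = 3 := by
        rcases (cs u0 hu0 ho0).2 with h' | h' | h'
        · omega
        · omega
        · omega
      by_cases hall : ∀ u ∈ K.Gr t z, om K t u < 15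
      · exfalso
        have cs3 : ∀ u ∈ K.Gr t z, (K.Gr t z).erase u ⊆ K.L u z ∧ t1 ∈ K.L u z ∧ t1 ∈ K.L t z := by
          intro u hu
          rcases (cs u hu (hall u hu)).2 with h' | h' | h'
          · omega
          · omega
          · exact ⟨h'.2.1, h'.2.2.1, h'.2.2.2.1⟩
        obtain ⟨x, y, w, hxy, hxw, hyw, hG⟩ := Finset.card_eq_three.mp j3
        have hx : x ∈ K.Gr t z := by rw [hG]; simp
        have hy : y ∈ K.Gr t z := by rw [hG]; simp
        have hw : w ∈ K.Gr t z := by rw [hG]; simp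
        have hz1 : z ≠ t1 := by
          rintro rfl; exact not_L_self2 (cs3 x hx).2.2
        have hzt : z ≠ t := by rintro rfl; exact N_irr hz
        exact c.no_three hzt hz1 hyw hxy hxw (cs3 x hx).2.1 ((cs3 x hx).1 (Finset.mem_erase.mpr ⟨hxy.symm, hy⟩))
          ((cs3 x hx).1 (Finset.mem_erase.mpr ⟨hxw.symm, hw⟩)) (cs3 y hy).2.1
          ((cs3 y hy).1 (Finset.mem_erase.mpr ⟨hyw.symm, hw⟩)) (cs3 w hw).2.1
      · push Not at hall
        obtain ⟨x, hx, hxo⟩ := hall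
        have e1 := two _ (Finset.erase_subset x _) (by rw [Finset.card_erase_of_mem hx]; omega)
        have e2 := Finset.sum_erase_add (K.Gr t z) (fun u => pay K t u) hx
        have e3 := hpay x hxo
        simp only [e3] at e2
        omega
  · push Not at hd
    rw [Finset.sum_eq_zero fun u hu => hpay u (hd u hu)]
    omega

theorem sum8 (c : Ctx K t t1 h) (hn : (K.N t).card = 8) : 120 ≤ ∑ u ∈ K.N t, om K t u := by
  have e1 : ∑ z ∈ K.N t, (∑ u ∈ K.Gr t z, pay K t u + 30) ≤ ∑ z ∈ K.N t, (2 * om K t z + 2 * (15 - om K t z)) :=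
    Finset.sum_le_sum fun z hz => c.pay_le hn hz
  have e2 : ∑ z ∈ K.N t, ∑ u ∈ K.Gr t z, pay K t u = ∑ u ∈ K.N t, 2 * (15 - om K t u) := by
    rw [Finset.sum_comm' (t' := K.N t) (s' := fun u => K.Gr t u)]
    · refine Finset.sum_congr rfl fun u hu => ?_
      rw [Finset.sum_const, smul_eq_mul, c.pay_sum hu]
    · intro x y
      constructor
      · rintro ⟨h1, h2⟩; exact ⟨Gr_symm h1 h2, Gr_N h2⟩
      · rintro ⟨h1, h2⟩; exact ⟨Gr_N h1, Gr_symm h2 h1⟩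
  rw [Finset.sum_add_distrib, Finset.sum_add_distrib, e2, Finset.sum_const, hn, smul_eq_mul, ← Finset.mul_sum, ← Finset.mul_sum] at e1
  omega

end Ctx
end SComplex

namespace SComplex
variable {K : SComplex}
namespace Ctx
variable {t t1 h : ℕ}

theorem tri {u z : ℕ} (hz : z ∈ K.Gr t u) (ho : om K t u < 12) :
    (K.Gr t u).card = 1 ∧ ((K.Out t u = {z} ∧ 6 ≤ om K t u) ∨
      ∃ v, v ∉ K.N t ∧ K.Out t u = {v, z} ∧ 0 < gv K t u v ∧ 9 ≤ om K t u) := by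
  have o3 := om3 (K := K) (t := t) (u := u)
  have oc := Out_card (K := K) (t := t) (u := u)
  have ju : 1 ≤ (K.Gr t u).card := Finset.card_pos.mpr ⟨z, hz⟩
  have j1 : (K.Gr t u).card = 1 := by omega
  refine ⟨j1, ?_⟩
  by_cases hc : (K.Out t u).card = 1
  · left
    obtain ⟨a, ha⟩ := Finset.card_eq_one.mp hc
    have := Gr_Out hz
    rw [ha, Finset.mem_singleton] at this
    subst this
    exact ⟨ha, by omega⟩
  · right
    obtain ⟨v, hv⟩ := Finset.card_eq_one.mp (show (K.Out t u \ K.N t).card = 1 by omega)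
    have e1 := om_eq (K := K) (t := t) (u := u)
    rw [hv, Finset.sum_singleton] at e1
    have hvm : v ∈ K.Out t u \ K.N t := by rw [hv]; simp
    rw [Finset.mem_sdiff] at hvm
    refine ⟨v, hvm.2, ?_, by omega, by omega⟩
    symm
    refine Finset.eq_of_subset_of_card_le ?_ ?_
    · intro y
      rw [Finset.mem_insert, Finset.mem_singleton]
      rintro (rfl | rfl)
      · exact hvm.1
      · exact Gr_Out hz
    · rw [Finset.card_pair]
      · omega
      · rintro rfl; exact hvm.2 (Gr_N hz)

/-- demand on `z` -/
def Dm (K : SComplex) (t z : ℕ) : ℕ := ∑ u ∈ K.Gr t z, (12 - om K t u)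

theorem Dm_sum (c : Ctx K t t1 h) : ∑ z ∈ K.N t, Dm K t z = ∑ u ∈ K.N t, (12 - om K t u) := by
  unfold Dm
  rw [Finset.sum_comm' (t' := K.N t) (s' := fun u => K.Gr t u)]
  · refine Finset.sum_congr rfl fun u hu => ?_
    rw [Finset.sum_const, smul_eq_mul]
    by_cases ho : om K t u < 12
    · obtain ⟨z, hz⟩ := c.j_ge hu
      rw [(tri hz ho).1, one_mul]
    · rw [show 12 - om K t u = 0 by omega, mul_zero]
  · intro x y
    constructor
    · rintro ⟨h1, h2⟩; exact ⟨Gr_symm h1 h2, Gr_N h2⟩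
    · rintro ⟨h1, h2⟩; exact ⟨Gr_N h1, Gr_symm h2 h1⟩

theorem ge6 {u z : ℕ} (hz : z ∈ K.Gr t u) : 6 ≤ om K t u := by
  have o3 := om3 (K := K) (t := t) (u := u)
  have oc := Out_card (K := K) (t := t) (u := u)
  have ju : 1 ≤ (K.Gr t u).card := Finset.card_pos.mpr ⟨z, hz⟩
  omega

theorem Sp_of_Out {u z : ℕ} (hz : z ∈ K.N t) (hu : u ∈ K.Gr t z) (hO : K.Out t u = {z}) : u ∈ Sp K t z := by
  refine Finset.mem_filter.mpr ⟨hu, fun y hy => ?_⟩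
  by_contra hc
  have := XOut (mem_Gr.mp (Gr_symm hz hu)).2.1 hy hc
  rw [hO, Finset.mem_singleton] at this
  subst this
  exact not_L_self2 hy

theorem mainA (c : Ctx K t t1 h) {z : ℕ} (hz : z ∈ K.N t) (hh : z = t1 → (K.Gr t t1).card < 6) :
    Dm K t z + 12 ≤ om K t z + (12 - om K t z) := by
  have hd : ∀ u ∈ K.Gr t z, om K t u < 12 → u ∈ Sp K t z ∨ (u = t1 ∧ 9 ≤ om K t u ∧ ∃ v, v ∉ K.N t ∧ K.Out t u = {v, z}) := by
    intro u hu ho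
    rcases (tri (Gr_symm hz hu) ho).2 with h' | ⟨v, h1, h2, h3, h4⟩
    · exact Or.inl (Sp_of_Out hz hu h'.1)
    · by_cases h5 : u = t1
      · exact Or.inr ⟨h5, h4, v, h1, h2⟩
      · exfalso
        have := c.type2 (Gr_N hu) h5 h2 h3 hz
        have := hh this.1
        omega
  have e0 : ∀ u ∈ K.Gr t z, 12 - om K t u ≤ 6 := by
    intro u hu
    have := ge6 (Gr_symm hz hu)
    omega
  have hSG : Sp K t z ⊆ K.Gr t z := Finset.filter_subset _ _
  have o3 := om_sub3 (K := K) (t := t) (u := z) (Finset.empty_subset _)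
  rw [Finset.card_empty] at o3
  have hS6 : ∑ u ∈ Sp K t z, (12 - om K t u) ≤ 6 * (Sp K t z).card := by
    have := Finset.sum_le_card_nsmul (Sp K t z) (fun u => 12 - om K t u) 6 (fun u hu => e0 u (hSG hu))
    rw [smul_eq_mul] at this
    omega
  by_cases hall : ∀ u ∈ K.Gr t z, om K t u < 12 → u ∈ Sp K t z
  · have e1 : Dm K t z = ∑ u ∈ Sp K t z, (12 - om K t u) := by
      unfold Dm
      symm
      refine Finset.sum_subset hSG fun u hu hu' => ?_
      by_contra hc
      exact hu' (hall u hu (by omega))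
    rcases (Sp K t z).eq_empty_or_nonempty with he | hne
    · rw [he, Finset.sum_empty] at e1
      omega
    · have := c.G2 hz hne
      omega
  · push Not at hall
    obtain ⟨u, hu, ho, huS⟩ := hall
    rcases hd u hu ho with h' | ⟨rfl, h9, v, hv, hO⟩
    · exact absurd h' huS
    have e1 : Dm K t z = (12 - om K t u) + ∑ u ∈ Sp K t z, (12 - om K t u) := by
      unfold Dm
      rw [← Finset.sum_insert (f := fun w => 12 - om K t w) huS]
      symm
      refine Finset.sum_subset (Finset.insert_subset hu hSG) fun w hw hw' => ?_
      rw [Finset.mem_insert, not_or] at hw'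
      by_contra hc
      rcases hd w hw (by omega) with h' | h'
      · exact hw'.2 h'
      · exact hw'.1 h'.1
    rcases (Sp K t z).eq_empty_or_nonempty with he | hne
    · rw [he, Finset.sum_empty] at e1
      have := c.edge30 hz hu
      omega
    · have g2 := c.G2 hz hne
      have hvO : ({v} : Finset ℕ) ⊆ K.Out t z \ K.N t := by
        rw [Finset.singleton_subset_iff, Finset.mem_sdiff]
        refine ⟨?_, hv⟩
        have hzu := Gr_symm hz hu
        have hns : ¬ K.L u z ⊆ K.L t u := fun h' => huS (Finset.mem_filter.mpr ⟨hu, h'⟩)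
        rw [Finset.not_subset] at hns
        obtain ⟨y, hy, hyn⟩ := hns
        have hyO := XOut (mem_Gr.mp hzu).2.1 hy hyn
        rw [hO, Finset.mem_insert, Finset.mem_singleton] at hyO
        rcases hyO with rfl | rfl
        · exact XOut (mem_Gr.mp hu).2.1 (by rw [L_comm]; exact hy) (fun h' => hv (L_sub_left h'))
        · exact absurd hy not_L_self2
      have o4 := om_sub3 hvO
      rw [Finset.card_singleton] at o4
      omega

theorem mainB {z : ℕ} (hz : z ∈ K.N t) : Dm K t z ≤ om K t z := by
  have o3 := om_sub3 (K := K) (t := t) (u := z) (Finset.empty_subset _)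
  have := Finset.sum_le_card_nsmul (K.Gr t z) (fun u => 12 - om K t u) 6 (fun u hu => by
    have := ge6 (Gr_symm hz hu)
    omega)
  rw [smul_eq_mul] at this
  unfold Dm
  omega

theorem sum10 (c : Ctx K t t1 h) (hn : 10 ≤ (K.N t).card) : 120 ≤ ∑ u ∈ K.N t, om K t u := by
  have ds := c.Dm_sum
  by_cases hb : t1 ∈ K.N t ∧ 6 ≤ (K.Gr t t1).card
  · have j := c.j_le hb.1
    have e1 : ∑ z ∈ (K.N t).erase t1, (Dm K t z + 12) ≤ ∑ z ∈ (K.N t).erase t1, (om K t z + (12 - om K t z)) := by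
      refine Finset.sum_le_sum fun z hz => c.mainA (Finset.mem_erase.mp hz).2 fun h' => ?_
      exact absurd h' (Finset.mem_erase.mp hz).1
    have e2 := mainB hb.1
    rw [Finset.sum_add_distrib, Finset.sum_add_distrib, Finset.sum_const, Finset.card_erase_of_mem hb.1, smul_eq_mul] at e1
    have f1 := Finset.sum_erase_add (K.N t) (fun z => Dm K t z) hb.1
    have f2 := Finset.sum_erase_add (K.N t) (fun z => om K t z) hb.1
    have f3 := Finset.sum_erase_add (K.N t) (fun z => 12 - om K t z) hb.1
    omega
  · have e1 : ∑ z ∈ K.N t, (Dm K t z + 12) ≤ ∑ z ∈ K.N t, (om K t z + (12 - om K t z)) := by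
      refine Finset.sum_le_sum fun z hz => c.mainA hz fun h' => ?_
      subst h'
      by_contra hc
      exact hb ⟨hz, by omega⟩
    rw [Finset.sum_add_distrib, Finset.sum_add_distrib, Finset.sum_const, smul_eq_mul] at e1
    omega

theorem def9 (c : Ctx K t t1 h) (hn : (K.N t).card = 9) {u z : ℕ} (hz : z ∈ K.N t) (hu : u ∈ K.Gr t z)
    (hu1 : u ≠ t1) (ho : om K t u < 12) : t1 ∈ K.L t z := by
  have hzu := Gr_symm hz hu
  rcases (tri hzu ho).2 with h' | ⟨v, h1, h2, h3, h4⟩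
  · have hs := (Finset.mem_filter.mp (Sp_of_Out hz hu h'.1)).2
    have e1 := jz (Gr_N hu) hzu
    rw [Finset.inter_eq_left.mpr hs] at e1
    have e2 := c.j_le hz
    have e3 := c.B1 u z (mem_Gr.mp hzu).1
    have : ¬ K.L u z ⊆ K.L u z \ K.L t z := by
      intro hc
      have := Finset.card_le_card hc
      omega
    rw [Finset.not_subset] at this
    obtain ⟨y, hy, hy'⟩ := this
    rw [Finset.mem_sdiff, not_and, not_not] at hy'
    have := c.pairA (mem_Gr.mp hzu).2.1 hy (hs hy) (hy' hy)
    rw [← this]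
    exact hy' hy
  · have := c.type2 (Gr_N hu) hu1 h2 h3 hz
    have e2 := c.j_le hz
    rw [← this.1] at this
    omega

theorem sum9 (c : Ctx K t t1 h) (hn : (K.N t).card = 9) : 120 ≤ ∑ u ∈ K.N t, om K t u := by
  have ds := c.Dm_sum
  have hA : ∀ z ∈ K.N t, Dm K t z + 12 ≤ om K t z + (12 - om K t z) := by
    intro z hz
    refine c.mainA hz fun h' => ?_
    have := c.j_le hz
    subst h'
    omega
  obtain ⟨x, z, hx, hz, hP⟩ : ∃ x z, x ∈ K.N t ∧ z ∈ K.Gr t x ∧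
      Dm K t x + Dm K t z + 36 ≤ om K t x + (12 - om K t x) + om K t z + (12 - om K t z) := by
    have hD0 : ∀ z ∈ K.N t, t1 ∉ K.L t z → t1 ∉ K.Gr t z → Dm K t z = 0 := by
      intro z hz h1 h2
      refine Finset.sum_eq_zero fun u hu => ?_
      by_contra hc
      refine h1 (c.def9 hn hz hu ?_ (by omega))
      rintro rfl; exact h2 hu
    by_cases ht : t1 ∈ K.N t
    · obtain ⟨z, hz⟩ := c.j_ge ht
      refine ⟨t1, z, ht, hz, ?_⟩
      have d1 := hD0 t1 ht not_L_self2 (fun h' => N_irr (mem_Gr.mp h').1)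
      have hz1 := Gr_symm ht hz
      have d2 : Dm K t z = 12 - om K t t1 := by
        unfold Dm
        refine Finset.sum_eq_single_of_mem t1 hz1 fun u hu hne => ?_
        by_contra hc
        exact (mem_Gr.mp hz1).2.1 (c.def9 hn (Gr_N hz) hu hne (by omega))
      have := c.edge36 ht hz (fun h' => not_L_self2 h'.1)
      omega
    · have hnl : ∀ z, t1 ∉ K.L t z := fun z h' => ht (L_sub_left h')
      have hng : ∀ z, t1 ∉ K.Gr t z := fun z h' => ht (Gr_N h')
      obtain ⟨x, hx⟩ := Finset.card_pos.mp (show 0 < (K.N t).card by omega)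
      obtain ⟨z, hz⟩ := c.j_ge hx
      refine ⟨x, z, hx, hz, ?_⟩
      rw [hD0 x hx (hnl x) (hng x), hD0 z (Gr_N hz) (hnl z) (hng z)]
      have := c.edge36 hx hz (fun h' => hnl _ h'.1)
      omega
  have hzx : z ∈ (K.N t).erase x := Finset.mem_erase.mpr ⟨by rintro rfl; exact N_irr (mem_Gr.mp hz).1, Gr_N hz⟩
  have e1 : ∑ y ∈ ((K.N t).erase x).erase z, (Dm K t y + 12) ≤ ∑ y ∈ ((K.N t).erase x).erase z, (om K t y + (12 - om K t y)) :=
    Finset.sum_le_sum fun y hy => hA y (Finset.mem_of_mem_erase (Finset.mem_of_mem_erase hy))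
  rw [Finset.sum_add_distrib, Finset.sum_add_distrib, Finset.sum_const, Finset.card_erase_of_mem hzx,
    Finset.card_erase_of_mem hx, smul_eq_mul, hn] at e1
  have g : ∀ f : ℕ → ℕ, ∑ y ∈ ((K.N t).erase x).erase z, f y + f z + f x = ∑ y ∈ K.N t, f y := fun f => by
    rw [Finset.sum_erase_add _ _ hzx, Finset.sum_erase_add _ _ hx]
  have f1 := g (fun z => Dm K t z)
  have f2 := g (fun z => om K t z)
  have f3 := g (fun z => 12 - om K t z)
  omega

theorem main (c : Ctx K t t1 h) : 4 * K.vertexSet.card + 3 * h ≤ K.fnum 1 := by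
  refine c.reduction ?_
  have := c.n8
  by_cases h8 : (K.N t).card = 8
  · exact c.sum8 h8
  by_cases h9 : (K.N t).card = 9
  · exact c.sum9 h9
  exact c.sum10 (by omega)

end Ctx
end SComplex

namespace SComplex
/-- Theorem 5.5: if `K ∈ R₂` with distinguished singular vertex `t` whose link is a
connected sum of `h` copies of `ℝP²` (`h` odd; Euler characteristic `2 − h`), the
other singular link being `ℝP²` (Euler characteristic `1`), then
`f₁(K) ≥ 4 f₀(K) + 3h`, i.e. `g₂(K) ≥ 10 + 3h`. -/
theorem statement18 (K : SComplex) (t t₁ : ℕ) (h : ℕ) (hK : InClassR K)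
    (hne : t ≠ t₁)
    (hsing : {v | K.IsSingular v} = {t, t₁})
    (ht₁ : (K.lk {t₁}).euler = 1)
    (hodd : Odd h)
    (ht : (K.lk {t}).euler = 2 - (h : ℤ))
    (hmax : ∀ v, K.IsSingular v → (K.lk {t}).euler ≤ (K.lk {v}).euler) :
    4 * (K.fnum 0 : ℤ) + 3 * (h : ℤ) ≤ (K.fnum 1 : ℤ) ∧
    10 + 3 * (h : ℤ) ≤ K.g2 := by
  have m1 : K.IsSingular t := by
    have : t ∈ {v | K.IsSingular v} := by rw [hsing]; simp
    exact this
  have m2 : K.IsSingular t₁ := by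
    have : t₁ ∈ {v | K.IsSingular v} := by rw [hsing]; simp
    exact this
  have hpos := hodd.pos
  have hχ : (K.lk {t}).euler ≤ 1 := by rw [ht]; omega
  have np := NP.ofNPM hK.1
  have hsph : ∀ v, v ≠ t → v ≠ t₁ → {v} ∈ K.faces → K.HasSphereLink 3 v := by
    intro v h1 h2 h3
    by_contra hc
    have : v ∈ {v | K.IsSingular v} := ⟨h3, hc⟩
    rw [hsing] at this
    simp only [Set.mem_insert_iff, Set.mem_singleton_iff] at this
    tauto
  have hv : ∀ {v p q : ℕ}, q ∈ K.L v p → {v} ∈ K.faces := fun h' =>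
    mem_vertexSet.mp (N_vert (N_symm.mp (L_sub_left h')))
  have c : Ctx K t t₁ h :=
    { np := np
      ne := hne
      tV := mem_vertexSet.mpr m1.1
      t1V := mem_vertexSet.mpr m2.1
      B1 := fun x y hy => SComplex.B1 hK m1.1 hχ hy
      B2 := fun x y hy => SComplex.B2 hK m1.1 hχ hy
      B3 := fun v h1 h2 a b c e1 e2 e3 => SComplex.B3 hK (hsph v h1 h2 (hv e1)) e1 e2 e3
      B3' := fun v h1 h2 p q e1 => SComplex.B3' hK (hsph v h1 h2 (hv e1)) e1
      six := fun x => by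
        have := B6 np x
        generalize (K.lk {x}).euler = e at this
        push_cast [← Nat.cast_sum] at this
        omega
      sumt := by
        have := B6 np t
        rw [ht] at this
        push_cast [← Nat.cast_sum] at this
        omega
      sumt1 := by
        have := B6 np t₁
        rw [ht₁] at this
        push_cast [← Nat.cast_sum] at this
        omega
      hodd := hodd }
  have hm := c.main
  rw [← fnum_zero] at hm
  have h1 : 4 * (K.fnum 0 : ℤ) + 3 * (h : ℤ) ≤ (K.fnum 1 : ℤ) := by exact_mod_cast hm
  refine ⟨h1, ?_⟩
  unfold g2
  omega

end SComplex
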